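/- For all k, there exists c = c(k) such that every graph in F_2 with no star cutset and with treewidth more than c contains a subdivision of the k-by-k wall W_{k×k} as an induced subgraph. -/

import Mathlib

open SimpleGraph Set List

namespace Paper

variable {V : Type} {W : Type}

/-- The closed neighborhood `N[v]` of a vertex. -/
def closedNbhd (G : SimpleGraph V) (v : V) : Set V := insert v (G.neighborSet v)

/-- The degree of a vertex (as the number of its neighbors). -/
noncomputable def deg (G : SimpleGraph V) (v : V) : ℕ := (G.neighborSet v).ncard

/-- `G` contains `H` as an induced subgraph, i.e. some induced subgraph of `G` is
isomorphic to `H`. -/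
def ContainsInduced (G : SimpleGraph V) (H : SimpleGraph W) : Prop :=
  ∃ s : Set V, Nonempty (H ≃g G.induce s)

/-- `(A, C, B)` is a separation of `G`. -/
def IsSeparation (G : SimpleGraph V) (A C B : Set V) : Prop :=
  A ∪ C ∪ B = Set.univ ∧ Disjoint A C ∧ Disjoint A B ∧ Disjoint C B ∧
    ∀ a ∈ A, ∀ b ∈ B, ¬G.Adj a b

/-- `G` admits a star cutset. -/
def HasStarCutset (G : SimpleGraph V) : Prop :=
  ∃ A C B : Set V, IsSeparation G A C B ∧ A.Nonempty ∧ B.Nonempty ∧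
    ∃ v ∈ C, C ⊆ closedNbhd G v

/-- `G` admits a clique cutset. -/
def HasCliqueCutset (G : SimpleGraph V) : Prop :=
  ∃ A C B : Set V, IsSeparation G A C B ∧ A.Nonempty ∧ B.Nonempty ∧ G.IsClique C

/-- `D` is a connected component of `G \ X`: a maximal connected subset of `Xᶜ`. -/
def IsComponentOf (G : SimpleGraph V) (X : Set V) (D : Set V) : Prop :=
  D.Nonempty ∧ D ⊆ Xᶜ ∧ (G.induce D).Connected ∧
    ∀ D' : Set V, D ⊆ D' → D' ⊆ Xᶜ → (G.induce D').Connected → D' = D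

/-- An induced path in `G` ("path" in the paper always means induced path). -/
def IsIPath (G : SimpleGraph V) {u v : V} (P : G.Walk u v) : Prop :=
  P.IsPath ∧ P.toSubgraph.IsInduced

/-- A hole: an induced cycle of length at least four. -/
def IsHole (G : SimpleGraph V) {v : V} (c : G.Walk v v) : Prop :=
  c.IsCycle ∧ 4 ≤ c.length ∧ c.toSubgraph.IsInduced

/-- `G` is sparse: for every hole and every vertex not in it, there is an edge `ab` of the
hole containing all neighbors of the vertex in the hole. -/
def Sparse (G : SimpleGraph V) : Prop :=
  ∀ (v : V) (c : G.Walk v v), IsHole G c → ∀ x, x ∉ c.support →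
    ∃ a b, c.toSubgraph.Adj a b ∧ ∀ y ∈ c.support, G.Adj x y → y = a ∨ y = b

/-- `G` contains a pyramid (necessarily as an induced subgraph). -/
def ContainsPyramid (G : SimpleGraph V) : Prop :=
  ∃ (a b₁ b₂ b₃ : V) (P₁ : G.Walk a b₁) (P₂ : G.Walk a b₂) (P₃ : G.Walk a b₃),
    G.Adj b₁ b₂ ∧ G.Adj b₂ b₃ ∧ G.Adj b₁ b₃ ∧
    IsIPath G P₁ ∧ IsIPath G P₂ ∧ IsIPath G P₃ ∧
    1 ≤ P₁.length ∧ 1 ≤ P₂.length ∧ 1 ≤ P₃.length ∧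
    ¬(P₁.length = 1 ∧ P₂.length = 1) ∧ ¬(P₁.length = 1 ∧ P₃.length = 1) ∧
    ¬(P₂.length = 1 ∧ P₃.length = 1) ∧
    (∀ p ∈ P₁.support, p ≠ a → ∀ q ∈ P₂.support, q ≠ a →
      p ≠ q ∧ (G.Adj p q → p = b₁ ∧ q = b₂)) ∧
    (∀ p ∈ P₁.support, p ≠ a → ∀ q ∈ P₃.support, q ≠ a →
      p ≠ q ∧ (G.Adj p q → p = b₁ ∧ q = b₃)) ∧
    (∀ p ∈ P₂.support, p ≠ a → ∀ q ∈ P₃.support, q ≠ a →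
      p ≠ q ∧ (G.Adj p q → p = b₂ ∧ q = b₃))

/-- `G` contains a prism (necessarily as an induced subgraph). -/
def ContainsPrism (G : SimpleGraph V) : Prop :=
  ∃ (a₁ a₂ a₃ b₁ b₂ b₃ : V) (P₁ : G.Walk a₁ b₁) (P₂ : G.Walk a₂ b₂) (P₃ : G.Walk a₃ b₃),
    G.Adj a₁ a₂ ∧ G.Adj a₂ a₃ ∧ G.Adj a₁ a₃ ∧
    G.Adj b₁ b₂ ∧ G.Adj b₂ b₃ ∧ G.Adj b₁ b₃ ∧
    IsIPath G P₁ ∧ IsIPath G P₂ ∧ IsIPath G P₃ ∧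
    1 ≤ P₁.length ∧ 1 ≤ P₂.length ∧ 1 ≤ P₃.length ∧
    (∀ p ∈ P₁.support, ∀ q ∈ P₂.support,
      p ≠ q ∧ (G.Adj p q → (p = a₁ ∧ q = a₂) ∨ (p = b₁ ∧ q = b₂))) ∧
    (∀ p ∈ P₁.support, ∀ q ∈ P₃.support,
      p ≠ q ∧ (G.Adj p q → (p = a₁ ∧ q = a₃) ∨ (p = b₁ ∧ q = b₃))) ∧
    (∀ p ∈ P₂.support, ∀ q ∈ P₃.support,
      p ≠ q ∧ (G.Adj p q → (p = a₂ ∧ q = a₃) ∨ (p = b₂ ∧ q = b₃)))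

/-- `G` is very sparse: sparse, pyramid-free and prism-free. -/
def VerySparse (G : SimpleGraph V) : Prop :=
  Sparse G ∧ ¬ContainsPyramid G ∧ ¬ContainsPrism G

/-- `G ∈ 𝓕_t`: `G` is very sparse with no clique of size at least `t+1`. -/
def MemF (t : ℕ) (G : SimpleGraph V) : Prop :=
  VerySparse G ∧ ∀ s : Set V, G.IsClique s → s.ncard ≤ t

/-- `G` has a tree decomposition of width at most `k`. -/
def HasTreewidthAtMost (G : SimpleGraph V) (k : ℕ) : Prop :=
  ∃ (ι : Type) (T : SimpleGraph ι) (χ : ι → Finset V),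
    T.IsTree ∧
    (∀ v : V, ∃ t, v ∈ χ t) ∧
    (∀ u v : V, G.Adj u v → ∃ t, u ∈ χ t ∧ v ∈ χ t) ∧
    (∀ v : V, (T.induce {t | v ∈ χ t}).Connected) ∧
    ∀ t, (χ t).card ≤ k + 1

/-- The `n`-by-`n` wall, as a brick wall graph: `n` rows of `2n` vertices each,
with horizontal path edges in each row, and vertical edges between consecutive
rows placed alternately. -/
def Wall (n : ℕ) : SimpleGraph (Fin n × Fin (2 * n)) :=
  SimpleGraph.fromRel (fun a b =>
    (a.1 = b.1 ∧ a.2.val + 1 = b.2.val) ∨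
    (a.2 = b.2 ∧ a.1.val + 1 = b.1.val ∧ (a.1.val + a.2.val) % 2 = 0))

/-- The graph obtained from `G` by subdividing the edge `uv` once (the new vertex
is `none`). -/
def subdivideEdge (G : SimpleGraph V) (u v : V) : SimpleGraph (Option V) :=
  SimpleGraph.fromRel (fun a b =>
    (∃ x y : V, a = some x ∧ b = some y ∧ G.Adj x y ∧ ¬(x = u ∧ y = v) ∧ ¬(x = v ∧ y = u)) ∨
    (a = none ∧ (b = some u ∨ b = some v)))

/-- `IsSubdivision G H`: `G` is (isomorphic to) a graph obtained from `H` by repeatedly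
subdividing edges. -/
inductive IsSubdivision : {α : Type} → SimpleGraph α → {β : Type} → SimpleGraph β → Prop where
  | base {α β : Type} {G : SimpleGraph α} {H : SimpleGraph β} :
      Nonempty (G ≃g H) → IsSubdivision G H
  | step {α β : Type} {G : SimpleGraph α} {H : SimpleGraph β} (u v : β) :
      H.Adj u v → IsSubdivision G (subdivideEdge H u v) → IsSubdivision G H

/-- `G` contains a subdivision of the `t`-by-`t` wall as an induced subgraph. -/
def ContainsWallSubdiv (G : SimpleGraph V) (t : ℕ) : Prop :=
  ∃ (α : Type) (S : SimpleGraph α), IsSubdivision S (Wall t) ∧ ContainsInduced G S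

/-- `G` contains the line graph of a subdivision of the `t`-by-`t` wall as an induced
subgraph. -/
def ContainsLineWallSubdiv (G : SimpleGraph V) (t : ℕ) : Prop :=
  ∃ (α : Type) (S : SimpleGraph α), IsSubdivision S (Wall t) ∧
    ContainsInduced G S.lineGraph

/-- `G` is `𝓣₁`-free: no vertex has two or more neighbors in a hole not containing it. -/
def T1Free (G : SimpleGraph V) : Prop :=
  ∀ (v : V) (c : G.Walk v v), IsHole G c → ∀ x, x ∉ c.support →
    ∀ y z, y ∈ c.support → z ∈ c.support → G.Adj x y → G.Adj x z → y = z

/-- `G` is `𝓣₂`-free: no vertex has two non-adjacent neighbors in a hole not containing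
it, and `G` is pyramid-free and prism-free. -/
def T2Free (G : SimpleGraph V) : Prop :=
  (∀ (v : V) (c : G.Walk v v), IsHole G c → ∀ x, x ∉ c.support →
    ∀ y z, y ∈ c.support → z ∈ c.support → G.Adj x y → G.Adj x z → y ≠ z → G.Adj y z) ∧
  ¬ContainsPyramid G ∧ ¬ContainsPrism G

/-- The weight `w(X)` of a set of vertices. -/
noncomputable def setW (w : V → ℝ) (X : Set V) : ℝ := ∑ᶠ x ∈ X, w x

/-- `w` is a weight function on `G`: values in `[0,1]` with total weight `1`. -/
def IsWeightFn (w : V → ℝ) : Prop :=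
  (∀ v, 0 ≤ w v ∧ w v ≤ 1) ∧ setW w Set.univ = 1

/-- `X` is a `(w, c)`-balanced separator. -/
def IsBalSep (G : SimpleGraph V) (w : V → ℝ) (c : ℝ) (X : Set V) : Prop :=
  ∀ D, IsComponentOf G X D → setW w D ≤ c

/-- `(G, w)` is `d`-unbalanced: `w` is a weight function and there is no
`(w, 1/2)`-balanced separator of size at most `d`. -/
def Unbalanced (G : SimpleGraph V) (w : V → ℝ) (d : ℕ) : Prop :=
  IsWeightFn w ∧ ∀ X : Set V, X.ncard ≤ d → ¬IsBalSep G w (1 / 2 : ℝ) X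

/-- `B = B(K₁,K₂)` is the (unique) component of `G ∖ (K₁ ∪ K₂)` of weight more
than `1/2`.  Then `A(K₁,K₂) = (B ∪ K₁ ∪ K₂)ᶜ` and `S(K₁,K₂) = (A, K₁ ∪ K₂, B)` is the
canonical two-clique-separation for `{K₁, K₂}`. -/
def IsCanonicalB (G : SimpleGraph V) (w : V → ℝ) (K₁ K₂ B : Set V) : Prop :=
  IsComponentOf G (K₁ ∪ K₂) B ∧ (1 / 2 : ℝ) < setW w B

/-- The open neighborhood `N(D)` of a set of vertices. -/
def nbhdOfSet (G : SimpleGraph V) (D : Set V) : Set V :=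
  {v | v ∉ D ∧ ∃ d ∈ D, G.Adj v d}

/-- The canonical two-clique-separation `S(K₁,K₂)` (with big side `B`) is proper. -/
def ProperPair (G : SimpleGraph V) (w : V → ℝ) (K₁ K₂ B : Set V) : Prop :=
  IsCanonicalB G w K₁ K₂ B ∧
  (∃ D, IsComponentOf G (K₁ ∪ K₂) D ∧ D ⊆ (B ∪ K₁ ∪ K₂)ᶜ ∧
    K₁ ∪ K₂ ⊆ nbhdOfSet G D) ∧
  (K₁.ncard = 1 → K₂.ncard = 1 →
    ¬∃ (x y : V) (P : G.Walk x y), K₁ = {x} ∧ K₂ = {y} ∧ IsIPath G P ∧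
      {v | v ∈ P.support} = (B ∪ K₁ ∪ K₂)ᶜ ∪ K₁ ∪ K₂)

/-- The canonical two-clique-separation `S(K₁,K₂)` (with big side `B`) is active,
where `K` bounds the size of the cliques considered. -/
def ActivePair (G : SimpleGraph V) (w : V → ℝ) (K : ℕ) (K₁ K₂ B : Set V) : Prop :=
  ProperPair G w K₁ K₂ B ∧
  ∀ K₁' K₂' B' : Set V, G.IsClique K₁' → G.IsClique K₂' →
    K₁'.ncard ≤ K → K₂'.ncard ≤ K → ProperPair G w K₁' K₂' B' →
    K₁ ∪ K₂ ≠ K₁' ∪ K₂' →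
      ¬(B' ∪ K₁' ∪ K₂' ⊂ B ∪ K₁ ∪ K₂) ∧
      (B' ∪ K₁' ∪ K₂' = B ∪ K₁ ∪ K₂ → B' ⊂ B)

/-- The interiors of two paths from `a` to `b` are disjoint and anticomplete. -/
def IntDisjAnti (G : SimpleGraph V) {a b : V} (P Q : G.Walk a b) : Prop :=
  ∀ x ∈ P.support, x ≠ a → x ≠ b → ∀ y ∈ Q.support, y ≠ a → y ≠ b → x ≠ y ∧ ¬G.Adj x y

/-- `Q₁, Q₂, Q₃` form a theta (as an induced subgraph of `G`) with ends `a, b`. -/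
def ThetaCfg (G : SimpleGraph V) {a b : V} (Q₁ Q₂ Q₃ : G.Walk a b) : Prop :=
  ¬G.Adj a b ∧
  IsIPath G Q₁ ∧ IsIPath G Q₂ ∧ IsIPath G Q₃ ∧
  2 ≤ Q₁.length ∧ 2 ≤ Q₂.length ∧ 2 ≤ Q₃.length ∧
  IntDisjAnti G Q₁ Q₂ ∧ IntDisjAnti G Q₁ Q₃ ∧ IntDisjAnti G Q₂ Q₃

/-- There is a theta through the seagull `a-v-u` in `G`: a theta one of whose ends is
`a` or `u` and which contains the seagull. -/
def ThetaThroughSeagull (G : SimpleGraph V) (a v u : V) : Prop :=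
  (∃ (b : V) (Q₁ Q₂ Q₃ : G.Walk a b), ThetaCfg G Q₁ Q₂ Q₃ ∧ [a, v, u] <+: Q₁.support) ∨
  (∃ (b : V) (Q₁ Q₂ Q₃ : G.Walk u b), ThetaCfg G Q₁ Q₂ Q₃ ∧ [u, v, a] <+: Q₁.support)

/-- `a-v-u` is a heavy seagull in `G`: an induced three-vertex path whose ends both
have degree at least three. -/
def HeavySeagull (G : SimpleGraph V) (a v u : V) : Prop :=
  a ≠ u ∧ G.Adj a v ∧ G.Adj v u ∧ ¬G.Adj a u ∧ 3 ≤ deg G a ∧ 3 ≤ deg G u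

end Paper

local notation "om" => by omega

namespace Paper
variable {V : Type}
def Conn (G : SimpleGraph V) (S : Set V) : Prop :=
  S.Nonempty ∧ ∀ P : V → Prop, (∃ x ∈ S, P x) →
    (∀ u ∈ S, ∀ v ∈ S, G.Adj u v → P u → P v) → ∀ y ∈ S, P y
def Mt (A B : Set V) : Prop := ∃ x, x ∈ A ∧ x ∈ B
theorem not_mt {A B : Set V} : ¬ Mt A B ↔ Disjoint A B := by
  rw [Set.disjoint_left]; simp [Mt]
def comp (G : SimpleGraph V) (S : Set V) (x : V) : Set V :=
  {y | Relation.ReflTransGen (fun u v => G.Adj u v ∧ v ∈ S) x y}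
section basics
variable {G : SimpleGraph V} {S T C : Set V} {x y : V}
theorem conn_single (G : SimpleGraph V) (x : V) : Conn G {x} := by
  refine ⟨⟨x, rfl⟩, ?_⟩
  grind
theorem Conn.mono {G' : SimpleGraph V} (h : Conn G S) (hG : G ≤ G') : Conn G' S :=
  ⟨h.1, fun P h1 h2 => h.2 P h1 fun u hu v hv ha => h2 u hu v hv (hG ha)⟩
theorem Conn.union (hS : Conn G S) (hT : Conn G T)
    (h : ∃ x ∈ S, ∃ y ∈ T, x = y ∨ G.Adj x y) : Conn G (S ∪ T) := by
  refine ⟨hS.1.mono subset_union_left, ?_⟩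
  rintro P ⟨z, hz, hPz⟩ hcl
  obtain ⟨x, hx, y, hy, hxy⟩ := h
  have h1 : ∀ z ∈ S, P z → ∀ w ∈ S, P w := fun z hz hp =>
    hS.2 P ⟨z, hz, hp⟩ fun u hu v hv => hcl u (.inl hu) v (.inl hv)
  have h2 : ∀ z ∈ T, P z → ∀ w ∈ T, P w := fun z hz hp =>
    hT.2 P ⟨z, hz, hp⟩ fun u hu v hv => hcl u (.inr hu) v (.inr hv)
  have h3 : P x ↔ P y := by
    rcases hxy with rfl | ha
    · rfl
    · exact ⟨hcl x (.inl hx) y (.inr hy) ha, hcl y (.inr hy) x (.inl hx) ha.symm⟩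
  grind
theorem Conn.ins (hS : Conn G S) (h : ∃ y ∈ S, G.Adj x y) : Conn G (insert x S) := by
  obtain ⟨y, hy, ha⟩ := h
  exact (conn_single G x).union hS ⟨x, rfl, y, hy, .inr ha⟩
theorem Conn.biUnion {ι : Type*} {I : Set ι} {A : ι → Set V} (hC : Conn G C)
    (hA : ∀ i ∈ I, Conn G (A i)) (h : ∀ i ∈ I, ∃ x ∈ C, ∃ y ∈ A i, x = y ∨ G.Adj x y) :
    Conn G (C ∪ ⋃ i ∈ I, A i) := by
  refine ⟨hC.1.mono subset_union_left, ?_⟩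
  rintro P ⟨z, hz, hPz⟩ hcl
  have key : ∀ i ∈ I, ∀ z ∈ C ∪ A i, P z → ∀ w ∈ C ∪ A i, P w := by
    intro i hi z hz hp
    have hsub : C ∪ A i ⊆ C ∪ ⋃ i ∈ I, A i :=
      union_subset_union_right _ (subset_biUnion_of_mem hi)
    exact (hC.union (hA i hi) (h i hi)).2 P ⟨z, hz, hp⟩
      fun u hu v hv => hcl u (hsub hu) v (hsub hv)
  have hCC : ∀ z ∈ C, P z → ∀ w ∈ C, P w := fun z hz hp =>
    hC.2 P ⟨z, hz, hp⟩ fun u hu v hv => hcl u (.inl hu) v (.inl hv)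
  obtain ⟨c, hc⟩ := hC.1
  have hPc : P c := by
    rcases hz with hz | hz
    · grind
    · simp only [mem_iUnion] at hz
      grind
  rintro w (hw | hw)
  · grind
  · simp only [mem_iUnion] at hw
    grind
theorem mem_comp_self : x ∈ comp G S x := Relation.ReflTransGen.refl
theorem comp_sub (hx : x ∈ S) : comp G S x ⊆ S := by
  intro y hy
  induction hy with
  | refl => exact hx
  | tail _ h _ => exact h.2
theorem comp_closed {z : V} (hy : y ∈ comp G S x) (h : G.Adj y z) (hz : z ∈ S) :
    z ∈ comp G S x := Relation.ReflTransGen.tail hy ⟨h, hz⟩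
theorem comp_conn (hx : x ∈ S) : Conn G (comp G S x) := by
  refine ⟨⟨x, mem_comp_self⟩, ?_⟩
  rintro P ⟨z, hz, hPz⟩ hcl
  have key : ∀ w, w ∈ comp G S x → (P w ↔ P x) := by
    intro w hw
    induction hw with
    | refl => rfl
    | @tail b c hb h ih =>
      have hb' : b ∈ comp G S x := hb
      have hc' := comp_closed hb' h.1 h.2
      rw [← ih]
      exact ⟨hcl _ hc' _ hb' h.1.symm, hcl _ hb' _ hc' h.1⟩
  grind
theorem Conn.edge (hC : Conn G C) (h1 : ∃ x ∈ C, x ∈ T) (h2 : ∃ x ∈ C, x ∉ T) :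
    ∃ u ∈ C, ∃ v ∈ C, u ∈ T ∧ v ∉ T ∧ G.Adj u v := by
  by_contra! h
  obtain ⟨y, hy, hyT⟩ := h2
  exact hyT (hC.2 (· ∈ T) h1 (fun u hu v hv ha hu' => by
    grind) y hy)
end basics
def IsP (G : SimpleGraph V) (f : ℕ → V) (n : ℕ) : Prop :=
  (∀ i, i < n → G.Adj (f i) (f (i + 1))) ∧
  ∀ i j, i < j → j ≤ n → f i ≠ f j ∧ (G.Adj (f i) (f j) → j = i + 1)
theorem conn_seg {G : SimpleGraph V} {f : ℕ → V} {i j : ℕ} (hij : i ≤ j)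
    (h : ∀ t, i ≤ t → t < j → G.Adj (f t) (f (t + 1))) : Conn G (f '' Icc i j) := by
  induction j, hij using Nat.le_induction with
  | base => simpa using conn_single G (f i)
  | succ j hj ih =>
    have h1 := (ih fun t h1 h2 => h t h1 om).ins
      ⟨f j, ⟨j, by simp [hj], rfl⟩, (h j hj om).symm⟩
    have : Icc i (j + 1) = insert (j + 1) (Icc i j) := by
      ext t; simp; omega
    rw [this, image_insert_eq]; exact h1
theorem exists_walkf {G : SimpleGraph V} {C : Set V} (hC : Conn G C) {x y : V} (hx : x ∈ C)
    (hy : y ∈ C) : ∃ (f : ℕ → V) (n : ℕ), f 0 = x ∧ f n = y ∧ (∀ i ≤ n, f i ∈ C) ∧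
      ∀ i, i < n → G.Adj (f i) (f (i + 1)) := by
  refine hC.2 (fun y => ∃ (f : ℕ → V) (n : ℕ), f 0 = x ∧ f n = y ∧ (∀ i ≤ n, f i ∈ C) ∧
      ∀ i, i < n → G.Adj (f i) (f (i + 1))) ⟨x, hx, fun _ => x, 0, by simp [hx]⟩ ?_ y hy
  rintro u hu v hv ha ⟨f, n, h0, hn, hf, hadj⟩
  refine ⟨fun i => if i ≤ n then f i else v, n + 1, by simp [h0], by simp, ?_, ?_⟩
  · grind
  grind
theorem exists_path {G : SimpleGraph V} {C A B : Set V} (hC : Conn G C) (hA : Mt C A)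
    (hB : Mt C B) : ∃ (f : ℕ → V) (n : ℕ), f 0 ∈ A ∧ f n ∈ B ∧ (∀ i ≤ n, f i ∈ C) ∧
      IsP G f n ∧ (∀ i ≤ n, f i ∈ A → i = 0) ∧ ∀ i ≤ n, f i ∈ B → i = n := by
  classical
  let Q : ℕ → Prop := fun n => ∃ f : ℕ → V, f 0 ∈ A ∧ f n ∈ B ∧ (∀ i ≤ n, f i ∈ C) ∧
    ∀ i, i < n → G.Adj (f i) (f (i + 1))
  have hQ : ∃ n, Q n := by
    obtain ⟨x, hx, hxA⟩ := hA
    obtain ⟨y, hy, hyB⟩ := hB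
    obtain ⟨f, n, h0, hn, h⟩ := exists_walkf hC hx hy
    exact ⟨n, f, h0 ▸ hxA, hn ▸ hyB, h⟩
  obtain ⟨f, h0, hn, hf, hadj⟩ := Nat.find_spec hQ
  set n := Nat.find hQ with hndef
  have hmin : ∀ m, m < n → ¬ Q m := fun m hm => Nat.find_min hQ hm
  clear_value n
  have short : ∀ i j, i + 1 < j → j ≤ n → ¬ G.Adj (f i) (f j) := by
    intro i j hij hj ha
    refine hmin (n - (j - i - 1)) om ⟨fun t => if t ≤ i then f t else f (t + (j - i - 1)),
      by simp [h0], ?_, ?_, ?_⟩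
    · dsimp only; rw [if_neg om, show n - (j - i - 1) + (j - i - 1) = n by omega]; exact hn
    · intro t ht; dsimp only; split_ifs <;> exact hf _ om
    grind
  refine ⟨f, n, h0, hn, hf, ⟨hadj, ?_⟩, ?_, ?_⟩
  · intro i j hij hj
    refine ⟨fun he => ?_, fun ha => by
      grind⟩
    rcases Nat.lt_or_ge j n with h | h
    · grind
    · have hjn : j = n := om
      subst hjn
      exact hmin i hij ⟨f, h0, he ▸ hn, fun t ht => hf t om, fun t ht => hadj t om⟩
  · intro i hi hiA
    by_contra hne
    refine hmin (n - i) om ⟨fun t => f (t + i), by simpa using hiA, ?_, ?_, ?_⟩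
    · dsimp only; rw [Nat.sub_add_cancel hi]; exact hn
    · grind
    grind
  · intro i hi hiB
    by_contra hne
    exact hmin i om ⟨f, h0, hiB, fun t ht => hf t om, fun t ht => hadj t om⟩
theorem Conn.noncut [Finite V] {G : SimpleGraph V} {T : Set V} (hT : Conn G T) {v : V} (hv : v ∈ T)
    (h : ∃ w ∈ T, w ≠ v) : ∃ x ∈ T, x ≠ v ∧ Conn G (T \ {x}) := by
  let F : Set (Set V) := {K | Conn G K ∧ K ⊆ T ∧ v ∈ K ∧ K ≠ T}
  have hF : F.Nonempty := ⟨{v}, conn_single G v, by simpa using hv, rfl, by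
    grind⟩
  obtain ⟨K, hK⟩ := (Set.toFinite F).exists_maximal hF
  obtain ⟨⟨hKc, hKT, hvK, hne⟩, hmax⟩ := hK
  obtain ⟨w, hwT, hwK⟩ : ∃ w ∈ T, w ∉ K := by grind
  obtain ⟨u, huT, x, hxT, huK, hxK, ha⟩ := hT.edge ⟨v, hv, hvK⟩ ⟨w, hwT, hwK⟩
  have h1 : Conn G (insert x K) := hKc.ins ⟨u, huK, ha.symm⟩
  have h2 : insert x K = T := by grind
  refine ⟨x, hxT, by grind, ?_⟩
  rw [← h2, insert_diff_self_of_notMem hxK]; exact hKc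
end Paper

namespace Paper
variable {V : Type}
theorem trim {G : SimpleGraph V} {C A P : Set V} (hC : Conn G C) (hA : Mt C A) (hP : Mt C P) :
    ∃ D ⊆ C, Conn G D ∧ Mt D A ∧ (∃ p ∈ P, D ∩ P = {p}) ∧
      ∀ S ⊆ P, ∀ w ∈ D, w ∉ S → ∃ K ⊆ D, Conn G K ∧ w ∈ K ∧ Disjoint K S ∧ Mt K A := by
  obtain ⟨f, n, h0, hn, hf, hp, h1, h2⟩ := exists_path hC hA hP
  have hseg : ∀ m ≤ n, Conn G (f '' Icc 0 m) := fun m hm =>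
    conn_seg (Nat.zero_le _) fun t _ ht => hp.1 t om
  refine ⟨f '' Icc 0 n, ?_, hseg n le_rfl, ⟨f 0, ⟨0, by simp, rfl⟩, h0⟩, ⟨f n, hn, ?_⟩, ?_⟩
  · rintro _ ⟨i, hi, rfl⟩; exact hf i hi.2
  · grind
  · rintro S hS _ ⟨i, hi, rfl⟩ hw
    refine ⟨f '' Icc 0 i, image_mono (Icc_subset_Icc_right hi.2), hseg i hi.2, ⟨i, by simp, rfl⟩,
      ?_, ⟨f 0, ⟨0, by simp, rfl⟩, h0⟩⟩
    grind
def Lnk (G : SimpleGraph V) (A B : Set V) (k : ℕ) : Prop :=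
  ∃ C : Fin k → Set V, (∀ i, Conn G (C i) ∧ Mt (C i) A ∧ Mt (C i) B) ∧
    ∀ i j, i ≠ j → Disjoint (C i) (C j)
theorem lnk_of_index {G : SimpleGraph V} {A B : Set V} {k : ℕ} {I : Set V} (hI : k ≤ I.ncard)
    (C : V → Set V) (h : ∀ i ∈ I, Conn G (C i) ∧ Mt (C i) A ∧ Mt (C i) B)
    (hd : ∀ i ∈ I, ∀ j ∈ I, i ≠ j → Disjoint (C i) (C j)) : Lnk G A B k := by
  classical
  obtain ⟨J, hJI, hJ⟩ : ∃ J : Finset V, (J : Set V) ⊆ I ∧ J.card = k := by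
    rcases Nat.eq_zero_or_pos k with rfl | hk
    · exact ⟨∅, by simp⟩
    · have hfin : I.Finite := Set.finite_of_ncard_pos om
      rw [Set.ncard_eq_toFinset_card _ hfin] at hI
      obtain ⟨J, h1, h2⟩ := Finset.exists_subset_card_eq hI
      exact ⟨J, fun x hx => by simpa using h1 hx, h2⟩
  let e := (J.equivFinOfCardEq hJ).symm
  refine ⟨fun i => C (e i), fun i => h _ (hJI (e i).2), fun i j hij => hd _ (hJI (e i).2) _ (hJI (e j).2) ?_⟩
  intro he; exact hij (e.injective (Subtype.ext he))
theorem goering_side [Finite V] {G : SimpleGraph V} {A P : Set V} {k : ℕ} (h : Lnk G A P k)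
    (hP : P.ncard ≤ k) : P.ncard = k ∧ ∃ D : V → Set V, ∀ p ∈ P, (Conn G (D p) ∧ Mt (D p) A ∧ D p ∩ P = {p} ∧
      ∀ S ⊆ P, ∀ w ∈ D p, w ∉ S → ∃ K ⊆ D p, Conn G K ∧ w ∈ K ∧ Disjoint K S ∧ Mt K A) ∧
      ∀ q ∈ P, p ≠ q → Disjoint (D p) (D q) := by
  classical
  obtain ⟨C, hC, hd⟩ := h
  choose D hD hc hA hp hS using fun i => trim (hC i).1 (hC i).2.1 (hC i).2.2
  choose p hpP hpe using hp
  have hpD : ∀ i, p i ∈ D i := fun i => by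
    have : p i ∈ D i ∩ P := by rw [hpe]; rfl
    exact this.1
  have hdD : ∀ i j, i ≠ j → Disjoint (D i) (D j) := fun i j hij => (hd i j hij).mono (hD i) (hD j)
  have hinj : Function.Injective p := fun i j hij => by
    by_contra hne
    exact Set.disjoint_left.1 (hdD i j hne) (hpD i) (hij ▸ hpD j)
  have hr : range p = P := by
    apply Set.eq_of_subset_of_ncard_le (by rintro _ ⟨i, rfl⟩; exact hpP i)
    rw [← Set.image_univ, Set.ncard_image_of_injective _ hinj, Set.ncard_univ]; simpa using hP
  have hcard : P.ncard = k := by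
    rw [← hr, ← Set.image_univ, Set.ncard_image_of_injective _ hinj, Set.ncard_univ]; simp
  have hex : ∀ q, q ∈ P → ∃ i, p i = q := fun q hq => by rw [← hr] at hq; exact hq
  refine ⟨hcard, fun q => if hq : q ∈ P then D (hex q hq).choose else ∅, fun q hq => ?_⟩
  grind
theorem goering_sep {G G' : SimpleGraph V} {A B S : Set V} {x y : V} {k : ℕ}
    (hle : ∀ u v, G.Adj u v → G'.Adj u v ∨ (u = x ∧ v = y) ∨ (u = y ∧ v = x))
    (hS : ∀ C, Conn G' C → Disjoint C S → Mt C A → ¬ Mt C B)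
    {Y : Set V} (hY : Conn G' Y) (hYS : Disjoint Y S) (hyY : y ∈ Y) (hYB : Mt Y B)
    (hG : ∀ S : Set V, S.ncard < k → ∃ C, Conn G C ∧ Disjoint C S ∧ Mt C A ∧ Mt C B) :
    ∀ T : Set V, T.ncard < k → ∃ C, Conn G' C ∧ Disjoint C T ∧ Mt C A ∧ Mt C (insert x S) := by
  intro T hT
  obtain ⟨C, hC, hCT, ⟨a, haC, haA⟩, ⟨b, hbC, hbB⟩⟩ := hG T hT
  have hKC : comp G' C a ⊆ C := comp_sub haC
  have hKc : Conn G' (comp G' C a) := comp_conn haC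
  refine ⟨comp G' C a, hKc, hCT.mono_left hKC, ⟨a, mem_comp_self, haA⟩, ?_⟩
  by_contra hP
  rw [not_mt] at hP
  have hKS : Disjoint (comp G' C a) S := hP.mono_right (subset_insert _ _)
  have hKB := hS _ hKc hKS ⟨a, mem_comp_self, haA⟩
  obtain ⟨u, hu, v, hv, huK, hvK, hadj⟩ := hC.edge (T := comp G' C a) ⟨a, haC, mem_comp_self⟩
    ⟨b, hbC, fun h => hKB ⟨b, h, hbB⟩⟩
  rcases hle u v hadj with h | ⟨rfl, rfl⟩ | ⟨rfl, rfl⟩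
  · exact hvK (comp_closed huK h hv)
  · grind
  · refine hS _ (hKc.union hY ⟨u, huK, u, hyY, .inl rfl⟩) (by simp [hKS, hYS])
      ⟨a, .inl mem_comp_self, haA⟩ ?_
    obtain ⟨z, h1, h2⟩ := hYB
    exact ⟨z, .inr h1, h2⟩
theorem menger [Finite V] (G : SimpleGraph V) (A B : Set V) (k : ℕ)
    (hG : ∀ S : Set V, S.ncard < k → ∃ C, Conn G C ∧ Disjoint C S ∧ Mt C A ∧ Mt C B) :
    Lnk G A B k := by
  induction G using WellFoundedLT.induction generalizing A B k with
  | ind G ih =>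
  by_cases hbot : ∃ x y, G.Adj x y
  swap
  · push Not at hbot
    refine lnk_of_index (I := A ∩ B) ?_ (fun v => {v}) (fun i hi => ⟨conn_single _ _, ⟨i, rfl, hi.1⟩, ⟨i, rfl, hi.2⟩⟩)
      (fun i _ j _ h => by simpa using h)
    by_contra! hlt
    obtain ⟨C, hC, hd, ⟨a, ha, haA⟩, ⟨b, hb, hbB⟩⟩ := hG _ hlt
    by_cases hab : a = b
    · grind
    · obtain ⟨u, _, v, _, _, _, h⟩ := hC.edge (T := {a}) ⟨a, ha, rfl⟩ ⟨b, hb, fun h => hab h.symm⟩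
      exact hbot u v h
  obtain ⟨x, y, hxy⟩ := hbot
  set G' := G.deleteEdges {s(x, y)} with hG'
  have hle : G' ≤ G := deleteEdges_le _
  have hlt : G' < G := lt_of_le_of_ne hle (fun h => by
    have : G'.Adj x y := h ▸ hxy
    simp [hG'] at this)
  have hadj : ∀ u v, G.Adj u v → G'.Adj u v ∨ (u = x ∧ v = y) ∨ (u = y ∧ v = x) := by
    intro u v h; simp [hG', h]; tauto
  by_cases hcase : ∀ S : Set V, S.ncard < k → ∃ C, Conn G' C ∧ Disjoint C S ∧ Mt C A ∧ Mt C B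
  · obtain ⟨C, hC, hd⟩ := ih G' hlt A B k hcase
    exact ⟨C, fun i => ⟨(hC i).1.mono hle, (hC i).2⟩, hd⟩
  push Not at hcase
  obtain ⟨S, hSk, hS⟩ := hcase
  obtain ⟨x, y, hxy, hadj, X, Y, hX, hY, hXS, hYS, hxX, hyY, hXA, hYB⟩ : ∃ x y, G.Adj x y ∧
      (∀ u v, G.Adj u v → G'.Adj u v ∨ (u = x ∧ v = y) ∨ (u = y ∧ v = x)) ∧ ∃ X Y : Set V,
      Conn G' X ∧ Conn G' Y ∧ Disjoint X S ∧ Disjoint Y S ∧ x ∈ X ∧ y ∈ Y ∧ Mt X A ∧ Mt Y B := by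
    obtain ⟨C, hC, hCS, ⟨a, haC, haA⟩, ⟨b, hbC, hbB⟩⟩ := hG S hSk
    have hKC : comp G' C a ⊆ C := comp_sub haC
    have hKc : Conn G' (comp G' C a) := comp_conn haC
    have hKB := hS _ hKc (hCS.mono_left hKC) ⟨a, mem_comp_self, haA⟩
    obtain ⟨u, hu, v, hv, huK, hvK, huv⟩ := hC.edge (T := comp G' C a) ⟨a, haC, mem_comp_self⟩
      ⟨b, hbC, fun h => hKB ⟨b, h, hbB⟩⟩
    have hadj2 : ∀ u' v', G.Adj u' v' → G'.Adj u' v' ∨ (u' = u ∧ v' = v) ∨ (u' = v ∧ v' = u) := by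
      rcases hadj u v huv with h | ⟨rfl, rfl⟩ | ⟨rfl, rfl⟩
      · exact absurd (comp_closed huK h hv) hvK
      · exact hadj
      · intro u' v' h; have := hadj u' v' h; tauto
    refine ⟨u, v, huv, hadj2, comp G' C a, comp G' C v, hKc, comp_conn hv, hCS.mono_left hKC,
      hCS.mono_left (comp_sub hv), huK, mem_comp_self, ⟨a, mem_comp_self, haA⟩, b, ?_, hbB⟩
    by_contra hb
    obtain ⟨p, hp, q, hq, hpT, hqT, hpq⟩ := hC.edge (T := comp G' C a ∪ comp G' C v)
      ⟨a, haC, .inl mem_comp_self⟩ ⟨b, hbC, fun h => h.elim (fun h => hKB ⟨b, h, hbB⟩) hb⟩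
    rcases hadj2 p q hpq with h | ⟨rfl, rfl⟩ | ⟨rfl, rfl⟩
    · exact hqT (hpT.imp (fun h' => comp_closed h' h hq) (fun h' => comp_closed h' h hq))
    · exact hqT (.inr mem_comp_self)
    grind
  have hLA := ih G' hlt A (insert x S) k (goering_sep hadj (fun C h1 h2 h3 => hS C h1 h2 h3) hY hYS hyY hYB hG)
  have hLB := ih G' hlt B (insert y S) k (goering_sep (A := B) (B := A) (x := y) (y := x) (S := S) (k := k)
    (fun u v h => by have := hadj u v h; tauto) (fun C h1 h2 h3 h4 => hS C h1 h2 h4 h3) hX hXS hxX hXA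
    (fun T hT => by grind))
  obtain ⟨hPk, D, hD⟩ := goering_side hLA ((Set.ncard_insert_le _ _).trans om)
  obtain ⟨hQk, E, hE⟩ := goering_side hLB ((Set.ncard_insert_le _ _).trans om)
  have hxS : x ∉ S := Set.disjoint_left.1 hXS hxX
  have hyS : y ∉ S := Set.disjoint_left.1 hYS hyY
  have key : ∀ p ∈ insert x S, ∀ q ∈ insert y S, p ≠ q → Disjoint (D p) (E q) := by
    intro p hp q hq hpq
    rw [Set.disjoint_left]
    intro w hwD hwE
    have hDp := (hD p hp).1
    have hEq := (hE q hq).1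
    have hwS : w ∉ S := by
      intro hw
      have h1 : w ∈ D p ∩ insert x S := ⟨hwD, .inr hw⟩
      have h2 : w ∈ E q ∩ insert y S := ⟨hwE, .inr hw⟩
      rw [hDp.2.2.1] at h1; rw [hEq.2.2.1] at h2
      exact hpq (h1.symm.trans h2)
    obtain ⟨K, _, hK, hwK, hKS, z, hz⟩ := hDp.2.2.2 S (subset_insert _ _) w hwD hwS
    obtain ⟨K', _, hK', hwK', hKS', z', hz'⟩ := hEq.2.2.2 S (subset_insert _ _) w hwE hwS
    exact hS (K ∪ K') (hK.union hK' ⟨w, hwK, w, hwK', .inl rfl⟩) (by simp [hKS, hKS'])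
      ⟨z, .inl hz.1, hz.2⟩ ⟨z', .inr hz'.1, hz'.2⟩
  classical
  let φ : V → V := fun p => if p = x then y else p
  have hφ : ∀ p ∈ insert x S, φ p ∈ insert y S := by
    rintro p (rfl | hp)
    · simp [φ]
    · simp only [φ]; split_ifs <;> simp [hp]
  have hφi : ∀ p ∈ insert x S, ∀ q ∈ insert x S, p ≠ q → φ p ≠ φ q := by
    intro p hp q hq; simp only [φ]; grind
  have hmD : ∀ p ∈ insert x S, p ∈ D p := fun p hp => by
    have : p ∈ D p ∩ insert x S := by rw [(hD p hp).1.2.2.1]; rfl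
    exact this.1
  have hmE : ∀ p ∈ insert y S, p ∈ E p := fun p hp => by
    have : p ∈ E p ∩ insert y S := by rw [(hE p hp).1.2.2.1]; rfl
    exact this.1
  have hpφ : ∀ p ∈ insert x S, ∀ q ∈ insert x S, p ≠ q → p ≠ φ q := by
    rintro p hp q hq hne; simp only [φ]; split_ifs with h
    · grind
    · exact hne
  refine lnk_of_index (I := insert x S) hPk.ge (fun p => D p ∪ E (φ p)) ?_ ?_
  · intro p hp
    obtain ⟨z, hz, hzA⟩ := (hD p hp).1.2.1
    obtain ⟨z', hz', hzB⟩ := (hE _ (hφ p hp)).1.2.1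
    refine ⟨((hD p hp).1.1.mono hle).union ((hE _ (hφ p hp)).1.1.mono hle)
      ⟨p, hmD p hp, φ p, hmE _ (hφ p hp), ?_⟩, ⟨z, .inl hz, hzA⟩, ⟨z', .inr hz', hzB⟩⟩
    simp only [φ]; split_ifs with h
    · subst h; exact .inr hxy
    · exact .inl rfl
  · intro p hp q hq hne
    simp only [disjoint_union_left, disjoint_union_right]
    grind
end Paper

namespace Paper
variable {V : Type}
theorem conn_iff {G : SimpleGraph V} {S : Set V} : (G.induce S).Connected ↔ Conn G S := by
  constructor
  · intro h
    obtain ⟨x0⟩ := h.nonempty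
    refine ⟨⟨x0, x0.2⟩, ?_⟩
    rintro P ⟨x, hx, hPx⟩ hcl y hy
    obtain ⟨w⟩ := h.preconnected ⟨x, hx⟩ ⟨y, hy⟩
    have : ∀ (a b : S), (G.induce S).Walk a b → P a → P b := by
      intro a b w
      induction w with
      | nil => exact id
      | cons h _ ih => exact fun hp => ih (hcl _ (Subtype.mem _) _ (Subtype.mem _) h hp)
    exact this _ _ w hPx
  · intro h
    obtain ⟨x, hx⟩ := h.1
    have key := h.2 (fun y => ∃ hy : y ∈ S, (G.induce S).Reachable ⟨x, hx⟩ ⟨y, hy⟩)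
      ⟨x, hx, hx, Reachable.refl _⟩ (by
        rintro u hu v hv ha ⟨_, hr⟩
        exact ⟨hv, hr.trans (Adj.reachable (by simpa using ha))⟩)
    have : Nonempty S := ⟨⟨x, hx⟩⟩
    exact ⟨fun a b => (key a a.2).choose_spec.symm.trans (key b b.2).choose_spec⟩
theorem Conn.map {W : Type} {G : SimpleGraph V} {H : SimpleGraph W} {S : Set V} (f : V → W)
    (hf : ∀ u ∈ S, ∀ v ∈ S, G.Adj u v → f u = f v ∨ H.Adj (f u) (f v)) (h : Conn G S) : Conn H (f '' S) := by
  refine ⟨h.1.image f, ?_⟩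
  rintro P ⟨_, ⟨x, hx, rfl⟩, hP⟩ hcl _ ⟨y, hy, rfl⟩
  refine h.2 (fun y => P (f y)) ⟨x, hx, hP⟩ (fun u hu v hv ha hp => ?_) y hy
  grind
theorem isTree_sum {ι₁ ι₂ : Type} [Finite ι₁] [Finite ι₂] {T₁ : SimpleGraph ι₁} {T₂ : SimpleGraph ι₂}
    (h₁ : T₁.IsTree) (h₂ : T₂.IsTree) (r₁ : ι₁) (r₂ : ι₂) :
    (T₁.sum T₂ ⊔ edge (.inl r₁) (.inr r₂)).IsTree := by
  rw [isTree_iff_connected_and_card] at *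
  refine ⟨h₁.1.sum_sup_edge h₂.1, ?_⟩
  have he : (edge (Sum.inl r₁ : ι₁ ⊕ ι₂) (.inr r₂)).edgeSet = {s(.inl r₁, .inr r₂)} := by
    rw [edgeSet_edge]; ext e; simp; rintro rfl; simp
  rw [edgeSet_sup, he, Nat.card_coe_set_eq, Set.ncard_union_eq (by simp) (Set.toFinite _) (Set.toFinite _),
    ← Nat.card_coe_set_eq, Nat.card_congr edgeSetSumEquiv, Nat.card_sum, Nat.card_sum]
  simp only [Nat.card_coe_set_eq, Set.ncard_singleton] at *; omega
def TD (G : SimpleGraph V) (k : ℕ) (U W : Set V) : Prop :=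
  ∃ (ι : Type) (_ : Finite ι) (T : SimpleGraph ι) (χ : ι → Finset V) (r : ι),
    T.IsTree ∧ (∀ v ∈ U, Conn T {t | v ∈ χ t}) ∧
    (∀ u ∈ U, ∀ v ∈ U, G.Adj u v → ∃ t, u ∈ χ t ∧ v ∈ χ t) ∧
    (∀ t, (χ t).card ≤ k + 1) ∧ (∀ t, ∀ v ∈ χ t, v ∈ U) ∧ ∀ v ∈ W, v ∈ χ r
theorem td_single [Finite V] {G : SimpleGraph V} {k : ℕ} {X : Set V} (hX : X.ncard ≤ k + 1) : TD G k X X := by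
  have hf := X.toFinite
  refine ⟨Unit, inferInstance, ⊥, fun _ => hf.toFinset, (), IsTree.of_subsingleton, ?_, ?_, ?_, ?_, ?_⟩
  · intro v hv
    have : {t : Unit | v ∈ hf.toFinset} = {()} := by ext; simp [hv]
    rw [this]; exact conn_single _ _
  · intro u hu v hv _; exact ⟨(), by simp [hu, hv]⟩
  · intro _; rwa [← Set.ncard_eq_toFinset_card]
  · simp
  · simp
theorem td_glue {G : SimpleGraph V} {k : ℕ} {U₁ U₂ W₁ W : Set V} (h₁ : TD G k U₁ W₁) (h₂ : TD G k U₂ W)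
    (hW : W ⊆ W₁) (hU : U₁ ∩ U₂ ⊆ W) (hadj : ∀ u ∈ U₁, ∀ v ∈ U₂, v ∉ U₁ → G.Adj u v → u ∈ U₂) :
    TD G k (U₁ ∪ U₂) W₁ := by
  obtain ⟨ι₁, _, T₁, χ₁, r₁, ht₁, hc₁, ha₁, hk₁, hs₁, hr₁⟩ := h₁
  obtain ⟨ι₂, _, T₂, χ₂, r₂, ht₂, hc₂, ha₂, hk₂, hs₂, hr₂⟩ := h₂
  refine ⟨ι₁ ⊕ ι₂, inferInstance, _, Sum.elim χ₁ χ₂, .inl r₁, isTree_sum ht₁ ht₂ r₁ r₂, ?_, ?_, ?_, ?_, ?_⟩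
  · intro v hv
    have e : {t | v ∈ Sum.elim χ₁ χ₂ t} = Sum.inl '' {t | v ∈ χ₁ t} ∪ Sum.inr '' {t | v ∈ χ₂ t} := by
      ext (t | t) <;> simp
    have c₁ : v ∈ U₁ → Conn (T₁.sum T₂ ⊔ edge (.inl r₁) (.inr r₂)) (Sum.inl '' {t | v ∈ χ₁ t}) := fun h =>
      (hc₁ v h).map Sum.inl (fun u _ v _ h => by simp [h])
    have c₂ : v ∈ U₂ → Conn (T₁.sum T₂ ⊔ edge (.inl r₁) (.inr r₂)) (Sum.inr '' {t | v ∈ χ₂ t}) := fun h =>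
      (hc₂ v h).map Sum.inr (fun u _ v _ h => by simp [h])
    rw [e]
    by_cases h1 : v ∈ U₁ <;> by_cases h2 : v ∈ U₂
    · have hw := hU ⟨h1, h2⟩
      exact (c₁ h1).union (c₂ h2) ⟨.inl r₁, ⟨r₁, hr₁ v (hW hw), rfl⟩, .inr r₂, ⟨r₂, hr₂ v hw, rfl⟩,
        .inr (by simp [edge_adj])⟩
    · rw [show {t | v ∈ χ₂ t} = ∅ by grind]; simpa using c₁ h1
    · rw [show {t | v ∈ χ₁ t} = ∅ by grind]; simpa using c₂ h2
    grind
  · have main : ∀ u ∈ U₁, ∀ v ∈ U₁ ∪ U₂, G.Adj u v → ∃ t, u ∈ Sum.elim χ₁ χ₂ t ∧ v ∈ Sum.elim χ₁ χ₂ t := by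
      intro u hu v hv h
      by_cases h1 : v ∈ U₁
      · obtain ⟨t, ht⟩ := ha₁ u hu v h1 h; exact ⟨.inl t, ht⟩
      · have h2 : v ∈ U₂ := hv.resolve_left h1
        obtain ⟨t, ht⟩ := ha₂ u (hadj u hu v h2 h1 h) v h2 h; exact ⟨.inr t, ht⟩
    intro u hu v hv h
    by_cases h1 : u ∈ U₁
    · grind
    · by_cases h2 : v ∈ U₁
      · obtain ⟨t, ht⟩ := main v h2 u hu h.symm; grind
      · obtain ⟨t, ht⟩ := ha₂ u (hu.resolve_left h1) v (hv.resolve_left h2) h; exact ⟨.inr t, ht⟩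
  · grind
  · grind
  · exact hr₁
def Nb (G : SimpleGraph V) (A : Set V) : Set V := {v | v ∉ A ∧ ∃ a ∈ A, G.Adj a v}
def Touch (G : SimpleGraph V) (X Y : Set V) : Prop := ∃ x ∈ X, ∃ y ∈ Y, x = y ∨ G.Adj x y
def Bram (G : SimpleGraph V) (B : Set (Set V)) (c : ℕ) : Prop :=
  (∀ X ∈ B, Conn G X) ∧ (∀ X ∈ B, ∀ Y ∈ B, Touch G X Y) ∧
    ∀ S : Set V, S.ncard ≤ c → ∃ X ∈ B, Disjoint X S
theorem td_rec [Finite V] {G : SimpleGraph V} {k : ℕ}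
    (H : ∀ W : Set V, ∃ S : Set V, S.ncard ≤ k ∧ ∀ C, Conn G C → Disjoint C S → 2 * (C ∩ W).ncard ≤ W.ncard) :
    ∀ n : ℕ, ∀ C W : Set V, C.ncard ≤ n → Nb G C ⊆ W → Disjoint C W → W.ncard ≤ 2 * k + 2 →
      TD G (3 * k + 2) (C ∪ W) W := by
  intro n
  induction n with
  | zero =>
    intro C W hC _ _ hW
    have : C = ∅ := (Set.ncard_eq_zero (Set.toFinite _)).1 om
    rw [this, empty_union]; exact td_single om
  | succ n ih =>
    intro C W hC hN hd hW
    by_cases hemp : C = ∅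
    · rw [hemp, empty_union]; exact td_single om
    obtain ⟨v, hv⟩ := Set.nonempty_iff_ne_empty.2 hemp
    obtain ⟨S, hS, hSW⟩ := H W
    set X : Set V := W ∪ insert v (S ∩ C) with hX
    have hXc : X.ncard ≤ 3 * k + 2 + 1 := by
      have h1 := Set.ncard_union_le W (insert v (S ∩ C))
      have h2 := Set.ncard_insert_le v (S ∩ C)
      have h3 := Set.ncard_le_ncard (inter_subset_left : S ∩ C ⊆ S)
      grind
    have Q : ∀ m : ℕ, ∀ R : Set V, R.ncard ≤ m → R ⊆ C \ X → (∀ u ∈ R, ∀ w, G.Adj u w → w ∈ R ∪ X) →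
        TD G (3 * k + 2) (X ∪ R) X := by
      intro m
      induction m with
      | zero =>
        intro R hR _ _
        have : R = ∅ := (Set.ncard_eq_zero (Set.toFinite _)).1 om
        rw [this, union_empty]; exact td_single hXc
      | succ m ihm =>
        intro R hR hRC hRN
        by_cases hemp : R = ∅
        · rw [hemp, union_empty]; exact td_single hXc
        obtain ⟨x, hx⟩ := Set.nonempty_iff_ne_empty.2 hemp
        set K := comp G R x
        have hKR : K ⊆ R := comp_sub hx
        have hxK : x ∈ K := mem_comp_self
        have hKc : Conn G K := comp_conn hx
        have hKcl : ∀ u ∈ K, ∀ w, G.Adj u w → w ∈ R → w ∈ K := fun u hu w h hw => comp_closed hu h hw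
        have hNK : Nb G K ⊆ X := by
          rintro w ⟨hw, a, ha, haw⟩
          grind
        have hlt : (R \ K).ncard < R.ncard :=
          Set.ncard_lt_ncard ⟨diff_subset, fun h => (h hx).2 hxK⟩
        have t1 := ihm (R \ K) om (diff_subset.trans hRC) (by
          intro u hu w huw
          rcases hRN u hu.1 w huw with h | h
          · exact .inl ⟨h, fun hK => hu.2 (hKcl w hK u huw.symm hu.1)⟩
          · exact .inr h)
        have hKC : K.ncard ≤ n := by
          have : K.ncard < C.ncard := Set.ncard_lt_ncard ⟨fun z hz => (hRC (hKR hz)).1, fun h =>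
            (hRC (hKR (h hv))).2 (.inr (.inl rfl))⟩
          omega
        have hNKc : (Nb G K).ncard ≤ 2 * k + 2 := by
          have hc : Conn G (K ∪ ⋃ w ∈ (Nb G K \ insert v S), {w}) :=
            hKc.biUnion (fun i _ => conn_single _ _) (fun w hw => by
              obtain ⟨⟨_, a, ha, haw⟩, _⟩ := hw; exact ⟨a, ha, w, rfl, .inr haw⟩)
          rw [Set.biUnion_of_singleton] at hc
          have h1 := hSW _ hc (by
            rw [Set.disjoint_left]
            rintro z (hz | hz) hzS
            · exact (hRC (hKR hz)).2 (.inr (.inr ⟨hzS, (hRC (hKR hz)).1⟩))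
            · exact hz.2 (.inr hzS))
          have h2 : Nb G K ⊆ ((K ∪ (Nb G K \ insert v S)) ∩ W) ∪ insert v S := by
            intro w hw
            by_cases hvs : w ∈ insert v S
            · exact .inr hvs
            · refine .inl ⟨.inr ⟨hw, hvs⟩, ?_⟩
              have := hNK hw
              grind
          have h3 := Set.ncard_le_ncard h2
          have h4 := Set.ncard_union_le ((K ∪ (Nb G K \ insert v S)) ∩ W) (insert v S)
          have h5 := Set.ncard_insert_le v S
          omega
        have t2 := ih K (Nb G K) hKC le_rfl (by
          rw [Set.disjoint_left]; exact fun z hz hz' => hz'.1 hz) hNKc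
        have t3 := td_glue t1 t2 hNK (by
          rintro z ⟨hz1, hz2⟩
          rcases hz2 with h | h
          · rcases hz1 with h' | h'
            · exact absurd h' (hRC (hKR h)).2
            · exact absurd h h'.2
          · exact h) (by
          intro u hu w hw hw1 huw
          rcases hw with h | h
          · by_cases huK : u ∈ K
            · exact .inl huK
            · exact .inr ⟨huK, w, h, huw.symm⟩
          · exact absurd (.inl (hNK h)) hw1)
        have e : X ∪ R \ K ∪ (K ∪ Nb G K) = X ∪ R := by
          ext z; have := @hNK z; have := @hKR z; simp only [mem_union, mem_diff]; tauto
        rwa [e] at t3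
    have t := Q _ (C \ X) le_rfl le_rfl (by
      intro u hu w huw
      by_cases hw : w ∈ C
      · grind
      · exact .inr (.inl (hN ⟨hw, u, hu.1, huw⟩)))
    have e : X ∪ C \ X = C ∪ W := by
      ext z; simp only [hX, mem_union, mem_diff, Set.mem_insert_iff, Set.mem_inter_iff]; grind
    rw [e] at t
    obtain ⟨ι, hι, T, χ, r, h1, h2, h3, h4, h5, h6⟩ := t
    exact ⟨ι, hι, T, χ, r, h1, h2, h3, h4, h5, fun v hv => h6 v (.inl hv)⟩
theorem tw_bramble [Finite V] {G : SimpleGraph V} {k : ℕ} (h : ¬ HasTreewidthAtMost G (3 * k + 2)) :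
    ∃ B, Bram G B k := by
  by_contra! hB
  have H : ∀ W : Set V, ∃ S : Set V, S.ncard ≤ k ∧
      ∀ C, Conn G C → Disjoint C S → 2 * (C ∩ W).ncard ≤ W.ncard := by
    intro W
    by_contra! hW
    refine hB {C | Conn G C ∧ W.ncard < 2 * (C ∩ W).ncard} ⟨fun X hX => hX.1, ?_, ?_⟩
    · intro X hX Y hY
      by_contra hT
      have hd : Disjoint (X ∩ W) (Y ∩ W) := by
        rw [Set.disjoint_left]; exact fun z hz hz' => hT ⟨z, hz.1, z, hz'.1, .inl rfl⟩
      have h1 := Set.ncard_union_eq hd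
      have h2 := Set.ncard_le_ncard (show X ∩ W ∪ Y ∩ W ⊆ W by simp)
      grind
    grind
  obtain ⟨ι, hι, T, χ, r, h1, h2, h3, h4, h5, h6⟩ := td_rec H _ univ ∅ le_rfl (fun z hz => absurd trivial hz.1) (by simp) (by simp)
  refine h ⟨ι, T, χ, h1, fun v => (h2 v (.inl trivial)).1, fun u v => h3 u (.inl trivial) v (.inl trivial),
    fun v => conn_iff.2 (h2 v (.inl trivial)), h4⟩
end Paper

namespace Paper
variable {V : Type}
def rst (G : SimpleGraph V) (U : Set V) : SimpleGraph V where
  Adj u v := G.Adj u v ∧ u ∈ U ∧ v ∈ U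
  symm := ⟨fun _ _ h => ⟨h.1.symm, h.2.2, h.2.1⟩⟩
  loopless := ⟨fun _ h => h.1.ne rfl⟩
theorem rst_le {G : SimpleGraph V} {U : Set V} : rst G U ≤ G := fun _ _ h => h.1
theorem conn_rst {G : SimpleGraph V} {U C : Set V} (h : Conn (rst G U) C) (hm : Mt C U) : C ⊆ U :=
  h.2 (· ∈ U) hm fun _ _ _ _ ha _ => ha.2.2
theorem Conn.rst {G : SimpleGraph V} {U C : Set V} (h : Conn G C) (hs : C ⊆ U) : Conn (rst G U) C :=
  ⟨h.1, fun P h1 h2 => h.2 P h1 fun u hu v hv ha => h2 u hu v hv ⟨ha, hs hu, hs hv⟩⟩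
def IsW (G : SimpleGraph V) (f : ℕ → V) (n : ℕ) : Prop :=
  (∀ i, i < n → G.Adj (f i) (f (i + 1))) ∧ ∀ i j, i < j → j ≤ n → f i ≠ f j
theorem IsW.concat {G : SimpleGraph V} {f g : ℕ → V} {n m : ℕ} (hf : IsW G f n) (hg : IsW G g m)
    (h0 : f n = g 0) (hd : ∀ i ≤ n, ∀ j, 0 < j → j ≤ m → f i ≠ g j) :
    ∃ h, IsW G h (n + m) ∧ (∀ i ≤ n, h i = f i) ∧ ∀ j ≤ m, h (n + j) = g j := by
  have e1 : ∀ i ≤ n, (if i ≤ n then f i else g (i - n)) = f i := fun i hi => if_pos hi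
  have e2 : ∀ j, (if n + j ≤ n then f (n + j) else g (n + j - n)) = g j := by grind
  refine ⟨fun t => if t ≤ n then f t else g (t - n), ⟨?_, ?_⟩, e1, fun j _ => e2 j⟩
  · intro i hi; dsimp only
    rcases Nat.lt_or_ge i n with h | h
    · rw [e1 i h.le, e1 (i + 1) h]; exact hf.1 i h
    · obtain ⟨j, rfl⟩ := Nat.exists_eq_add_of_le h
      rw [e2 j, add_assoc, e2 (j + 1)]; exact hg.1 j om
  · intro i j hij hj; dsimp only
    rcases Nat.lt_or_ge n j with h | h
    · obtain ⟨j', rfl⟩ := Nat.exists_eq_add_of_le h.le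
      rw [e2]
      rcases Nat.lt_or_ge n i with h' | h'
      · obtain ⟨i', rfl⟩ := Nat.exists_eq_add_of_le h'.le
        rw [e2]; exact hg.2 _ _ om om
      grind
    · rw [e1 i om, e1 j h]; exact hf.2 i j hij h
theorem hit_path [Finite V] {G : SimpleGraph V} {B : Set (Set V)} {c : ℕ} (hB : Bram G B c) :
    ∃ f n, IsW G f n ∧ ∀ X ∈ B, Mt (f '' Icc 0 n) X := by
  by_contra! hno
  have key : ∀ n : ℕ, ∃ f m, n ≤ m ∧ IsW G f m ∧ ∃ X ∈ B, ∀ i ≤ m, f i ∈ X ↔ i = m := by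
    intro n
    induction n with
    | zero =>
      obtain ⟨X, hX, _⟩ := hB.2.2 ∅ (by simp)
      obtain ⟨x, hx⟩ := (hB.1 X hX).1
      exact ⟨fun _ => x, 0, le_rfl, ⟨by simp, om⟩, X, hX, by simp [hx]⟩
    | succ n ih =>
      obtain ⟨f, m, hm, hf, X, hX, hfX⟩ := ih
      obtain ⟨Y, hY, hfY⟩ := hno f m hf
      rw [not_mt, Set.disjoint_left] at hfY
      have hfY' : ∀ i ≤ m, f i ∉ Y := fun i hi => hfY ⟨i, by simp [hi], rfl⟩
      have hmX : f m ∈ X := (hfX m le_rfl).2 rfl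
      obtain ⟨y, hy⟩ := (hB.1 Y hY).1
      obtain ⟨g, l, h0, hl, hgC, hg, hg0, hgl⟩ := exists_path (A := {f m}) (B := Y)
        ((hB.1 X hX).union (hB.1 Y hY) (hB.2.1 X hX Y hY)) ⟨f m, .inl hmX, rfl⟩ ⟨y, .inr hy, hy⟩
      have hl0 : 0 < l := by grind
      obtain ⟨h, hh, h1, h2⟩ := hf.concat (m := l) ⟨hg.1, fun i j h h' => (hg.2 i j h h').1⟩ h0.symm (by
        grind)
      refine ⟨h, m + l, om, hh, Y, hY, fun i hi => ?_⟩
      rcases Nat.lt_or_ge i m with h' | h'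
      · grind
      · obtain ⟨j, rfl⟩ := Nat.exists_eq_add_of_le h'
        grind
  obtain ⟨f, m, hm, hf, _⟩ := key (Nat.card V)
  have hinj : Function.Injective (fun i : Fin (m + 1) => f i) := by
    intro i j hij
    rcases lt_trichotomy i j with h | h | h
    · exact absurd hij (hf.2 i j h om)
    · exact h
    · exact absurd hij.symm (hf.2 j i h om)
  have := Nat.card_le_card_of_injective _ hinj
  simp at this; omega
def beta (G : SimpleGraph V) (B : Set (Set V)) (S : Set V) : Set V :=
  {y | ∃ C, Conn G C ∧ Disjoint C S ∧ y ∈ C ∧ ∃ X ∈ B, X ⊆ C}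
section
variable {G : SimpleGraph V} {B : Set (Set V)} {c : ℕ} {S : Set V}
theorem beta_anti {S T : Set V} (h : S ⊆ T) : beta G B T ⊆ beta G B S := by
  rintro y ⟨C, h1, h2, h3⟩; exact ⟨C, h1, h2.mono_right h, h3⟩
theorem beta_disj : Disjoint (beta G B S) S := by
  rw [Set.disjoint_left]; rintro y ⟨C, h1, h2, h3, _⟩; grind
theorem beta_closed {K : Set V} (hK : Conn G K) (hS : Disjoint K S) (h : Touch G K (beta G B S)) :
    K ⊆ beta G B S := by
  obtain ⟨x, hx, y, ⟨C, h1, h2, h3, X, hX, hXC⟩, hxy⟩ := h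
  intro z hz
  exact ⟨K ∪ C, hK.union h1 ⟨x, hx, y, h3, hxy⟩, by simp [hS, h2], .inl hz, X, hX,
    hXC.trans subset_union_right⟩
theorem beta_conn (hB : Bram G B c) (hS : S.ncard ≤ c) : Conn G (beta G B S) := by
  obtain ⟨X, hX, hXS⟩ := hB.2.2 S hS
  have hsub : X ⊆ beta G B S := fun x hx => ⟨X, hB.1 X hX, hXS, hx, X, hX, le_rfl⟩
  have := (hB.1 X hX).biUnion (I := {C | Conn G C ∧ Disjoint C S ∧ ∃ X ∈ B, X ⊆ C}) (A := id)
    (fun i hi => hi.1) (fun C hC => by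
      obtain ⟨Y, hY, hYC⟩ := hC.2.2
      obtain ⟨x, hx, y, hy, h⟩ := hB.2.1 X hX Y hY
      grind)
  convert this using 1
  ext y; constructor
  · rintro ⟨C, h1, h2, h3, h4⟩
    exact .inr (mem_biUnion (x := C) ⟨h1, h2, h4⟩ h3)
  · rintro (h | h)
    · exact hsub h
    · simp only [mem_iUnion] at h
      obtain ⟨C, ⟨h1, h2, h4⟩, h3⟩ := h
      exact ⟨C, h1, h2, h3, h4⟩
theorem mesh1 [Finite V] {N : ℕ} (hB : Bram G B c) (hN : 2 ≤ N) (hc : N ≤ c) :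
    ∃ f n S, IsW G f n ∧ S.ncard = N ∧ Disjoint (f '' Icc 0 n) (beta G B S) ∧
      ∀ T : Set V, T.ncard < N → Mt (f '' Icc 0 n) (beta G B T) := by
  classical
  obtain ⟨f, n₀, hf, hit⟩ := hit_path hB
  let Q : ℕ → Prop := fun n => ∀ T : Set V, T.ncard < N → Mt (f '' Icc 0 n) (beta G B T)
  have hQ : Q n₀ := by
    intro T hT
    obtain ⟨X, hX, hXT⟩ := hB.2.2 T om
    obtain ⟨x, hx, hxX⟩ := hit X hX
    exact ⟨x, hx, X, hB.1 X hX, hXT, hxX, X, hX, le_rfl⟩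
  have hex : ∃ n, Q n := ⟨n₀, hQ⟩
  set n := Nat.find hex with hn
  have hn1 : Q n := Nat.find_spec hex
  have hn2 : n ≤ n₀ := Nat.find_le hQ
  obtain ⟨S, hS, hd⟩ : ∃ S : Set V, S.ncard ≤ N ∧ Disjoint (f '' Icc 0 n) (beta G B S) := by
    rcases Nat.eq_zero_or_pos n with h0 | h0
    · refine ⟨{f 0}, by simp; omega, ?_⟩
      rw [h0]; simpa using fun h => Set.disjoint_left.1 (beta_disj (S := {f 0})) h (Set.mem_singleton (f 0))
    · have h3 : ¬ Q (n - 1) := Nat.find_min hex om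
      simp only [Q, not_forall, not_mt] at h3
      obtain ⟨T, hT, hTd⟩ := h3
      refine ⟨insert (f n) T, (Set.ncard_insert_le _ _).trans hT, ?_⟩
      rw [Set.disjoint_left] at hTd ⊢
      rintro _ ⟨i, hi, rfl⟩ h
      by_cases h4 : i = n
      · subst h4; exact Set.disjoint_left.1 beta_disj h (mem_insert _ _)
      · simp at hi
        exact hTd ⟨i, by simp; omega, rfl⟩ (beta_anti (Set.subset_insert _ _) h)
  refine ⟨f, n, S, ⟨fun i hi => hf.1 i om, fun i j h1 h2 => hf.2 i j h1 om⟩, ?_, hd, hn1⟩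
  by_contra hne
  exact not_mt.2 hd (hn1 S om)
theorem mesh2 [Finite V] {N : ℕ} {P : Set V} (hS : S.ncard = N)
    (hd : Disjoint P (beta G B S)) (hP : ∀ T : Set V, T.ncard < N → Mt P (beta G B T)) :
    ∃ D : V → Set V, ∀ s ∈ S, Conn G (D s) ∧ s ∈ D s ∧ Disjoint (D s) (beta G B S) ∧
      (∃ p, D s ∩ P = {p}) ∧ ∀ s' ∈ S, s ≠ s' → Disjoint (D s) (D s') := by
  have hL : Lnk G P S N := by
    apply menger
    intro T hT
    obtain ⟨x, hx, C, h1, h2, h3, X, hX, hXC⟩ := hP T hT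
    refine ⟨C, h1, h2, ⟨x, h3, hx⟩, ?_⟩
    by_contra hCS
    exact Set.disjoint_left.1 hd hx ⟨C, h1, not_mt.1 hCS, h3, X, hX, hXC⟩
  obtain ⟨_, D, hD⟩ := goering_side hL hS.le
  have : ∀ s : V, ∃ E : Set V, s ∈ S → E ⊆ D s ∧ Conn G E ∧ s ∈ E ∧ ∃ p, E ∩ P = {p} := by
    intro s
    by_cases hs : s ∈ S
    · have h := (hD s hs).1
      have hsm : s ∈ D s ∩ S := by rw [h.2.2.1]; rfl
      obtain ⟨E, hE, hEc, ⟨z, hzE, hzS⟩, ⟨p, _, hp⟩, _⟩ := trim (A := S) (P := P) h.1 ⟨s, hsm⟩ h.2.1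
      grind
    grind
  choose E hE using this
  refine ⟨E, fun s hs => ⟨(hE s hs).2.1, (hE s hs).2.2.1, ?_, (hE s hs).2.2.2, fun s' hs' hne =>
    ((hD s hs).2 s' hs' hne).mono (hE s hs).1 (hE s' hs').1⟩⟩
  rw [Set.disjoint_left]
  intro w hw hwU
  obtain ⟨K, _, hK, hwK, hKS, x, hxK, hxP⟩ :=
    (hD s hs).1.2.2.2 S le_rfl w ((hE s hs).1 hw) (Set.disjoint_left.1 beta_disj hwU)
  exact Set.disjoint_left.1 hd hxP (beta_closed hK hKS ⟨w, hwK, w, hwU, .inl rfl⟩ hxK)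
theorem mesh3 [Finite V] {N k : ℕ} {P Si Sj : Set V} (hB : Bram G B c) (hc : N + k ≤ c) (hS : S.ncard = N)
    (hd : Disjoint P (beta G B S)) (hP : ∀ T : Set V, T.ncard < N → Mt P (beta G B T))
    (hi : Si ⊆ S) (hj : Sj ⊆ S) (hik : Si.ncard = k) (hjk : Sj.ncard = k) :
    Lnk (rst G (beta G B S ∪ (Si ∪ Sj))) Si Sj k := by
  apply menger
  intro T hT
  set U' := beta G B (S ∪ T) with hU'
  have hU'c : Conn G U' := beta_conn hB (by have := Set.ncard_union_le S T; omega)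
  have hU'U : U' ⊆ beta G B S := beta_anti subset_union_left
  have key : ∀ Si, Si ⊆ S → Si.ncard = k → ∃ s ∈ Si, s ∉ T ∧ ∃ u ∈ U', G.Adj s u := by
    intro Si hi hik
    by_contra! hno
    obtain ⟨x, hxP, C, h1, h2, h3, X, hX, hXC⟩ := hP (S \ Si ∪ T) (by
      have h1 := Set.ncard_union_le (S \ Si) T
      have h2 := Set.ncard_diff_add_ncard_of_subset hi
      omega)
    have hcl : ∀ w, w ∉ S \ Si ∪ T → (∃ u ∈ U', w = u ∨ G.Adj w u) → w ∈ U' := by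
      rintro w hw ⟨u, hu, rfl | h⟩
      · exact hu
      · by_cases hwS : w ∈ Si
        · grind
        · refine beta_closed (conn_single G w) ?_ ⟨w, rfl, u, hu, .inr h⟩ rfl
          grind
    have hCU : C ⊆ U' := by
      obtain ⟨Y, hY, hYS⟩ := hB.2.2 (S ∪ T) (by have := Set.ncard_union_le S T; omega)
      obtain ⟨a, ha, b, hb, hab⟩ := hB.2.1 X hX Y hY
      have hCn : ∀ w ∈ C, w ∉ S \ Si ∪ T := fun w hw => Set.disjoint_left.1 h2 hw
      exact h1.2 (· ∈ U') ⟨a, hXC ha, hcl a (hCn a (hXC ha)) ⟨b, ⟨Y, hB.1 Y hY, hYS, hb, Y, hY, le_rfl⟩, hab⟩⟩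
        (fun u _ v hv h hu => hcl v (hCn v hv) ⟨u, hu, .inr h.symm⟩)
    grind
  obtain ⟨s, hs, hsT, u, hu, hsu⟩ := key Si hi hik
  obtain ⟨s', hs', hsT', u', hu', hsu'⟩ := key Sj hj hjk
  refine ⟨insert s (insert s' U'), ?_, ?_, ⟨s, .inl rfl, hs⟩, ⟨s', .inr (.inl rfl), hs'⟩⟩
  · refine Conn.rst ((hU'c.ins ⟨u', hu', hsu'⟩).ins ⟨u, .inr hu, hsu⟩) ?_
    grind
  · rw [Set.disjoint_left]
    rintro z (rfl | rfl | hz)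
    exacts [hsT, hsT', fun h => Set.disjoint_left.1 beta_disj hz (.inr h)]
theorem mesh4 {k : ℕ} {U Ai Aj Si Sj : Set V} (hL : Lnk (rst G (U ∪ (Si ∪ Sj))) Si Sj k)
    (hi : Si ⊆ Ai) (hj : Sj ⊆ Aj) (hT : ¬ Touch G Ai Aj) (hUi : Disjoint Ai U) (hUj : Disjoint Aj U) :
    Lnk (rst G U) (Nb G Ai ∩ U) (Nb G Aj ∩ U) k := by
  obtain ⟨C, hC, hd⟩ := hL
  have key : ∀ i, ∃ D ⊆ C i, Conn (rst G U) D ∧ Mt D (Nb G Ai ∩ U) ∧ Mt D (Nb G Aj ∩ U) := by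
    intro i
    obtain ⟨h1, h2, h3⟩ := hC i
    have hsub : C i ⊆ U ∪ (Si ∪ Sj) := conn_rst h1 (by
      obtain ⟨z, hz, hz'⟩ := h2; exact ⟨z, hz, .inr (.inl hz')⟩)
    obtain ⟨f, n, h0, hn, hf, hp, hA, hB⟩ := exists_path h1 h2 h3
    have n0 : n ≠ 0 := by rintro rfl; exact hT ⟨f 0, hi h0, f 0, hj hn, .inl rfl⟩
    have n1 : n ≠ 1 := by rintro rfl; exact hT ⟨f 0, hi h0, f 1, hj hn, .inr (hp.1 0 om).1⟩
    have hU : ∀ t, 1 ≤ t → t ≤ n - 1 → f t ∈ U := by grind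
    have hD : f '' Icc 1 (n - 1) ⊆ U := by grind
    refine ⟨f '' Icc 1 (n - 1), ?_, Conn.rst (conn_seg om fun t h1 h2 => (hp.1 t om).1) hD,
      ⟨f 1, ⟨1, by simp; omega, rfl⟩, ⟨?_, f 0, hi h0, (hp.1 0 om).1⟩, hU 1 om om⟩,
      ⟨f (n - 1), ⟨n - 1, by simp; omega, rfl⟩, ⟨?_, f n, hj hn, ?_⟩, hU (n - 1) om om⟩⟩
    · grind
    · grind
    · grind
    · have := (hp.1 (n - 1) om).1; rw [show n - 1 + 1 = n by omega] at this; exact this.symm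
  choose D hD1 hD2 using key
  exact ⟨D, hD2, fun i j hij => (hd i j hij).mono (hD1 i) (hD1 j)⟩
theorem mesh [Finite V] {m k : ℕ} (hB : Bram G B c) (hm : 2 ≤ m * k) (hc : m * k + k ≤ c) :
    ∃ (U : Set V) (A : Fin m → Set V), (∀ i, Conn G (A i) ∧ Disjoint (A i) U) ∧
      (∀ i j, i ≠ j → Disjoint (A i) (A j)) ∧
      ∀ i j, i ≠ j → Touch G (A i) (A j) ∨ Lnk (rst G U) (Nb G (A i) ∩ U) (Nb G (A j) ∩ U) k := by
  classical
  obtain ⟨f, n, S, hf, hS, hd, hP⟩ := mesh1 hB hm om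
  obtain ⟨D, hD⟩ := mesh2 hS hd hP
  choose! p hp using fun s hs => (hD s hs).2.2.2.1
  have hpm : ∀ s ∈ S, p s ∈ D s ∧ p s ∈ f '' Icc 0 n := fun s hs => by
    have : p s ∈ D s ∩ f '' Icc 0 n := by rw [hp s hs]; rfl
    exact this
  choose! t ht htp using fun s hs => (hpm s hs).2
  have tinj : InjOn t S := by
    intro s hs s' hs' he
    grind
  have hSf := S.toFinite
  have hTc : (hSf.toFinset.image t).card = m * k := by
    rw [Finset.card_image_of_injOn (by simpa using tinj), ← hS, Set.ncard_eq_toFinset_card _ hSf]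
  let o := (hSf.toFinset.image t).orderEmbOfFin hTc
  have ho : ∀ a, ∃ s ∈ S, t s = o a := fun a => by
    have := Finset.orderEmbOfFin_mem _ hTc a
    rw [Finset.mem_image] at this
    obtain ⟨s, hs, h⟩ := this
    exact ⟨s, by simpa using hs, h⟩
  choose s hs hso using ho
  have sinj : Function.Injective s := fun a b h => o.injective (by grind)
  rcases Nat.eq_zero_or_pos k with rfl | hk
  · omega
  have lt1 : ∀ (i : Fin m) (r : ℕ), r < k → i * k + r < m * k := fun i r hr => by
    have := Nat.mul_le_mul_right k (show (i : ℕ) + 1 ≤ m from i.2)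
    grind
  let a : Fin m → Fin k → Fin (m * k) := fun i r => ⟨i * k + r, lt1 i r r.2⟩
  have olt : ∀ {x y}, x < y → o x < o y := fun h => o.strictMono h
  let q0 : Fin m → ℕ := fun i => o (a i ⟨0, hk⟩)
  let q1 : Fin m → ℕ := fun i => o (a i ⟨k - 1, om⟩)
  have hq : ∀ i r, q0 i ≤ o (a i r) ∧ o (a i r) ≤ q1 i := fun i r =>
    ⟨o.monotone (by simp [a]), o.monotone (by simp [a]; omega)⟩
  have hq1 : ∀ i, q1 i ≤ n := fun i => by
    have := (ht _ (hs (a i ⟨k - 1, om⟩))).2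
    rwa [hso] at this
  have hqq : ∀ i j, i < j → q1 i < q0 j := fun i j hij => olt (by
    simp only [a, Fin.lt_def, add_zero]
    have := lt1 i (k - 1) om
    have h2 := Nat.mul_le_mul_right k (show (i : ℕ) + 1 ≤ j from hij)
    rw [add_mul] at h2; omega)
  let A : Fin m → Set V := fun i => f '' Icc (q0 i) (q1 i) ∪ ⋃ r ∈ (univ : Set (Fin k)), D (s (a i r))
  let Ss : Fin m → Set V := fun i => range fun r => s (a i r)
  have ainj : ∀ i j r r', a i r = a j r' → i = j := by
    intro i j r r' h
    by_contra hne
    rcases lt_or_gt_of_ne hne with h' | h'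
    · grind
    grind
  have segsub : ∀ i, f '' Icc (q0 i) (q1 i) ⊆ f '' Icc 0 n := fun i =>
    image_mono (Icc_subset_Icc (Nat.zero_le _) (hq1 i))
  have fs : ∀ x, f (o x) = p (s x) := fun x => by rw [← hso, htp _ (hs x)]
  have finj : ∀ x y, x ≤ n → y ≤ n → f x = f y → x = y := by
    intro x y hx hy h
    rcases lt_trichotomy x y with h' | h' | h'
    · exact absurd h (hf.2 x y h' hy)
    · exact h'
    · exact absurd h.symm (hf.2 y x h' hx)
  have on : ∀ x, o x ≤ n := fun x => by have := (ht _ (hs x)).2; rwa [hso] at this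
  have hAU : ∀ i, Disjoint (A i) (beta G B S) := by
    intro i
    rw [Set.disjoint_left]
    rintro z (hz | hz)
    · exact Set.disjoint_left.1 hd (segsub i hz)
    · simp only [mem_iUnion] at hz
      obtain ⟨r, _, hz⟩ := hz
      exact Set.disjoint_left.1 (hD _ (hs _)).2.2.1 hz
  have cross : ∀ i j r, i ≠ j → ∀ z ∈ f '' Icc (q0 i) (q1 i), z ∉ D (s (a j r)) := by
    rintro i j r hij _ ⟨x, hx, rfl⟩ hz
    have h1 : f x ∈ D (s (a j r)) ∩ f '' Icc 0 n := ⟨hz, segsub i ⟨x, hx, rfl⟩⟩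
    rw [hp _ (hs _), ← fs] at h1
    have h2 := finj _ _ (hx.2.trans (hq1 i)) (on _) h1
    have h3 := hq j r
    have h4 := hx.1
    have h5 := hx.2
    rcases lt_or_gt_of_ne hij with h' | h'
    · have := hqq i j h'; omega
    · have := hqq j i h'; omega
  refine ⟨beta G B S, A, fun i => ⟨?_, hAU i⟩, ?_, ?_⟩
  · refine Conn.biUnion (conn_seg ((hq i ⟨0, hk⟩).1.trans (hq i ⟨0, hk⟩).2) fun x _ hx => hf.1 x ?_)
      (fun r _ => (hD _ (hs _)).1) (fun r _ => ⟨f (o (a i r)), ⟨_, hq i r, rfl⟩, _, (hpm _ (hs _)).1, .inl (fs _)⟩)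
    have := hq1 i; omega
  · intro i j hij
    rw [Set.disjoint_left]
    rintro z (hz | hz) (hz' | hz')
    · obtain ⟨x, hx, rfl⟩ := hz
      obtain ⟨y, hy, he⟩ := hz'
      have h2 := finj _ _ (hy.2.trans (hq1 j)) (hx.2.trans (hq1 i)) he
      subst h2
      have h4 := hx.1
      have h5 := hx.2
      have h6 := hy.1
      have h7 := hy.2
      rcases lt_or_gt_of_ne hij with h' | h'
      · have := hqq i j h'; omega
      · have := hqq j i h'; omega
    · simp only [mem_iUnion] at hz'
      obtain ⟨r, _, hz'⟩ := hz'
      exact cross i j r hij z hz hz'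
    · simp only [mem_iUnion] at hz
      obtain ⟨r, _, hz⟩ := hz
      exact cross j i r hij.symm z hz' hz
    · simp only [mem_iUnion] at hz hz'
      obtain ⟨r, _, hz⟩ := hz
      obtain ⟨r', _, hz'⟩ := hz'
      refine Set.disjoint_left.1 ((hD _ (hs _)).2.2.2.2 _ (hs _) ?_) hz hz'
      intro he; exact hij (ainj _ _ _ _ (sinj he))
  · intro i j hij
    by_cases hT : Touch G (A i) (A j)
    · exact .inl hT
    have hcard : ∀ i, (Ss i).ncard = k := fun i => by
      show (Set.range _).ncard = k
      rw [← image_univ, Set.ncard_image_of_injective, Set.ncard_univ]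
      · simp
      · intro r r' h; have := sinj h; simp [a] at this; exact Fin.ext this
    have hsubS : ∀ i, Ss i ⊆ S := fun i => by rintro _ ⟨r, rfl⟩; exact hs _
    have hsubA : ∀ i, Ss i ⊆ A i := fun i => by
      rintro _ ⟨r, rfl⟩; exact .inr (mem_biUnion (x := r) trivial (hD _ (hs _)).2.1)
    exact .inr (mesh4 (mesh3 hB hc hS hd hP (hsubS i) (hsubS j) (hcard i) (hcard j)) (hsubA i) (hsubA j) hT
      (hAU i) (hAU j))
end
end Paper

namespace Paper
variable {V : Type}
def Rows (G : SimpleGraph V) {g : ℕ} (f : Fin g → ℕ → V) (N : Fin g → ℕ) : Prop :=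
  (∀ j i, i < N j → G.Adj (f j i) (f j (i + 1))) ∧
  ∀ j j' q q', q ≤ N j → q' ≤ N j' → f j q = f j' q' → j = j' ∧ q = q'
theorem cut1 [Finite V] {G G0 : SimpleGraph V} {X Y : Set V} {g : ℕ} {f : Fin g → ℕ → V}
    {N : Fin g → ℕ} (hR : Rows G f N) (hX : ∀ j, f j 0 ∈ X) (hY : ∀ j, f j (N j) ∈ Y)
    {j1 : Fin g} {p : ℕ} (hp0 : 0 < p) (hp : p ≤ N j1)
    (hG : ∀ x y, G.Adj x y → G0.Adj x y ∨ (x = f j1 (p - 1) ∧ y = f j1 p) ∨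
      (y = f j1 (p - 1) ∧ x = f j1 p)) (hL : ¬ Lnk G0 X Y g) :
    ∃ S L : Set V, S.ncard ≤ g ∧ (∀ A, Conn G A → ¬ (f j1 (p - 1) ∈ A ∧ f j1 p ∈ A) → Disjoint A S →
        A ⊆ L ∨ Disjoint A L) ∧
      (∀ j q q', q ≤ N j → q' ≤ N j → f j q ∈ L → f j q' ∉ L → f j q' ∉ S → q < q') ∧
      ∀ q ≤ N j1, f j1 q ∈ L ↔ q < p := by
  classical
  have : ∃ S : Set V, S.ncard < g ∧ ∀ C, Conn G0 C → Disjoint C S → Mt C X → ¬ Mt C Y := by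
    by_contra! h; exact hL (menger _ _ _ _ fun S hS => h S hS)
  obtain ⟨S, hSg, hS⟩ := this
  have stp : ∀ j t, t < N j → (j ≠ j1 ∨ t + 1 ≠ p) → G0.Adj (f j t) (f j (t + 1)) := by
    intro j t ht h
    rcases hG _ _ (hR.1 j t ht) with h' | ⟨h1, h2⟩ | ⟨h1, h2⟩
    · exact h'
    · obtain ⟨rfl, h3⟩ := hR.2 _ _ _ _ ht.le om h1
      grind
    · have := (hR.2 _ _ _ _ ht.le hp h2).2
      obtain ⟨rfl, h3⟩ := hR.2 _ _ _ _ ht om h1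
      omega
  have ex : ∀ j, ∃ σ, j ≠ j1 → σ ≤ N j ∧ f j σ ∈ S := by
    intro j
    by_cases hj : j = j1
    · grind
    have hC := conn_seg (f := f j) (Nat.zero_le (N j)) (fun t _ ht => stp j t ht (.inl hj))
    by_contra! h
    refine hS _ hC ?_ ⟨f j 0, ⟨0, by simp, rfl⟩, hX j⟩ ⟨f j (N j), ⟨N j, by simp, rfl⟩, hY j⟩
    grind
  choose σ hσ using ex
  have hSe : (fun j => f j (σ j)) '' {j | j ≠ j1} = S := by
    apply Set.eq_of_subset_of_ncard_le
    · grind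
    · rw [Set.ncard_image_of_injOn]
      · have : {j | j ≠ j1} = ({j1} : Set (Fin g))ᶜ := rfl
        rw [this, Set.ncard_compl]; simp; omega
      · intro j hj j' hj' h; exact (hR.2 _ _ _ _ (hσ j hj).1 (hσ j' hj').1 h).1
    · exact S.toFinite
  have hSm : ∀ j q, q ≤ N j → f j q ∈ S → j ≠ j1 ∧ q = σ j := by
    intro j q hq h
    rw [← hSe] at h
    obtain ⟨j', hj', h⟩ := h
    obtain ⟨rfl, h3⟩ := hR.2 _ _ _ _ (hσ j' hj').1 hq h
    grind
  let L : Set V := {v | ∃ C, Conn G0 C ∧ Disjoint C S ∧ v ∈ C ∧ Mt C X}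
  let τ : Fin g → ℕ := fun j => if j = j1 then p else σ j
  have pre : ∀ j q, q ≤ N j → q < τ j → f j q ∈ L := by
    intro j q hq h
    refine ⟨_, conn_seg (f := f j) (Nat.zero_le q) (fun t _ ht => stp j t om ?_), ?_,
      ⟨q, by simp, rfl⟩, ⟨f j 0, ⟨0, by simp, rfl⟩, hX j⟩⟩
    · grind
    · rw [Set.disjoint_left]; rintro _ ⟨i, hi, rfl⟩ hs
      obtain ⟨h1, h2⟩ := hSm j i (hi.2.trans hq) hs
      simp [τ, h1] at h; have := hi.2; omega
  have suf : ∀ j q, q ≤ N j → (τ j < q ∨ (j = j1 ∧ p ≤ q)) → f j q ∉ L := by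
    rintro j q hq h ⟨C, hC, hCS, hqC, hCX⟩
    have h3 : ∀ t, q ≤ t → t + 1 ≠ p ∨ j ≠ j1 := by grind
    have h1 := conn_seg (f := f j) (i := q) (j := N j) hq (fun t h1 ht => stp j t ht (h3 t h1).symm)
    refine hS _ (hC.union h1 ⟨_, hqC, f j q, ⟨q, by simpa using hq, rfl⟩, .inl rfl⟩) ?_ ?_
      ⟨f j (N j), .inr ⟨N j, by simpa using hq, rfl⟩, hY j⟩
    · rw [Set.disjoint_union_left]; refine ⟨hCS, ?_⟩
      rw [Set.disjoint_left]; rintro _ ⟨i, hi, rfl⟩ hs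
      obtain ⟨h1, h2⟩ := hSm j i hi.2 hs
      have := hi.1
      rcases h with h | h
      · grind
      · exact h1 h.1
    · obtain ⟨x, hx, hx'⟩ := hCX; exact ⟨x, .inl hx, hx'⟩
  refine ⟨S, L, hSg.le, ?_, ?_, ?_⟩
  · intro A hA hab hAS
    have hA0 : Conn G0 A := ⟨hA.1, fun P h1 h2 => hA.2 P h1 fun u hu v hv ha => by
      rcases hG _ _ ha with h | ⟨rfl, rfl⟩ | ⟨rfl, rfl⟩
      · exact h2 u hu v hv h
      · grind
      · grind⟩
    by_cases hd : Disjoint A L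
    · exact .inr hd
    left
    obtain ⟨x, hx, C, hC, hCS, hxC, y, hy, hyX⟩ := Set.not_disjoint_iff.1 hd
    intro z hz
    exact ⟨A ∪ C, hA0.union hC ⟨x, hx, x, hxC, .inl rfl⟩, by simp [hAS, hCS], .inl hz, y, .inr hy, hyX⟩
  · grind
  grind
theorem exists_sort {n : ℕ} (p : Fin n → ℕ) (hp : Function.Injective p) :
    ∃ e : Fin n → Fin n, ∀ a b, a < b → p (e a) < p (e b) := by
  classical
  have hc : (Finset.univ.image p).card = n := by
    rw [Finset.card_image_of_injective _ hp]; simp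
  have ho : ∀ a, ∃ s, p s = (Finset.univ.image p).orderEmbOfFin hc a := fun a => by
    have := Finset.orderEmbOfFin_mem _ hc a
    grind
  choose e he using ho
  exact ⟨e, fun a b h => by rw [he, he]; exact (OrderEmbedding.lt_iff_lt _).2 h⟩
theorem cuts [Finite V] {G : SimpleGraph V} {X Y : Set V} {g n D : ℕ} {f : Fin g → ℕ → V}
    {N : Fin g → ℕ} (hR : Rows G f N) (hX : ∀ j, f j 0 ∈ X) (hY : ∀ j, f j (N j) ∈ Y)
    {A : Fin n → Set V} (hA : ∀ i, Conn G (A i)) (hd : ∀ i j, i ≠ j → Disjoint (A i) (A j))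
    (hcr : ∀ i x y, x ∉ A i → y ∈ A i → G.Adj x y → ¬ Lnk (G.deleteEdges {s(x, y)}) X Y g)
    (j1 : Fin g) (hm : ∀ i, ∃ p ≤ N j1, f j1 p ∈ A i) (hn : D * (D * g + 1) ≤ n) :
    ∃ φ : Fin D → Fin n, ∀ c c', c < c' → ∀ j p p', p ≤ N j → p' ≤ N j → f j p ∈ A (φ c) →
      f j p' ∈ A (φ c') → p < p' := by
  classical
  let p : Fin n → ℕ := fun i => Nat.find (hm i)
  have hp : ∀ i, p i ≤ N j1 ∧ f j1 (p i) ∈ A i := fun i => Nat.find_spec (hm i)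
  have hpm : ∀ i q, q < p i → ¬ (q ≤ N j1 ∧ f j1 q ∈ A i) := fun i q h => Nat.find_min (hm i) h
  have hpi : Function.Injective p := fun i i' h => by
    by_contra hne
    exact Set.disjoint_left.1 (hd i i' hne) (hp i).2 (h ▸ (hp i').2)
  obtain ⟨e, he⟩ := exists_sort p hpi
  have heinj : Function.Injective e := fun a b h => by
    by_contra hne
    rcases lt_or_gt_of_ne hne with h' | h' <;> have := he _ _ h' <;> rw [h] at this <;> omega
  have hcut : ∀ s : Fin n, 0 < s.val → ∃ S L : Set V, S.ncard ≤ g ∧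
      (∀ t, Disjoint (A (e t)) S → A (e t) ⊆ L ∨ Disjoint (A (e t)) L) ∧
      (∀ j q q', q ≤ N j → q' ≤ N j → f j q ∈ L → f j q' ∉ L → f j q' ∉ S → q < q') ∧
      ∀ q ≤ N j1, f j1 q ∈ L ↔ q < p (e s) := by
    intro s hs
    have h0 : 0 < p (e s) := by
      have := he ⟨0, om⟩ s hs; omega
    have hnot : f j1 (p (e s) - 1) ∉ A (e s) := fun h =>
      hpm (e s) (p (e s) - 1) om ⟨by have := (hp (e s)).1; omega, h⟩
    have hadj : G.Adj (f j1 (p (e s) - 1)) (f j1 (p (e s))) := by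
      have := hR.1 j1 (p (e s) - 1) (by have := (hp (e s)).1; omega)
      grind
    obtain ⟨S, L, h1, h2, h3, h4⟩ := cut1 hR hX hY h0 (hp (e s)).1
      (G0 := G.deleteEdges {s(f j1 (p (e s) - 1), f j1 (p (e s)))}) (fun x y h => by
        by_cases hh : s(x, y) = s(f j1 (p (e s) - 1), f j1 (p (e s)))
        · right; simpa [and_comm] using hh
        · left; simp only [deleteEdges_adj]; grind)
      (hcr _ _ _ hnot (hp (e s)).2 hadj)
    refine ⟨S, L, h1, fun t ht => h2 _ (hA _) ?_ ht, h3, h4⟩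
    rintro ⟨h5, h6⟩
    by_cases hts : e t = e s
    · grind
    · exact Set.disjoint_left.1 (hd _ _ hts) h6 (hp (e s)).2
  have hcut' : ∀ s : Fin n, ∃ S L : Set V, 0 < s.val → S.ncard ≤ g ∧
      (∀ t, Disjoint (A (e t)) S → A (e t) ⊆ L ∨ Disjoint (A (e t)) L) ∧
      (∀ j q q', q ≤ N j → q' ≤ N j → f j q ∈ L → f j q' ∉ L → f j q' ∉ S → q < q') ∧
      ∀ q ≤ N j1, f j1 q ∈ L ↔ q < p (e s) := fun s => by
    by_cases hs : 0 < s.val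
    · obtain ⟨S, L, h⟩ := hcut s hs; exact ⟨S, L, fun _ => h⟩
    · exact ⟨∅, ∅, fun h => absurd h hs⟩
  choose S L hSL using hcut'
  set q := D * g + 1 with hq
  have hlt : ∀ (c : Fin D) r, r < q → c * q + r < n := fun c r hr => by
    have : (c + 1) * q ≤ D * q := Nat.mul_le_mul_right _ c.2
    nlinarith
  let st : Fin D → Fin n := fun c => ⟨c * q, by have := hlt c 0 om; omega⟩
  let Z : Set V := ⋃ c ∈ {c : Fin D | 0 < (c : ℕ)}, S (st c)
  have hZ : Z.ncard ≤ D * g := by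
    have h1 : ∀ c : Fin D, (if 0 < (c : ℕ) then S (st c) else ∅).ncard ≤ g := by
      intro c; split_ifs with h
      · grind
      · simp
    have h2 : Z = ⋃ c : Fin D, (if 0 < (c : ℕ) then S (st c) else ∅) := by
      ext x; simp [Z]
    rw [h2]
    refine (Set.ncard_iUnion_le_of_fintype _).trans ?_
    refine (Finset.sum_le_sum fun c _ => h1 c).trans ?_
    simp
  have hgood : ∀ c : Fin D, ∃ t : Fin n, c * q ≤ t.val ∧ t.val < c * q + q ∧ Disjoint (A (e t)) Z := by
    intro c
    by_contra! hno
    have : ∀ r : Fin q, ∃ z ∈ Z, z ∈ A (e ⟨c * q + r, hlt c r r.2⟩) := fun r => by grind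
    choose z hz hzA using this
    have hzi : Function.Injective z := fun r r' h => by
      by_contra hne
      have : e ⟨c * q + r, hlt c r r.2⟩ ≠ e ⟨c * q + r', hlt c r' r'.2⟩ := fun h => by grind
      exact Set.disjoint_left.1 (hd _ _ this) (hzA r) (h ▸ hzA r')
    have h1 : (Set.range z).ncard = q := by
      rw [← image_univ, Set.ncard_image_of_injective _ hzi, Set.ncard_univ]; simp
    have h2 : (Set.range z).ncard ≤ Z.ncard :=
      Set.ncard_le_ncard (by rintro _ ⟨r, rfl⟩; exact hz r) Z.toFinite
    omega
  choose t ht1 ht2 htZ using hgood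
  refine ⟨fun c => e (t c), ?_⟩
  intro c c' hcc j r r' hr hr' hrA hrA'
  have hcc' : (c : ℕ) + 1 ≤ c' := hcc
  obtain ⟨h1, h2, h3, h4⟩ := hSL (st c') (Nat.mul_pos (show 0 < (c' : ℕ) by omega) om)
  have hsub : S (st c') ⊆ Z := fun x hx => by
    simp only [Z, mem_iUnion]; exact ⟨c', show 0 < (c' : ℕ) by omega, hx⟩
  have hlt1 : t c < st c' := by
    show (t c).val < c' * q
    have : ((c : ℕ) + 1) * q ≤ c' * q := Nat.mul_le_mul_right _ hcc'
    have := ht2 c; nlinarith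
  have hge1 : st c' ≤ t c' := ht1 c'
  have hin : A (e (t c)) ⊆ L (st c') := by
    rcases h2 (t c) ((htZ c).mono_right hsub) with h | h
    · exact h
    · exact absurd ((h4 _ (hp _).1).2 (he _ _ hlt1)) (Set.disjoint_left.1 h (hp (e (t c))).2)
  have hout : Disjoint (A (e (t c'))) (L (st c')) := by
    rcases h2 (t c') ((htZ c').mono_right hsub) with h | h
    · have := (h4 _ (hp _).1).1 (h (hp (e (t c'))).2)
      rcases hge1.lt_or_eq with h' | h'
      · have := he _ _ h'; omega
      · rw [← h'] at this; omega
    · exact h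
  exact h3 j r r' hr hr' (hin hrA) (Set.disjoint_left.1 hout hrA')
    (fun hs => Set.disjoint_left.1 (htZ c') hrA' (hsub hs))
def Strip (G : SimpleGraph V) (D h : ℕ) : Prop :=
  ∃ (f : Fin h → ℕ → V) (N : Fin h → ℕ) (A : Fin D → Set V), Rows G f N ∧ (∀ i, Conn G (A i)) ∧
    (∀ i j, i ≠ j → Disjoint (A i) (A j)) ∧ (∀ i j, ∃ p ≤ N j, f j p ∈ A i) ∧
    ∀ c c', c < c' → ∀ j p p', p ≤ N j → p' ≤ N j → f j p ∈ A c → f j p' ∈ A c' → p < p'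
theorem Strip.mono {G G' : SimpleGraph V} {D h : ℕ} (hle : G ≤ G') : Strip G D h → Strip G' D h := by
  rintro ⟨f, N, A, h1, h2, h3⟩
  exact ⟨f, N, A, ⟨fun j i hi => hle (h1.1 j i hi), h1.2⟩, fun i => (h2 i).mono hle, h3⟩
theorem lnk_fin {G : SimpleGraph V} {A B : Set V} {g k : ℕ} {C : Fin g → Set V}
    (h : ∀ i, Conn G (C i)) (hd : ∀ i j, i ≠ j → Disjoint (C i) (C j)) (J : Finset (Fin g))
    (hJ : k ≤ J.card) (hm : ∀ j ∈ J, Mt (C j) A ∧ Mt (C j) B) : Lnk G A B k := by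
  obtain ⟨J', hJ', hc⟩ := Finset.exists_subset_card_eq hJ
  let o := J'.orderEmbOfFin hc
  refine ⟨fun i => C (o i), fun i => ⟨h _, hm _ (hJ' (Finset.orderEmbOfFin_mem _ hc i))⟩,
    fun i j hij => hd _ _ fun h => hij (o.injective h)⟩
theorem exists_min [Finite V] {G : SimpleGraph V} {X Y : Set V} {g n : ℕ} {A : Fin n → Set V}
    (hA : ∀ i, Conn G (A i)) (hd : ∀ i j, i ≠ j → Disjoint (A i) (A j)) (hL : Lnk G X Y g) :
    ∃ G' ≤ G, (∀ i, Conn G' (A i)) ∧ Lnk G' X Y g ∧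
      ∀ i x y, x ∉ A i → y ∈ A i → G'.Adj x y → ¬ Lnk (G'.deleteEdges {s(x, y)}) X Y g := by
  obtain ⟨G', ⟨h1, h2, h3⟩, hmin⟩ := exists_minimal_of_wellFoundedLT
    (fun G' : SimpleGraph V => G' ≤ G ∧ (∀ i, ∀ x ∈ A i, ∀ y ∈ A i, G.Adj x y → G'.Adj x y) ∧ Lnk G' X Y g)
    ⟨G, le_rfl, fun i x _ y _ h => h, hL⟩
  refine ⟨G', h1, fun i => ⟨(hA i).1, fun P hP hc => (hA i).2 P hP fun u hu v hv ha =>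
    hc u hu v hv (h2 i u hu v hv ha)⟩, h3, ?_⟩
  intro i x y hx hy ha hL'
  have := hmin (y := G'.deleteEdges {s(x, y)}) ⟨(deleteEdges_le _).trans h1, ?_, hL'⟩ (deleteEdges_le _) ha
  · simp at this
  · intro i' u hu v hv huv
    rw [deleteEdges_adj]
    refine ⟨h2 i' u hu v hv huv, ?_⟩
    intro h
    have h : s(u, v) = s(x, y) := h
    rw [Sym2.eq_iff] at h
    have : x ∈ A i' ∧ y ∈ A i' := by grind
    by_cases hii : i = i'
    · grind
    · exact Set.disjoint_left.1 (hd _ _ hii) hy this.2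
theorem lemmaL (D h : ℕ) (hh : 0 < h) (hD : 0 < D) (K : ℕ) : ∃ F, ∀ (V : Type) [Finite V] (G : SimpleGraph V) (X Y : Fin K → Set V),
    (∀ t, Lnk G (X t) (Y t) F) → Strip G D h ∨ ∃ R : Fin K → Set V,
      (∀ t, Conn G (R t) ∧ Mt (R t) (X t) ∧ Mt (R t) (Y t)) ∧ ∀ i j, i ≠ j → Disjoint (R i) (R j) := by
  classical
  induction K with
  | zero => exact ⟨0, fun V _ G X Y _ => .inr ⟨fun _ => ∅, fun t => t.elim0, fun t => t.elim0⟩⟩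
  | succ K ih =>
  obtain ⟨F, hF⟩ := ih
  set g := F + h with hg
  set n' := D * (D * g + 1) with hn'
  set n := K * 2 ^ g * n' + 1 with hn
  refine ⟨n + g, fun V _ G X Y hL => ?_⟩
  obtain ⟨A, hA, hAd⟩ : Lnk G (X 0) (Y 0) n := by
    obtain ⟨C, hC, hd⟩ := hL 0
    exact ⟨fun i => C (i.castAdd g), fun i => hC _, fun i j hij => hd _ _ fun h => hij (by simpa using h)⟩
  have hLg : ∀ t : Fin K, Lnk G (X t.succ) (Y t.succ) g := fun t => by
    obtain ⟨C, hC, hd⟩ := hL t.succ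
    exact ⟨fun i => C (i.natAdd n), fun i => hC _, fun i j hij => hd _ _ fun h => hij (by simpa using h)⟩
  choose G' hG' hG'A hG'L hcr using fun t => exists_min (fun i => (hA i).1) hAd (hLg t)
  choose C hC hCd using hG'L
  choose f N hf0 hfN hfC hfP _ _ using fun t j => exists_path (hC t j).1 (hC t j).2.1 (hC t j).2.2
  have hRows : ∀ t, Rows (G' t) (f t) (N t) := fun t => ⟨fun j i hi => (hfP t j).1 i hi, by
    intro j j' q q' hq hq' he
    have : j = j' := by
      by_contra hne
      exact Set.disjoint_left.1 (hCd t j j' hne) (hfC t j q hq) (he ▸ hfC t j' q' hq')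
    subst this
    refine ⟨rfl, ?_⟩
    by_contra hne
    rcases lt_or_gt_of_ne hne with h | h
    · exact ((hfP t j).2 _ _ h hq').1 he
    · exact ((hfP t j).2 _ _ h hq).1 he.symm⟩
  let J : Fin n → Fin K → Finset (Fin g) := fun i t => Finset.univ.filter fun j => ∃ p ≤ N t j, f t j p ∈ A i
  by_cases hgood : ∃ i, ∀ t, F ≤ (J i t)ᶜ.card
  · obtain ⟨i, hi⟩ := hgood
    have hrow : ∀ t, ∀ j, j ∈ (J i t)ᶜ → f t j '' Icc 0 (N t j) ⊆ (A i)ᶜ := by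
      rintro t j hj _ ⟨p, hp, rfl⟩ hpA
      simp [J] at hj
      exact hj p hp.2 hpA
    have := hF V (rst G (A i)ᶜ) (fun t => X t.succ \ A i) (fun t => Y t.succ \ A i) (fun t => by
      refine lnk_fin (C := fun j => if j ∈ (J i t)ᶜ then f t j '' Icc 0 (N t j) else {f t j 0}) ?_ ?_ (J i t)ᶜ (hi t) ?_
      · intro j
        split_ifs with hj
        · exact ((conn_seg (Nat.zero_le _) fun s _ hs => (hRows t).1 j s hs).mono (hG' t)).rst (hrow t j hj)
        · exact conn_single _ _
      · intro j j' hjj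
        have hsub : ∀ j, (if j ∈ (J i t)ᶜ then f t j '' Icc 0 (N t j) else {f t j 0}) ⊆ C t j := by grind
        exact (hCd t j j' hjj).mono (hsub j) (hsub j')
      · intro j hj
        rw [if_pos hj]
        have h0 : f t j 0 ∈ f t j '' Icc 0 (N t j) := ⟨0, by simp, rfl⟩
        have h1 : f t j (N t j) ∈ f t j '' Icc 0 (N t j) := ⟨N t j, by simp, rfl⟩
        exact ⟨⟨_, h0, hf0 t j, hrow t j hj h0⟩, ⟨_, h1, hfN t j, hrow t j hj h1⟩⟩)
    rcases this with h | ⟨R, hR, hRd⟩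
    · exact .inl (h.mono rst_le)
    · right
      have hRA : ∀ t, R t ⊆ (A i)ᶜ := fun t => by
        obtain ⟨x, hx, hx'⟩ := (hR t).2.1
        exact conn_rst (hR t).1 ⟨x, hx, hx'.2⟩
      refine ⟨Fin.cons (A i) R, ?_, ?_⟩
      · intro t
        refine Fin.cases ?_ (fun t => ?_) t
        · exact hA i
        · obtain ⟨h1, ⟨x, hx, hx'⟩, ⟨y, hy, hy'⟩⟩ := hR t
          exact ⟨h1.mono rst_le, ⟨x, hx, hx'.1⟩, ⟨y, hy, hy'.1⟩⟩
      · intro s t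
        refine Fin.cases ?_ (fun s => ?_) s <;> refine Fin.cases ?_ (fun t => ?_) t
        · simp
        · intro _; simp only [Fin.cons_zero, Fin.cons_succ]
          rw [Set.disjoint_right]; exact fun x hx => hRA t hx
        · intro _; simp only [Fin.cons_zero, Fin.cons_succ]
          rw [Set.disjoint_left]; exact fun x hx => hRA s hx
        · intro hst; simp only [Fin.cons_succ]; exact hRd _ _ fun h => hst (by rw [h])
  · left
    push Not at hgood
    choose t ht using hgood
    obtain ⟨⟨t0, J0⟩, _, hfib⟩ := Finset.exists_lt_card_fiber_of_mul_lt_card_of_maps_to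
      (s := (Finset.univ : Finset (Fin n))) (t := (Finset.univ : Finset (Fin K × Finset (Fin g))))
      (f := fun i => (t i, J i (t i))) (n := n' - 1) (fun _ _ => Finset.mem_univ _) (by
        simp only [Finset.card_univ, Fintype.card_prod, Fintype.card_fin, Fintype.card_finset]
        rw [hn]
        have := Nat.mul_le_mul_left (K * 2 ^ g) (Nat.sub_le n' 1)
        omega)
    obtain ⟨I, hI, hIc⟩ := Finset.exists_subset_card_eq (Nat.le_of_pred_lt hfib)
    let o := I.orderEmbOfFin hIc
    have ho : ∀ a, t (o a) = t0 ∧ J (o a) t0 = J0 := fun a => by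
      have := hI (Finset.orderEmbOfFin_mem _ hIc a)
      simp only [Finset.mem_filter, Prod.mk.injEq] at this
      grind
    have hn0 : 0 < n' := by positivity
    have hJ0 : h ≤ J0.card := by
      have h1 := ht (o ⟨0, hn0⟩)
      rw [(ho _).1, (ho _).2, Finset.card_compl] at h1
      simp at h1; omega
    obtain ⟨J1, hJ1, hJc⟩ := Finset.exists_subset_card_eq hJ0
    let r := J1.orderEmbOfFin hJc
    have hr : ∀ b, r b ∈ J0 := fun b => hJ1 (Finset.orderEmbOfFin_mem _ hJc b)
    have hmeet : ∀ a b, ∃ p ≤ N t0 (r b), f t0 (r b) p ∈ A (o a) := fun a b => by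
      have := hr b
      rw [← (ho a).2] at this
      simpa [J] using this
    obtain ⟨φ, hφ⟩ := cuts (D := D) (hRows t0) (hf0 t0) (hfN t0) (A := fun a => A (o a)) (fun a => hG'A t0 _)
      (fun a b hab => hAd _ _ fun h => hab (o.injective h)) (fun a => hcr t0 _) (r ⟨0, hh⟩)
      (fun a => hmeet a _) le_rfl
    refine Strip.mono (hG' t0) ⟨fun b => f t0 (r b), fun b => N t0 (r b), fun c => A (o (φ c)),
      ⟨fun j => (hRows t0).1 _, fun j j' q q' h1 h2 h3 => ?_⟩, fun c => hG'A t0 _, ?_, fun c b => hmeet _ _,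
      fun c c' hcc j => hφ c c' hcc (r j)⟩
    · obtain ⟨h4, h5⟩ := (hRows t0).2 _ _ _ _ h1 h2 h3
      exact ⟨r.injective h4, h5⟩
    · intro c c' hcc
      refine hAd _ _ fun he => ?_
      have he : φ c = φ c' := o.injective he
      obtain ⟨p, hp, hpA⟩ := hmeet (φ c) ⟨0, hh⟩
      rcases lt_or_gt_of_ne hcc with h' | h'
      · exact lt_irrefl _ (hφ _ _ h' _ p p hp hp hpA (he ▸ hpA))
      · exact lt_irrefl _ (hφ _ _ h' _ p p hp hp (he ▸ hpA) hpA)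
end Paper

namespace Paper
variable {V : Type}
def Ed (G : SimpleGraph V) (X Y : Set V) : Prop := ∃ x ∈ X, ∃ y ∈ Y, G.Adj x y
theorem Ed.symm {G : SimpleGraph V} {X Y : Set V} : Ed G X Y → Ed G Y X :=
  fun ⟨x, hx, y, hy, h⟩ => ⟨y, hy, x, hx, h.symm⟩
theorem Ed.mono {G : SimpleGraph V} {X Y X' Y' : Set V} (h1 : X ⊆ X') (h2 : Y ⊆ Y') : Ed G X Y → Ed G X' Y' :=
  fun ⟨x, hx, y, hy, h⟩ => ⟨x, h1 hx, y, h2 hy, h⟩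
def Minor {W : Type} (G : SimpleGraph V) (H : SimpleGraph W) : Prop :=
  ∃ μ : W → Set V, (∀ w, Conn G (μ w)) ∧ (∀ w w', w ≠ w' → Disjoint (μ w) (μ w')) ∧
    ∀ w w', H.Adj w w' → Ed G (μ w) (μ w')
theorem ext_cells [Finite V] {ι : Type} [Nonempty ι] {G : SimpleGraph V} {M : Set V} (hM : Conn G M) (S : ι → Set V)
    (h1 : ∀ i, Conn G (S i) ∧ S i ⊆ M) (h2 : ∀ i j, i ≠ j → Disjoint (S i) (S j)) :
    ∃ C : ι → Set V, (∀ i, Conn G (C i) ∧ S i ⊆ C i ∧ C i ⊆ M) ∧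
      (∀ i j, i ≠ j → Disjoint (C i) (C j)) ∧ ∀ x ∈ M, ∃ i, x ∈ C i := by
  classical
  by_cases hc : ∀ x ∈ M, ∃ i, x ∈ S i
  · exact ⟨S, fun i => ⟨(h1 i).1, le_rfl, (h1 i).2⟩, h2, hc⟩
  push Not at hc
  obtain ⟨i0⟩ := ‹Nonempty ι›
  obtain ⟨y, hy, hyn⟩ := hc
  obtain ⟨z, hz⟩ := (h1 i0).1.1
  obtain ⟨u, hu, v, hv, huT, hvT, huv⟩ := hM.edge (T := {x | ∃ i, x ∈ S i}) ⟨z, (h1 i0).2 hz, i0, hz⟩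
    ⟨y, hy, by simpa using hyn⟩
  obtain ⟨i, hi⟩ := huT
  have hvT : ∀ j, v ∉ S j := by simpa using hvT
  haveI : Nonempty ι := ⟨i⟩
  let S' : ι → Set V := Function.update S i (insert v (S i))
  have hS'i : S' i = insert v (S i) := by simp [S']
  have hS'j : ∀ j, j ≠ i → S' j = S j := fun j hj => by simp [S', hj]
  have : (M \ {x | ∃ i, x ∈ S' i}).ncard < (M \ {x | ∃ i, x ∈ S i}).ncard := by
    apply Set.ncard_lt_ncard _ (Set.toFinite _)
    refine ⟨fun x hx => ⟨hx.1, ?_⟩, fun h => (h (⟨hv, by simpa using hvT⟩)).2 ⟨i, by simp [hS'i]⟩⟩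
    rintro ⟨j, hj⟩
    refine hx.2 ⟨j, ?_⟩
    by_cases hji : j = i
    · grind
    · grind
  obtain ⟨C, hC1, hC2, hC3⟩ := ext_cells hM S' (fun j => by
      by_cases hji : j = i
      · subst hji; rw [hS'i]
        exact ⟨(h1 j).1.ins ⟨u, hi, huv.symm⟩, Set.insert_subset hv (h1 j).2⟩
      grind) (fun j k hjk => by
      grind)
  refine ⟨C, fun j => ⟨(hC1 j).1, ?_, (hC1 j).2.2⟩, hC2, hC3⟩
  grind
termination_by (M \ {x | ∃ i, x ∈ S i}).ncard
def colG {h : ℕ} (G : SimpleGraph V) (C : Fin h → Set V) : SimpleGraph (Fin h) :=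
  SimpleGraph.fromRel fun l l' => Ed G (C l) (C l')
theorem colG_ed {h : ℕ} {G : SimpleGraph V} {C : Fin h → Set V} {l l' : Fin h} (hl : (colG G C).Adj l l') :
    Ed G (C l) (C l') := by
  simp only [colG, fromRel_adj] at hl
  exact hl.2.elim id Ed.symm
theorem colG_conn {h : ℕ} {G : SimpleGraph V} {C : Fin h → Set V} {M : Set V} (hM : Conn G M)
    (hC : ∀ i, (C i).Nonempty ∧ C i ⊆ M) (hc : ∀ x ∈ M, ∃ i, x ∈ C i) (hd : ∀ i j, i ≠ j → Disjoint (C i) (C j))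
    (h0 : 0 < h) :
    Conn (colG G C) Set.univ := by
  refine ⟨⟨⟨0, h0⟩, trivial⟩, ?_⟩
  rintro P ⟨l, _, hl⟩ hP l' _
  obtain ⟨x, hx⟩ := (hC l).1
  obtain ⟨y, hy⟩ := (hC l').1
  have := hM.2 (fun v => ∀ i, v ∈ C i → P i) ⟨x, (hC l).2 hx, fun i hi => by
    by_cases h : l = i
    · exact h ▸ hl
    · exact absurd hi (Set.disjoint_left.1 (hd _ _ h) hx)⟩ (fun u hu v hv huv h i hi => by
    obtain ⟨j, hj⟩ := hc u hu
    by_cases hji : j = i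
    · grind
    · refine hP j trivial i trivial ?_ (h j hj)
      simp only [colG, fromRel_adj]
      exact ⟨hji, .inl ⟨u, hj, v, hi, huv⟩⟩) y ((hC l').2 hy)
  exact this l' hy
theorem strip_cols [Finite V] {G : SimpleGraph V} {d h : ℕ} (h0 : 0 < h) (hS : Strip G (d + 1) h) :
    ∃ C : ℕ → Fin h → Set V, (∀ c < d, ∀ l, Conn G (C c l)) ∧
      (∀ c < d, ∀ c' < d, ∀ l l', c ≠ c' ∨ l ≠ l' → Disjoint (C c l) (C c' l')) ∧
      (∀ c, c + 1 < d → ∀ l, Ed G (C c l) (C (c + 1) l)) ∧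
      ∀ c < d, Conn (colG G (C c)) Set.univ := by
  classical
  obtain ⟨f, N, A0, hR, hA, hAd, hm, hord⟩ := hS
  let A : ℕ → Set V := fun t => if ht : t < d + 1 then A0 ⟨t, ht⟩ else ∅
  have hAe : ∀ t (ht : t < d + 1), A t = A0 ⟨t, ht⟩ := fun t ht => dif_pos ht
  have hm' : ∀ t l, ∃ p, t < d + 1 → (p ≤ N l ∧ f l p ∈ A t) ∧ ∀ q < p, f l q ∉ A t := by
    intro t l
    by_cases ht : t < d + 1
    · refine ⟨Nat.find (hm ⟨t, ht⟩ l), fun _ => ⟨?_, fun q hq => ?_⟩⟩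
      · grind
      · have := Nat.find_min (hm ⟨t, ht⟩ l) hq
        grind
    · exact ⟨0, fun h => absurd h ht⟩
  choose p hp using hm'
  have hlt : ∀ t t' l q, t < t' → t' < d + 1 → q ≤ N l → f l q ∈ A t → q < p t' l := by grind
  have hplt : ∀ t t' l, t < t' → t' < d + 1 → p t l < p t' l := fun t t' l h1 h2 =>
    hlt t t' l _ h1 h2 (hp t l om).1.1 (hp t l om).1.2
  have hple : ∀ t t' l, t ≤ t' → t' < d + 1 → p t l ≤ p t' l := fun t t' l h1 h2 => by grind
  let sg : ℕ → Fin h → Set V := fun t l => f l '' Icc (p t l) (p (t + 1) l - 1)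
  have hsgC : ∀ t < d, ∀ l, Conn G (sg t l) := fun t ht l =>
    conn_seg (by have := hplt t (t + 1) l om om; omega) fun s h1 h2 => hR.1 l s (by
      have := (hp (t + 1) l om).1.1; omega)
  have hsgd : ∀ t < d, ∀ t' < d, ∀ l l', t ≠ t' ∨ l ≠ l' → Disjoint (sg t l) (sg t' l') := by
    intro t ht t' ht' l l' hne
    rw [Set.disjoint_left]
    rintro _ ⟨i, hi, rfl⟩ ⟨i', hi', he⟩
    have e1 := (hp (t + 1) l om).1.1
    have e2 := (hp (t' + 1) l' om).1.1
    have e3 := hplt t (t + 1) l om om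
    have e4 := hplt t' (t' + 1) l' om om
    have e5 := hi.1; have e6 := hi.2; have e7 := hi'.1; have e8 := hi'.2
    obtain ⟨rfl, rfl⟩ := hR.2 _ _ _ _ om om he
    rcases hne with hne | hne
    · rcases lt_or_gt_of_ne hne with h | h
      · have := hple (t + 1) t' l' h om; omega
      · have := hple (t' + 1) t l' h om; omega
    · exact hne rfl
  have hAsg : ∀ t < d, ∀ t' < d, ∀ l, t ≠ t' → Disjoint (A t) (sg t' l) := by
    intro t ht t' ht' l hne
    rw [Set.disjoint_right]
    rintro _ ⟨i, hi, rfl⟩ hA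
    have e1 := (hp (t' + 1) l om).1.1
    have e5 := hi.1; have e6 := hi.2
    have e4 := hplt t' (t' + 1) l om om
    rcases lt_or_gt_of_ne hne with h | h
    · have := hlt t t' l i h om om hA; omega
    · have := hple (t' + 1) t l h om
      exact (hp t l om).2 i om hA
  let M : ℕ → Set V := fun t => A t ∪ ⋃ l ∈ (Set.univ : Set (Fin h)), sg t l
  have hpsg : ∀ t < d, ∀ l, f l (p t l) ∈ sg t l := fun t ht l =>
    ⟨p t l, ⟨le_rfl, by have := hplt t (t + 1) l om om; omega⟩, rfl⟩
  have hM : ∀ t < d, Conn G (M t) := by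
    intro t ht
    refine Conn.biUnion (by grind) (fun l _ => hsgC t ht l) (fun l _ => ?_)
    grind
  have hMd : ∀ t < d, ∀ t' < d, t ≠ t' → Disjoint (M t) (M t') := by
    intro t ht t' ht' hne
    simp only [M, Set.disjoint_union_left, Set.disjoint_union_right, Set.disjoint_iUnion_left,
      Set.disjoint_iUnion_right]
    refine ⟨⟨?_, fun l _ => (hAsg t' ht' t ht l hne.symm).symm⟩, fun l' _ => ⟨hAsg t ht t' ht' l' hne, fun l _ => hsgd t ht t' ht' _ _ (.inl hne)⟩⟩
    rw [hAe t om, hAe t' om]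
    exact hAd _ _ (by simpa using hne)
  haveI : Nonempty (Fin h) := ⟨⟨0, h0⟩⟩
  have hex : ∀ t, ∃ C : Fin h → Set V, t < d → (∀ i, Conn G (C i) ∧ sg t i ⊆ C i ∧ C i ⊆ M t) ∧
      (∀ i j, i ≠ j → Disjoint (C i) (C j)) ∧ ∀ x ∈ M t, ∃ i, x ∈ C i := fun t => by
    by_cases ht : t < d
    · obtain ⟨C, hC⟩ := ext_cells (hM t ht) (sg t) (fun l => ⟨hsgC t ht l, fun x hx => .inr (by
        simp only [mem_iUnion]; exact ⟨l, trivial, hx⟩)⟩) (fun l l' hl => hsgd t ht t ht l l' (.inr hl))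
      exact ⟨C, fun _ => hC⟩
    · exact ⟨fun _ => ∅, fun h => absurd h ht⟩
  choose C hC using hex
  refine ⟨C, fun c hc l => ((hC c hc).1 l).1, ?_, ?_, ?_⟩
  · intro c hc c' hc' l l' hne
    by_cases h : c = c'
    · grind
    · exact (hMd c hc c' hc' h).mono ((hC c hc).1 l).2.2 ((hC c' hc').1 l').2.2
  · intro c hc l
    have e1 := hplt c (c + 1) l om om
    refine ⟨f l (p (c + 1) l - 1), ((hC c om).1 l).2.1 ⟨_, ⟨by omega, le_rfl⟩, rfl⟩, f l (p (c + 1) l),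
      ((hC (c + 1) hc).1 l).2.1 (hpsg _ hc l), ?_⟩
    have := hR.1 l (p (c + 1) l - 1) (by have := (hp (c + 1) l om).1.1; omega)
    rwa [Nat.sub_add_cancel om] at this
  · intro c hc
    exact colG_conn (hM c hc) (fun i => ⟨((hC c hc).1 i).1.1, ((hC c hc).1 i).2.2⟩) (hC c hc).2.2 (hC c hc).2.1 h0
end Paper

namespace Paper
variable {V : Type}
def Cells (G : SimpleGraph V) {h : ℕ} (q : ℕ) (R : SimpleGraph (Fin h)) (C : ℕ → Fin h → Set V) : Prop :=
  (∀ c < q, ∀ l, Conn G (C c l)) ∧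
  (∀ c < q, ∀ c' < q, ∀ l l', c ≠ c' ∨ l ≠ l' → Disjoint (C c l) (C c' l')) ∧
  (∀ c, c + 1 < q → ∀ l, Ed G (C c l) (C (c + 1) l)) ∧
  ∀ c < q, ∀ l l', R.Adj l l' → Ed G (C c l) (C c l')
theorem conn_row {G : SimpleGraph V} {C : ℕ → Set V} {a b : ℕ} (hab : a ≤ b)
    (h1 : ∀ c, a ≤ c → c ≤ b → Conn G (C c)) (h2 : ∀ c, a ≤ c → c < b → Ed G (C c) (C (c + 1))) :
    Conn G (⋃ c ∈ Icc a b, C c) := by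
  induction b, hab using Nat.le_induction with
  | base => simpa using h1 a le_rfl le_rfl
  | succ b hb ih =>
    have : (⋃ c ∈ Icc a (b + 1), C c) = (⋃ c ∈ Icc a b, C c) ∪ C (b + 1) := by
      ext x; simp only [mem_iUnion, Set.mem_union, Set.mem_Icc]
      grind
    rw [this]
    refine (ih (fun c h3 h4 => h1 c h3 om) fun c h3 h4 => h2 c h3 om).union (h1 _ om le_rfl) ?_
    obtain ⟨x, hx, y, hy, h⟩ := h2 b hb om
    exact ⟨x, by simp only [mem_iUnion]; grind, y, hy, .inr h⟩
theorem strip_cells {h q : ℕ} (h0 : 0 < h) : ∃ D, 0 < D ∧ ∀ (V : Type) [Finite V] (G : SimpleGraph V),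
    Strip G D h → ∃ (R : SimpleGraph (Fin h)) (C : ℕ → Fin h → Set V), Conn R Set.univ ∧ Cells G q R C := by
  classical
  haveI : Fintype (SimpleGraph (Fin h)) := Fintype.ofFinite _
  set d := Fintype.card (SimpleGraph (Fin h)) * q + 1 with hd
  refine ⟨d + 1, om, fun V _ G hS => ?_⟩
  obtain ⟨C, h1, h2, h3, h4⟩ := strip_cols h0 hS
  obtain ⟨R, _, hfib⟩ := Finset.exists_lt_card_fiber_of_mul_lt_card_of_maps_to
      (s := (Finset.univ : Finset (Fin d))) (t := (Finset.univ : Finset (SimpleGraph (Fin h))))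
      (f := fun i => colG G (C i)) (n := q) (fun _ _ => Finset.mem_univ _) (by simp [hd])
  obtain ⟨I, hI, hIc⟩ := Finset.exists_subset_card_eq (Nat.succ_le_of_lt hfib)
  let o' := I.orderEmbOfFin hIc
  let o : ℕ → ℕ := fun s => if hs : s < q + 1 then o' ⟨s, hs⟩ else 0
  have hoe : ∀ s (hs : s < q + 1), o s = o' ⟨s, hs⟩ := fun s hs => dif_pos hs
  have holt : ∀ s < q + 1, o s < d := fun s hs => by grind
  have homono : ∀ s s', s < s' → s' < q + 1 → o s < o s' := fun s s' hs hs' => by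
    rw [hoe s om, hoe s' hs']; exact Fin.lt_def.1 (o'.strictMono hs)
  have hoR : ∀ s < q + 1, colG G (C (o s)) = R := fun s hs => by
    have := hI (Finset.orderEmbOfFin_mem _ hIc ⟨s, hs⟩)
    rw [hoe s hs]
    simpa using this
  have hsub : ∀ s < q, ∀ l, C (o s) l ⊆ ⋃ c ∈ Icc (o s) (o (s + 1) - 1), C c l := fun s hs l x hx => by
    simp only [mem_iUnion]; exact ⟨o s, ⟨le_rfl, by have := homono s (s + 1) om om; omega⟩, hx⟩
  refine ⟨R, fun s l => ⋃ c ∈ Icc (o s) (o (s + 1) - 1), C c l, ?_, ?_, ?_, ?_, ?_⟩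
  · rw [← hoR 0 om]; exact h4 _ (holt 0 om)
  · intro s hs l
    have e1 := homono s (s + 1) om om
    have e2 := holt (s + 1) om
    exact conn_row (C := fun c => C c l) om (fun c _ _ => h1 c om l) (fun c _ _ => h3 c om l)
  · intro s hs s' hs' l l' hne
    have e1 := homono s (s + 1) om om
    have e2 := holt (s + 1) om
    have e1' := homono s' (s' + 1) om om
    have e2' := holt (s' + 1) om
    simp only [Set.disjoint_iUnion_left, Set.disjoint_iUnion_right]
    rintro c ⟨hc1, hc2⟩ c' ⟨hc1', hc2'⟩
    refine h2 _ om _ om _ _ ?_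
    rcases hne with hne | hne
    · left
      rcases lt_or_gt_of_ne hne with h' | h'
      · have : o (s + 1) ≤ o s' := by
          rcases (show s + 1 ≤ s' from h').lt_or_eq with h | h
          · exact (homono _ _ h om).le
          · rw [h]
        omega
      · have : o (s' + 1) ≤ o s := by
          rcases (show s' + 1 ≤ s from h').lt_or_eq with h | h
          · exact (homono _ _ h om).le
          · rw [h]
        omega
    · exact .inr hne
  · intro s hs l
    have e1 := homono s (s + 1) om om
    have e2 := holt (s + 1) om
    refine Ed.mono ?_ (hsub (s + 1) hs l) (Nat.sub_add_cancel (show 1 ≤ o (s + 1) by omega) ▸ h3 (o (s + 1) - 1) om l)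
    intro x hx; simp only [mem_iUnion]; exact ⟨o (s + 1) - 1, ⟨by omega, le_rfl⟩, hx⟩
  · intro s hs l l' hl
    rw [← hoR s om] at hl
    exact (colG_ed hl).mono (hsub s hs l) (hsub s hs l')
theorem path_or_star {h r : ℕ} (hr : 0 < r) (hh : (r + 1) ^ r < h) (R : SimpleGraph (Fin h)) (hR : Conn R Set.univ) :
    (∃ f : ℕ → Fin h, (∀ i j, i < r → j < r → f i = f j → i = j) ∧ ∀ i, i + 1 < r → R.Adj (f i) (f (i + 1))) ∨
    ∃ (z : Fin h) (f : ℕ → Fin h), (∀ i j, i < r → j < r → f i = f j → i = j) ∧ ∀ i < r, R.Adj z (f i) := by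
  classical
  by_cases hdeg : ∃ z, r ≤ (R.neighborSet z).ncard
  · right
    obtain ⟨z, hz⟩ := hdeg
    rw [Set.ncard_eq_toFinset_card _ (Set.toFinite _)] at hz
    obtain ⟨J, hJ, hJc⟩ := Finset.exists_subset_card_eq hz
    let o := J.orderEmbOfFin hJc
    refine ⟨z, fun i => if hi : i < r then o ⟨i, hi⟩ else z, ?_, ?_⟩
    · intro i j hi hj he
      simp only [hi, hj, dif_pos] at he
      simpa using o.injective he
    · intro i hi
      simp only [hi, dif_pos]
      have := hJ (Finset.orderEmbOfFin_mem _ hJc ⟨i, hi⟩)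
      simpa using this
  left
  push Not at hdeg
  obtain ⟨x, -⟩ := hR.1
  let S : ℕ → Set (Fin h) := fun i => (fun T : Set (Fin h) => ⋃ y ∈ T, insert y (R.neighborSet y))^[i] {x}
  have hS1 : ∀ i, S (i + 1) = ⋃ y ∈ S i, insert y (R.neighborSet y) := fun i => Function.iterate_succ_apply' _ _ _
  have hSc : ∀ i, (S i).ncard ≤ (r + 1) ^ i := by
    intro i
    induction i with
    | zero => simp [S]
    | succ i ih =>
      have h1 : S (i + 1) = ⋃ y : ↥(S i), insert y.1 (R.neighborSet y.1) := by rw [hS1]; simp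
      rw [h1]
      haveI : Fintype ↥(S i) := (Set.toFinite (S i)).fintype
      refine (Set.ncard_iUnion_le_of_fintype _).trans ?_
      refine (Finset.sum_le_card_nsmul _ _ (r + 1) fun y _ => (Set.ncard_insert_le _ _).trans (by grind)).trans ?_
      have : (Finset.univ : Finset ↥(S i)).card = (S i).ncard := by
        rw [Finset.card_univ, ← Nat.card_eq_fintype_card]; rfl
      rw [this, smul_eq_mul, pow_succ]
      exact Nat.mul_le_mul_right _ ih
  obtain ⟨y, hy⟩ : ∃ y, y ∉ S r := by
    by_contra! hall
    have : S r = Set.univ := Set.eq_univ_of_forall hall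
    have h2 := hSc r
    rw [this, Set.ncard_univ] at h2
    simp at h2; omega
  obtain ⟨f, n, hf0, hfn, -, hP, -, -⟩ := exists_path hR (A := {x}) (B := {y}) ⟨x, trivial, rfl⟩ ⟨y, trivial, rfl⟩
  have hf0 : f 0 = x := hf0
  have hfn : f n = y := hfn
  have hmono : ∀ i j, i ≤ j → S i ⊆ S j := by
    intro i j hij
    induction j, hij using Nat.le_induction with
    | base => exact le_rfl
    | succ j _ ih => rw [hS1]; intro z hz; simp only [mem_iUnion]; grind
  have hfS : ∀ i ≤ n, f i ∈ S i := by
    intro i hi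
    induction i with
    | zero => exact hf0
    | succ i ih => rw [hS1]; simp only [mem_iUnion]; exact ⟨f i, ih om, .inr (hP.1 i om)⟩
  have hnr : r < n := by grind
  refine ⟨f, fun i j hi hj he => ?_, fun i hi => hP.1 i om⟩
  by_contra hne
  rcases lt_or_gt_of_ne hne with h | h
  · exact (hP.2 i j h om).1 he
  · exact (hP.2 j i h om).1 he.symm
theorem wall_adj {r : ℕ} {w w' : Fin r × Fin (2 * r)} {E : Fin r × Fin (2 * r) → Fin r × Fin (2 * r) → Prop}
    (hs : ∀ w w', E w w' → E w' w)
    (h1 : ∀ w w', w.1 = w'.1 → w.2.val + 1 = w'.2.val → E w w')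
    (h2 : ∀ w w', w.2 = w'.2 → w.1.val + 1 = w'.1.val → E w w') (h : (Wall r).Adj w w') : E w w' := by
  simp only [Wall, fromRel_adj] at h
  grind
theorem cells_path {G : SimpleGraph V} {h r q : ℕ} {R : SimpleGraph (Fin h)} {C : ℕ → Fin h → Set V}
    (hC : Cells G q R C) (hq : 2 * r ≤ q) {f : ℕ → Fin h} (hf : ∀ i j, i < r → j < r → f i = f j → i = j)
    (ha : ∀ i, i + 1 < r → R.Adj (f i) (f (i + 1))) : Minor G (Wall r) := by
  refine ⟨fun w => C w.2 (f w.1), fun w => hC.1 _ om _, ?_, ?_⟩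
  · intro w w' hne
    refine hC.2.1 _ om _ om _ _ ?_
    by_contra! hh
    exact hne (Prod.ext (Fin.ext (hf _ _ w.1.2 w'.1.2 hh.2)) (Fin.ext hh.1))
  · intro w w' hw
    refine wall_adj (E := fun w w' => Ed G (C w.2 (f w.1)) (C w'.2 (f w'.1))) (fun _ _ => Ed.symm) ?_ ?_ hw
    · intro w w' h1 h2
      rw [← h1, ← h2]; exact hC.2.2.1 _ om _
    · intro w w' h1 h2
      rw [← h1, ← h2]; exact hC.2.2.2 _ om _ _ (ha _ om)
theorem cells_star {G : SimpleGraph V} {h r q : ℕ} {R : SimpleGraph (Fin h)} {C : ℕ → Fin h → Set V}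
    (hC : Cells G q R C) (hr : 0 < r) (hq : 2 * r * r ≤ q) {z : Fin h} {f : ℕ → Fin h} (hf : ∀ i j, i < r → j < r → f i = f j → i = j)
    (ha : ∀ i < r, R.Adj z (f i)) : Minor G (Wall r) := by
  have hlt : ∀ (j : Fin (2 * r)) s, s < r → j * r + s < q := fun j s hs => by
    have : (j + 1) * r ≤ 2 * r * r := Nat.mul_le_mul_right _ j.2
    nlinarith
  let B : Fin r × Fin (2 * r) → Set V := fun w => ⋃ c ∈ Icc (w.2 * r) (w.2 * r + (r - 1)), C c (f w.1)
  let Z : Fin r × Fin (2 * r) → Set V := fun w => C (w.2 * r + w.1) z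
  have hB : ∀ w (s : ℕ), s < r → C (w.2 * r + s) (f w.1) ⊆ B w := fun w s hs x hx => by
    simp only [B, mem_iUnion]; grind
  have key : ∀ (w w' : Fin r × Fin (2 * r)) s s', s < r → s' < r → w.2 * r + s = w'.2 * r + s' → w.2 = w'.2 ∧ s = s' := by
    intro w w' s s' hs hs' he
    have h1 : (w.2 * r + s) / r = w.2 := by rw [mul_comm, Nat.mul_add_div hr, Nat.div_eq_of_lt hs]; rfl
    have h2 : (w'.2 * r + s') / r = w'.2 := by rw [mul_comm, Nat.mul_add_div hr, Nat.div_eq_of_lt hs']; rfl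
    grind
  have hBsub : ∀ w x, x ∈ B w → ∃ s < r, x ∈ C (w.2 * r + s) (f w.1) := fun w x hx => by
    simp only [B, mem_iUnion, Set.mem_Icc] at hx
    obtain ⟨c, ⟨h1, h2⟩, hx⟩ := hx
    exact ⟨c - w.2 * r, om, by rwa [Nat.add_sub_cancel' h1]⟩
  have hBZ : ∀ w w', Disjoint (B w) (Z w') := fun w w' => by
    rw [Set.disjoint_left]; intro x hx
    obtain ⟨s, hs, hx⟩ := hBsub w x hx
    exact Set.disjoint_left.1 (hC.2.1 _ (hlt _ _ hs) _ (hlt _ _ w'.1.2) _ _ (.inr (ha _ w.1.2).ne')) hx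
  refine ⟨fun w => B w ∪ Z w, fun w => ?_, ?_, ?_⟩
  · refine Conn.union (conn_row (C := fun c => C c (f w.1)) om ?_ ?_) (hC.1 _ (hlt _ _ w.1.2) _) ?_
    · intro c h1 h2; exact hC.1 _ (by have := hlt w.2 (r - 1) om; omega) _
    · intro c h1 h2; exact hC.2.2.1 _ (by have := hlt w.2 (r - 1) om; omega) _
    · obtain ⟨x, hx, y, hy, h⟩ := (hC.2.2.2 (w.2 * r + w.1) (hlt _ _ w.1.2) z (f w.1) (ha _ w.1.2)).symm
      exact ⟨x, hB w w.1 w.1.2 hx, y, hy, .inr h⟩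
  · intro w w' hne
    rw [Set.disjoint_union_left, Set.disjoint_union_right, Set.disjoint_union_right]
    refine ⟨⟨?_, hBZ _ _⟩, (hBZ _ _).symm, ?_⟩
    · rw [Set.disjoint_left]; intro x hx hx'
      obtain ⟨s, hs, hx⟩ := hBsub w x hx
      obtain ⟨s', hs', hx'⟩ := hBsub w' x hx'
      refine Set.disjoint_left.1 (hC.2.1 _ (hlt _ _ hs) _ (hlt _ _ hs') _ _ ?_) hx hx'
      by_contra! hh
      exact hne (Prod.ext (Fin.ext (hf _ _ w.1.2 w'.1.2 hh.2)) (key w w' _ _ hs hs' hh.1).1)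
    · refine hC.2.1 _ (hlt _ _ w.1.2) _ (hlt _ _ w'.1.2) _ _ (.inl fun he => ?_)
      have := key w w' _ _ w.1.2 w'.1.2 he
      exact hne (Prod.ext (Fin.ext this.2) this.1)
  · intro w w' hw
    refine wall_adj (E := fun w w' => Ed G (B w ∪ Z w) (B w' ∪ Z w')) (fun _ _ => Ed.symm) ?_ ?_ hw
    · intro w w' h1 h2
      have h3 := hB w' 0 hr
      rw [← h2, ← h1] at h3
      refine Ed.mono ((hB w (r - 1) om).trans subset_union_left) (h3.trans subset_union_left) ?_
      have := hC.2.2.1 (w.2 * r + (r - 1)) ?_ (f w.1)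
      · convert this using 2
        rw [add_mul]; omega
      · have := hlt w'.2 0 hr
        rw [← h2, add_mul] at this; omega
    · intro w w' h1 h2
      have h3 := hB w' w.1 w.1.2
      rw [← h1] at h3
      exact (hC.2.2.2 (w.2 * r + w.1) (hlt _ _ w.1.2) z (f w'.1) (ha _ w'.1.2)).mono subset_union_right (h3.trans subset_union_left)
theorem grid (r : ℕ) : ∃ c, ∀ (V : Type) [Finite V] (G : SimpleGraph V) (B : Set (Set V)), Bram G B c →
    Minor G (Wall r) := by
  classical
  rcases Nat.eq_zero_or_pos r with rfl | hr
  · exact ⟨0, fun V _ G B _ => ⟨fun _ => ∅, fun w => w.1.elim0, fun w => w.1.elim0, fun w => w.1.elim0⟩⟩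
  set h := (r + 1) ^ r + 1 with hh
  obtain ⟨D, hD, hDs⟩ := strip_cells (h := h) (q := 2 * r * r) om
  choose F hF using lemmaL D h om hD
  set m := r * (2 * r) with hm
  set k := (∑ i ∈ Finset.range (m * m + 1), F i) + 1 with hk
  refine ⟨m * k + k, fun V _ G B hB => ?_⟩
  have hm2 : 2 ≤ m := by nlinarith
  obtain ⟨U, A, hA, hAd, hT⟩ := mesh hB (m := m) (k := k) (hm2.trans (Nat.le_mul_of_pos_right m om)) le_rfl
  let T : Finset (Fin m × Fin m) := Finset.univ.filter fun p => p.1 < p.2 ∧ ¬ Touch G (A p.1) (A p.2)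
  have hTc : T.card ≤ m * m := (Finset.card_le_univ _).trans (by simp)
  have hFk : F T.card ≤ k := by
    have := Finset.single_le_sum (f := F) (fun _ _ => Nat.zero_le _) (Finset.mem_range.2 (show T.card < m * m + 1 by omega))
    grind
  let e := T.equivFin
  have he : ∀ t, (e.symm t).1.1 < (e.symm t).1.2 ∧ ¬ Touch G (A (e.symm t).1.1) (A (e.symm t).1.2) := fun t => by
    have := (e.symm t).2
    rw [Finset.mem_filter] at this; exact this.2
  rcases hF T.card V (rst G U) (fun t => Nb G (A (e.symm t).1.1) ∩ U) (fun t => Nb G (A (e.symm t).1.2) ∩ U) (fun t => by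
    obtain ⟨C, hC, hd⟩ := (hT _ _ (he t).1.ne).resolve_left (he t).2
    exact ⟨fun i => C (i.castLE hFk), fun i => hC _, fun i j hij => hd _ _ fun h => hij (by simpa using h)⟩) with hs | ⟨R, hR, hRd⟩
  · obtain ⟨R, C, hR, hC⟩ := hDs V G (hs.mono rst_le)
    rcases path_or_star hr om R hR with ⟨f, hf, ha⟩ | ⟨z, f, hf, ha⟩
    · exact cells_path hC (by nlinarith) hf ha
    · exact cells_star hC hr le_rfl hf ha
  have hRU : ∀ t, R t ⊆ U := fun t => by
    obtain ⟨x, hx, hx'⟩ := (hR t).2.1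
    exact conn_rst (hR t).1 ⟨x, hx, hx'.2⟩
  let μ : Fin m → Set V := fun i => A i ∪ ⋃ t ∈ {t | (e.symm t).1.1 = i}, R t
  have hμd : ∀ i j, i ≠ j → Disjoint (μ i) (μ j) := by
    intro i j hij
    simp only [μ, Set.disjoint_union_left, Set.disjoint_union_right, Set.disjoint_iUnion_left,
      Set.disjoint_iUnion_right]
    refine ⟨⟨hAd _ _ hij, fun t _ => ((hA j).2.mono_right (hRU t)).symm⟩, fun t ht => ⟨(hA i).2.mono_right (hRU t), fun t' ht' => hRd _ _ ?_⟩⟩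
    rintro rfl; exact hij (ht'.symm.trans ht)
  have hμe : ∀ i j, i < j → Ed G (μ i) (μ j) := by
    intro i j hij
    by_cases hTi : Touch G (A i) (A j)
    · obtain ⟨x, hx, y, hy, h | h⟩ := hTi
      · exact absurd (h ▸ hy) (Set.disjoint_left.1 (hAd _ _ hij.ne) hx)
      · exact ⟨x, .inl hx, y, .inl hy, h⟩
    · have ht : (i, j) ∈ T := by rw [Finset.mem_filter]; exact ⟨Finset.mem_univ _, hij, hTi⟩
      obtain ⟨x, hx, hxN⟩ := (hR (e ⟨(i, j), ht⟩)).2.2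
      simp only [Equiv.symm_apply_apply] at hxN
      obtain ⟨⟨_, a, ha, hax⟩, _⟩ := hxN
      refine ⟨x, .inr ?_, a, .inl ha, hax.symm⟩
      simp only [mem_iUnion]
      exact ⟨e ⟨(i, j), ht⟩, by simp, hx⟩
  let w := (finProdFinEquiv : Fin r × Fin (2 * r) ≃ Fin (r * (2 * r)))
  refine ⟨fun v => μ (w v), fun v => ?_, fun v v' hne => hμd _ _ fun h => hne (w.injective h), fun v v' hv => ?_⟩
  · refine Conn.biUnion (hA _).1 (fun t _ => (hR t).1.mono rst_le) fun t ht => ?_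
    obtain ⟨x, hx, ⟨_, a, ha, hax⟩, _⟩ := (hR t).2.1
    have ht : (e.symm t).1.1 = w v := ht
    exact ⟨a, ht ▸ ha, x, hx, .inr hax⟩
  · rcases lt_or_gt_of_ne (show w v ≠ w v' from fun h => hv.ne (w.injective h)) with h | h
    · exact hμe _ _ h
    · exact (hμe _ _ h).symm
end Paper

namespace Paper
variable {V : Type}
def Tf (G : SimpleGraph V) : Prop := ∀ x y z, G.Adj x y → G.Adj y z → ¬ G.Adj x z
def Anti (G : SimpleGraph V) (D D' : Set V) : Prop := ∀ x ∈ D, ∀ y ∈ D', x ≠ y ∧ ¬ G.Adj x y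
def CP (G : SimpleGraph V) : Prop := ∀ (v x y : V) (D D' : Set V), G.Adj v x → G.Adj v y → x ≠ y →
  Conn G D → Conn G D' → Anti G D D' → v ∉ D → v ∉ D' → x ∉ D → x ∉ D' → y ∉ D → y ∉ D' →
  (∃ d ∈ D, G.Adj x d) → (∃ d ∈ D, G.Adj y d) → (∃ d ∈ D', G.Adj x d) → (∃ d ∈ D', G.Adj y d) → False
theorem walk_of_fun {G : SimpleGraph V} (f : ℕ → V) (n : ℕ) (h : ∀ i < n, G.Adj (f i) (f (i + 1))) :
    ∃ p : G.Walk (f 0) (f n), p.length = n ∧ ∀ i ≤ n, p.getVert i = f i := by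
  induction n with
  | zero => exact ⟨.nil, rfl, fun i hi => by obtain rfl : i = 0 := om
                                             rfl⟩
  | succ n ih =>
    obtain ⟨p, h1, h2⟩ := ih fun i hi => h i om
    refine ⟨p.concat (h n om), by simp [h1], fun i hi => ?_⟩
    rw [Walk.concat_eq_append, Walk.getVert_append, h1]
    split_ifs with hlt
    · exact h2 i hlt.le
    · obtain h3 | h3 : i = n ∨ i = n + 1 := om
      · subst h3; simp
      · subst h3; simp
theorem hole_of_fun {G : SimpleGraph V} (hS : Sparse G) {h : ℕ → V} {m : ℕ} (hm : 3 ≤ m)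
    (h1 : ∀ i < m, G.Adj (h i) (h (i + 1))) (h2 : G.Adj (h m) (h 0))
    (h3 : ∀ i j, i < j → j ≤ m → h i ≠ h j ∧ (G.Adj (h i) (h j) → j = i + 1 ∨ (i = 0 ∧ j = m)))
    (x : V) (hx : ∀ i ≤ m, h i ≠ x) {s t : ℕ} (hs : s ≤ m) (ht : t ≤ m) (hst : h s ≠ h t)
    (hxs : G.Adj x (h s)) (hxt : G.Adj x (h t)) : G.Adj (h s) (h t) := by
  obtain ⟨p, hl, hv⟩ := walk_of_fun h m h1
  have hsup : ∀ y, y ∈ p.support → ∃ i ≤ m, h i = y := fun y hy => by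
    rw [Walk.mem_support_iff_exists_getVert] at hy
    obtain ⟨i, hi, hle⟩ := hy
    exact ⟨i, om, by grind⟩
  have hsup' : ∀ i ≤ m, h i ∈ p.support := fun i hi => by
    rw [← hv i hi]; exact Walk.getVert_mem_support _ _
  have hinj : ∀ i j, i ≤ m → j ≤ m → h i = h j → i = j := fun i j hi hj he => by grind
  have hpath : p.IsPath := by
    refine Walk.IsPath.getVert_injOn_iff p |>.1 fun i hi j hj he => ?_
    grind
  have hedge : ∀ i < m, s(h i, h (i + 1)) ∈ p.edges := fun i hi => by
    rw [← Walk.adj_toSubgraph_iff_mem_edges, ← hv i om, ← hv (i + 1) om]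
    exact p.toSubgraph_adj_getVert om
  have hne : s(h m, h 0) ∉ p.edges := by
    intro he
    rw [← Walk.adj_toSubgraph_iff_mem_edges, Walk.toSubgraph_adj_iff] at he
    obtain ⟨i, he, hi⟩ := he
    rw [hv i om, hv (i + 1) om, Sym2.eq_iff] at he
    grind
  let c := Walk.cons h2 p
  have hcs : ∀ y, y ∈ c.support ↔ y ∈ p.support := fun y => by
    simp only [c, Walk.support_cons, List.mem_cons]
    exact ⟨fun hy => hy.elim (fun e => e ▸ hsup' m le_rfl) id, .inr⟩
  have hce : ∀ e, e ∈ c.edges ↔ e = s(h m, h 0) ∨ e ∈ p.edges := fun e => by simp [c]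
  have hc : IsHole G c := by
    refine ⟨(Walk.cons_isCycle_iff _ _).2 ⟨hpath, hne⟩, by simp [c, hl]; omega, ?_⟩
    have key : ∀ i j, i < j → j ≤ m → G.Adj (h i) (h j) → s(h i, h j) ∈ c.edges := by
      intro i j hij hj ha
      rw [hce]
      rcases (h3 i j hij hj).2 ha with rfl | ⟨rfl, rfl⟩
      · grind
      · exact .inl Sym2.eq_swap
    intro u hu w hw ha
    rw [Walk.mem_verts_toSubgraph, hcs] at hu hw
    obtain ⟨i, hi, rfl⟩ := hsup u hu
    obtain ⟨j, hj, rfl⟩ := hsup w hw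
    rw [Walk.adj_toSubgraph_iff_mem_edges]
    rcases lt_trichotomy i j with h' | rfl | h'
    · exact key i j h' hj ha
    · exact absurd rfl ha.ne
    · rw [Sym2.eq_swap]; exact key j i h' hi ha.symm
  obtain ⟨a, b, hab, hN⟩ := hS _ c hc x (fun hxc => by
    obtain ⟨i, hi, he⟩ := hsup x ((hcs x).1 hxc); exact hx i hi he)
  have e1 := hN (h s) ((hcs _).2 (hsup' s hs)) hxs
  have e2 := hN (h t) ((hcs _).2 (hsup' t ht)) hxt
  have hab := hab.adj_sub
  rcases e1 with e1 | e1 <;> rcases e2 with e2 | e2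
  · grind
  · grind
  · rw [e1, e2]; exact hab.symm
  grind
theorem cp_of_sparse {G : SimpleGraph V} (hS : Sparse G) (hT : Tf G) : CP G := by
  intro v x y D D' hvx hvy hxy hD hD' hA hv hv' hx hx' hy hy' h1 h2 h3 h4
  obtain ⟨f, n, hf0, hfn, hfD, hfP, hfx, hfy⟩ := exists_path hD (A := {d | G.Adj x d}) (B := {d | G.Adj y d})
    (by obtain ⟨d, h⟩ := h1; exact ⟨d, h⟩) (by obtain ⟨d, h⟩ := h2; exact ⟨d, h⟩)
  obtain ⟨g, k, hg0, hgk, hgD, hgP, hgy, hgx⟩ := exists_path hD' (A := {d | G.Adj y d}) (B := {d | G.Adj x d})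
    (by obtain ⟨d, h⟩ := h4; exact ⟨d, h⟩) (by obtain ⟨d, h⟩ := h3; exact ⟨d, h⟩)
  have hnxy : ¬ G.Adj x y := hT _ _ _ hvx.symm hvy
  let h : ℕ → V := fun i => if i = 0 then x else if i ≤ n + 1 then f (i - 1) else if i = n + 2 then y else g (i - (n + 3))
  have e0 : h 0 = x := rfl
  have e1 : ∀ i ≤ n, h (i + 1) = f i := fun i hi => by simp [h]; omega
  have e2 : h (n + 2) = y := by simp [h]
  have e3 : ∀ i, h (n + 3 + i) = g i := fun i => by
    simp only [h]; rw [if_neg om, if_neg om, if_neg om]; congr 1; omega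
  have cs : ∀ i, i = 0 ∨ (∃ i' ≤ n, i = i' + 1) ∨ i = n + 2 ∨ ∃ i', i = n + 3 + i' := by
    intro i
    by_cases c1 : i = 0
    · exact .inl c1
    by_cases c2 : i ≤ n + 1
    · exact .inr (.inl ⟨i - 1, om, om⟩)
    by_cases c3 : i = n + 2
    · grind
    · exact .inr (.inr (.inr ⟨i - (n + 3), om⟩))
  have := hole_of_fun hS (h := h) (m := n + 3 + k) om ?_ ?_ ?_ v ?_ (s := 0) (t := n + 2) om om
    (by grind) (by grind) (by grind)
  · grind
  · intro i hi
    rcases cs i with rfl | ⟨i, h', rfl⟩ | rfl | ⟨i, rfl⟩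
    · grind
    · rw [e1 i h']
      rcases h'.lt_or_eq with h' | rfl
      · rw [e1 (i + 1) h']; exact hfP.1 i h'
      · rw [e2]; exact (show G.Adj _ _ from hfn).symm
    · grind
    · rw [e3, add_assoc, e3]; exact hgP.1 i om
  · rw [e0, e3]; exact (show G.Adj _ _ from hgk).symm
  · intro i j hij hj
    rcases cs i with rfl | ⟨i, hi, rfl⟩ | rfl | ⟨i, rfl⟩ <;> rcases cs j with rfl | ⟨j, hj', rfl⟩ | rfl | ⟨j, rfl⟩
    · omega
    · grind
    · grind
    · grind
    · omega
    · rw [e1 i hi, e1 j hj']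
      obtain ⟨h5, h6⟩ := hfP.2 i j om hj'
      grind
    · rw [e1 i hi, e2]
      refine ⟨fun e => hy (e ▸ hfD i hi), fun ha => ?_⟩
      have := hfy i hi (G.adj_symm ha); omega
    · rw [e1 i hi, e3]
      obtain ⟨h5, h6⟩ := hA _ (hfD i hi) _ (hgD j om)
      grind
    · omega
    · omega
    · omega
    · grind
    · omega
    · omega
    · omega
    · rw [e3, e3]
      obtain ⟨h5, h6⟩ := hgP.2 i j om om
      grind
  · intro i hi
    rcases cs i with rfl | ⟨i, h', rfl⟩ | rfl | ⟨i, rfl⟩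
    · grind
    · grind
    · rw [e2]; exact hvy.ne'
    grind
theorem tf_of_memF {G : SimpleGraph V} (h : MemF 2 G) : Tf G := by
  intro x y z hxy hyz hxz
  have h1 := h.2 {x, y, z} (by
    intro a ha b hb hab
    simp only [Set.mem_insert_iff, Set.mem_singleton_iff] at ha hb
    have := hxy.symm; have := hxz.symm; have := hyz.symm
    grind)
  rw [Set.ncard_eq_three.2 ⟨x, y, z, hxy.ne, hxz.ne, hyz.ne, rfl⟩] at h1
  omega
end Paper

namespace Paper
variable {V : Type}
theorem CP.use {G : SimpleGraph V} (h : CP G) {c x y : V} {D D' : Set V} (hx : G.Adj c x) (hy : G.Adj c y)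
    (hxy : x ≠ y) (hD : Conn G D) (hD' : Conn G D') (hA : Anti G D D')
    (h1 : ∀ d ∈ D, d ≠ c ∧ d ≠ x ∧ d ≠ y) (h2 : ∀ d ∈ D', d ≠ c ∧ d ≠ x ∧ d ≠ y)
    (e1 : ∃ d ∈ D, G.Adj x d) (e2 : ∃ d ∈ D, G.Adj y d) (e3 : ∃ d ∈ D', G.Adj x d)
    (e4 : ∃ d ∈ D', G.Adj y d) : False :=
  h c x y D D' hx hy hxy hD hD' hA (fun h => (h1 _ h).1 rfl) (fun h => (h2 _ h).1 rfl)
    (fun h => (h1 _ h).2.1 rfl) (fun h => (h2 _ h).2.1 rfl) (fun h => (h1 _ h).2.2 rfl)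
    (fun h => (h2 _ h).2.2 rfl) e1 e2 e3 e4
def Sep (G : SimpleGraph V) (v a u : V) : Prop := ∃ (z z' : V) (A : Set V), (z = z' ∨ G.Adj z z') ∧
  a ∈ A ∧ u ∉ A ∧ u ≠ z ∧ u ≠ z' ∧ z ∉ A ∧ z' ∉ A ∧ v ∉ A ∧ ∀ x ∈ A, ∀ y, G.Adj x y → y ∉ A → y = v ∨ y = z ∨ y = z'
def LC (G : SimpleGraph V) (v a u : V) (D D' : Set V) : Prop :=
  Conn G D ∧ Conn G D' ∧ a ∈ D ∧ u ∈ D ∧ a ∈ D' ∧ u ∈ D' ∧ v ∉ D ∧ v ∉ D' ∧ ∀ x ∈ D, x ∈ D' → x = a ∨ x = u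
def XE (G : SimpleGraph V) (a u : V) (D D' : Set V) : Set (Sym2 V) :=
  {s | ∃ x ∈ D, ∃ y ∈ D', (x ≠ a ∧ x ≠ u) ∧ (y ≠ a ∧ y ≠ u) ∧ G.Adj x y ∧ s = s(x, y)}
theorem Sep.symm {G : SimpleGraph V} {v a u : V} (h : Sep G v a u) (hu : u ≠ v) : Sep G v u a := by
  obtain ⟨z, z', A, h1, h2, h3, h4, h5, h6, h7, h8, h9⟩ := h
  refine ⟨z, z', {x | x ∉ A ∧ x ≠ v ∧ x ≠ z ∧ x ≠ z'}, h1, ⟨h3, hu, h4, h5⟩, fun h => h.1 h2,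
    fun e => h6 (e ▸ h2), fun e => h7 (e ▸ h2), fun h => h.2.2.1 rfl, fun h => h.2.2.2 rfl,
    fun h => h.2.1 rfl, fun x hx y ha hy => ?_⟩
  by_contra! hc
  have hyA : y ∈ A := by grind
  rcases h9 y hyA x ha.symm hx.1 with e | e | e
  exacts [hx.2.1 e, hx.2.2.1 e, hx.2.2.2 e]
theorem sep_conn {G : SimpleGraph V} {A T : Set V} {r w w' x y : V}
    (hA : ∀ x ∈ A, ∀ y, G.Adj x y → y ∉ A → y = r ∨ y = w ∨ y = w') (hT : Conn G T) (h1 : r ∉ T)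
    (h2 : w ∉ T) (h3 : w' ∉ T) (hx : x ∈ T) (hxA : x ∈ A) (hy : y ∈ T) : y ∈ A :=
  hT.2 (· ∈ A) ⟨x, hx, hxA⟩ (fun u _ s hs ha hu => by
    grind) y hy
theorem nsep {G : SimpleGraph V} {v a u : V} (h : ¬ Sep G v a u) (hva : v ≠ a) {z z' : V} (hz : z = z' ∨ G.Adj z z')
    (ha : a ≠ z) (ha' : a ≠ z') (hu : u ≠ z) (hu' : u ≠ z') :
    ∃ K, Conn G K ∧ a ∈ K ∧ u ∈ K ∧ v ∉ K ∧ z ∉ K ∧ z' ∉ K := by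
  have haS : a ∈ ({v, z, z'} : Set V)ᶜ := by grind
  have hs := comp_sub (G := G) haS
  have n1 : v ∉ comp G {v, z, z'}ᶜ a := fun h => hs h (by simp)
  have n2 : z ∉ comp G {v, z, z'}ᶜ a := fun h => hs h (by simp)
  have n3 : z' ∉ comp G {v, z, z'}ᶜ a := fun h => hs h (by simp)
  refine ⟨comp G {v, z, z'}ᶜ a, comp_conn haS, mem_comp_self, ?_, n1, n2, n3⟩
  by_contra hn
  refine h ⟨z, z', _, hz, mem_comp_self, hn, hu, hu', n2, n3, n1, fun x hx y hxy hy => ?_⟩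
  by_contra hc
  exact hy (comp_closed hx hxy (by simpa using hc))
theorem exists_LC [Finite V] {G : SimpleGraph V} (hT : Tf G) {v a u : V} (hva : G.Adj v a) (hvu : G.Adj v u)
    (hau : a ≠ u) (h : ¬ Sep G v a u) : ∃ D D', LC G v a u D D' := by
  let U : Set V := {v, a, u}ᶜ
  have hL : Lnk (rst G U) {x | x ∈ U ∧ G.Adj a x} {x | x ∈ U ∧ G.Adj u x} 2 := by
    refine menger _ _ _ _ fun S hS => ?_
    obtain ⟨K, hK, haK, huK, hvK, hSK⟩ : ∃ K, Conn G K ∧ a ∈ K ∧ u ∈ K ∧ v ∉ K ∧ ∀ s ∈ S, s ∈ K → s = a ∨ s = u := by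
      have hS' : ∃ s, S ⊆ {s} := by
        obtain h0 | h0 : S.ncard = 0 ∨ S.ncard = 1 := om
        · rw [Set.ncard_eq_zero] at h0; exact ⟨v, by simp [h0]⟩
        · rw [Set.ncard_eq_one] at h0; grind
      obtain ⟨s, hs⟩ := hS'
      by_cases hsa : s = a ∨ s = u
      · obtain ⟨K, h1, h2, h3, h4, -⟩ := nsep h hva.ne (.inl rfl : v = v ∨ _) hva.ne' hva.ne' hvu.ne' hvu.ne'
        grind
      · push Not at hsa
        obtain ⟨K, h1, h2, h3, h4, h5, -⟩ := nsep h hva.ne (.inl rfl : s = s ∨ _) hsa.1.symm hsa.1.symm hsa.2.symm hsa.2.symm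
        grind
    obtain ⟨f, n, hf0, hfn, hfK, hP, h0, hn⟩ := exists_path hK (A := {a}) (B := {u}) ⟨a, haK, rfl⟩ ⟨u, huK, rfl⟩
    have hn2 : 2 ≤ n := by
      by_contra hlt
      obtain rfl | rfl : n = 0 ∨ n = 1 := om
      · grind
      · have := hP.1 0 om; rw [hf0, show f (0 + 1) = u from hfn] at this
        exact hT _ _ _ hva.symm hvu this
    have hU : f '' Icc 1 (n - 1) ⊆ U := by grind
    refine ⟨f '' Icc 1 (n - 1), Conn.rst (conn_seg om fun t _ _ => hP.1 t om) hU, ?_, ?_, ?_⟩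
    · grind
    · refine ⟨f 1, ⟨1, ⟨by omega, om⟩, rfl⟩, hU ⟨1, ⟨by omega, om⟩, rfl⟩, ?_⟩
      have := hP.1 0 om; grind
    · refine ⟨f (n - 1), ⟨n - 1, ⟨by omega, om⟩, rfl⟩, hU ⟨n - 1, ⟨by omega, om⟩, rfl⟩, ?_⟩
      have := hP.1 (n - 1) om; rw [show n - 1 + 1 = n by omega, hfn] at this; exact this.symm
  obtain ⟨C, hC, hd⟩ := hL
  have key : ∀ i, Conn G (insert a (insert u (C i))) ∧ C i ⊆ U := fun i => by
    obtain ⟨h1, ⟨x, hx, hxU, hax⟩, ⟨y, hy, hyU, huy⟩⟩ := hC i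
    exact ⟨((h1.mono rst_le).ins ⟨y, hy, huy⟩).ins ⟨x, .inr hx, hax⟩, conn_rst h1 ⟨x, hx, hxU⟩⟩
  have hv : ∀ i, v ∉ insert a (insert u (C i)) := fun i hv => by
    rcases hv with e | e | e
    · exact hva.ne e
    · exact hvu.ne e
    grind
  refine ⟨_, _, (key 0).1, (key 1).1, .inl rfl, .inr (.inl rfl), .inl rfl, .inr (.inl rfl), hv 0, hv 1, ?_⟩
  rintro x (h1 | h1 | h1) (h2 | h2 | h2) <;> try tauto
  exact absurd h2 (Set.disjoint_left.1 (hd 0 1 (by decide)) h1)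
structure Cfg (G : SimpleGraph V) (v a u : V) (f g : ℕ → V) (n m i0 j0 : ℕ) (E : Set (Sym2 V)) : Prop where
  va : G.Adj v a
  vu : G.Adj v u
  au : a ≠ u
  ns : ¬ Sep G v a u
  pf : IsP G f n
  pg : IsP G g m
  f0 : f 0 = a
  g0 : g 0 = a
  fn : f n = u
  gm : g m = u
  dj : ∀ i ≤ n, ∀ j ≤ m, f i = g j → (i = 0 ∧ j = 0) ∨ (i = n ∧ j = m)
  vf : ∀ i ≤ n, f i ≠ v
  vg : ∀ i ≤ m, g i ≠ v
  hE : ∀ i j, 0 < i → i < n → 0 < j → j < m → G.Adj (f i) (g j) → s(f i, g j) ∈ E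
  mn : ∀ v' a' u' D D', G.Adj v' a' → G.Adj v' u' → a' ≠ u' → ¬ Sep G v' a' u' → LC G v' a' u' D D' →
    E.ncard ≤ (XE G a' u' D D').ncard
  hi : 0 < i0
  hi' : i0 < n
  hj : 0 < j0
  hj' : j0 < m
  e : G.Adj (f i0) (g j0)
section
variable {G : SimpleGraph V} {v a u : V} {f g : ℕ → V} {n m i0 j0 : ℕ} {E : Set (Sym2 V)}
theorem IsP.rev (h : IsP G f n) : IsP G (fun i => f (n - i)) n := by
  refine ⟨fun i hi => ?_, fun i j hij hj => ?_⟩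
  · have := h.1 (n - (i + 1)) om
    rw [show n - (i + 1) + 1 = n - i by omega] at this; exact this.symm
  · obtain ⟨h1, h2⟩ := h.2 (n - j) (n - i) om om
    exact ⟨h1.symm, fun ha => by have := h2 ha.symm; omega⟩
theorem IsP.adj (h : IsP G f n) {i j : ℕ} (hi : i ≤ n) (hj : j ≤ n) (ha : G.Adj (f i) (f j)) :
    j = i + 1 ∨ i = j + 1 := by
  rcases lt_trichotomy i j with h' | rfl | h'
  · exact .inl ((h.2 i j h' hj).2 ha)
  · exact absurd rfl ha.ne
  · exact .inr ((h.2 j i h' hi).2 ha.symm)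
theorem IsP.inj (h : IsP G f n) {i j : ℕ} (hi : i ≤ n) (hj : j ≤ n) (e : f i = f j) : i = j := by
  rcases lt_trichotomy i j with h' | rfl | h'
  · exact absurd e (h.2 i j h' hj).1
  · rfl
  · exact absurd e.symm (h.2 j i h' hi).1
theorem IsP.seg (h : IsP G f n) {i j : ℕ} (hij : i ≤ j) (hj : j ≤ n) : Conn G (f '' Icc i j) :=
  conn_seg hij fun t _ _ => h.1 t om
theorem mseg {i j k : ℕ} (h1 : i ≤ k) (h2 : k ≤ j) : f k ∈ f '' Icc i j := ⟨k, ⟨h1, h2⟩, rfl⟩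
theorem Cfg.swap (c : Cfg G v a u f g n m i0 j0 E) : Cfg G v a u g f m n j0 i0 E :=
  { va := c.va, vu := c.vu, au := c.au, ns := c.ns, pf := c.pg, pg := c.pf, f0 := c.g0, g0 := c.f0, fn := c.gm, gm := c.fn
    dj := fun i hi j hj e => by have := c.dj j hj i hi e.symm; tauto
    vf := c.vg, vg := c.vf, hE := fun i j h1 h2 h3 h4 ha => by rw [Sym2.eq_swap]; exact c.hE j i h3 h4 h1 h2 ha.symm
    mn := c.mn, hi := c.hj, hi' := c.hj', hj := c.hi, hj' := c.hi', e := c.e.symm }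
theorem Cfg.rev (c : Cfg G v a u f g n m i0 j0 E) :
    Cfg G v u a (fun i => f (n - i)) (fun i => g (m - i)) n m (n - i0) (m - j0) E :=
  { va := c.vu, vu := c.va, au := c.au.symm, ns := fun h => c.ns (h.symm c.va.ne'), pf := c.pf.rev, pg := c.pg.rev
    f0 := by simp [c.fn], g0 := by simp [c.gm], fn := by simp [c.f0], gm := by simp [c.g0]
    dj := fun i hi j hj e => by have := c.dj (n - i) om (m - j) om e; omega
    vf := fun i _ => c.vf _ om, vg := fun i _ => c.vg _ om
    hE := fun i j h1 h2 h3 h4 ha => c.hE _ _ om om om om ha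
    mn := c.mn, hi := by have := c.hi'; omega, hi' := by have := c.hi'; have := c.hi; omega
    hj := by have := c.hj'; omega, hj' := by have := c.hj; have := c.hj'; omega
    e := by
      have := c.hi'; have := c.hj'
      show G.Adj (f (n - (n - i0))) (g (m - (m - j0)))
      rw [show n - (n - i0) = i0 by omega, show m - (m - j0) = j0 by omega]; exact c.e }
theorem Cfg.inE (c : Cfg G v a u f g n m i0 j0 E) {i j : ℕ} (hi : i ≤ n) (hj : j ≤ m) (h1 : f i ≠ a) (h2 : f i ≠ u)
    (h3 : g j ≠ a) (h4 : g j ≠ u) (ha : G.Adj (f i) (g j)) :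
    s(f i, g j) ∈ E ∧ ∀ p q, 0 < p → p < n → q ≤ m → i ≠ p ∨ j ≠ q → s(f i, g j) ≠ s(f p, g q) := by
  have hne : 0 < i ∧ i < n ∧ 0 < j ∧ j < m := by
    refine ⟨?_, ?_, ?_, ?_⟩ <;> by_contra hc
    · exact h1 (by rw [show i = 0 by omega, c.f0])
    · exact h2 (by rw [show i = n by omega, c.fn])
    · exact h3 (by rw [show j = 0 by omega, c.g0])
    · exact h4 (by rw [show j = m by omega, c.gm])
  refine ⟨c.hE i j hne.1 hne.2.1 hne.2.2.1 hne.2.2.2 ha, fun p q hp hp' hq h e => ?_⟩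
  rw [Sym2.eq_iff] at e
  rcases e with ⟨e1, e2⟩ | ⟨e1, e2⟩
  · have := c.pf.inj hi hp'.le e1; have := c.pg.inj hj hq e2; omega
  · have := c.dj i hi q hq e1; omega
theorem Cfg.inE' (c : Cfg G v a u f g n m i0 j0 E) {i j : ℕ} (hi : i ≤ n) (hj : j ≤ m) (h1 : f i ≠ a) (h2 : f i ≠ u)
    (h3 : g j ≠ a) (h4 : g j ≠ u) (ha : G.Adj (g j) (f i)) :
    s(g j, f i) ∈ E ∧ ∀ p q, 0 < p → p < n → q ≤ m → i ≠ p ∨ j ≠ q → s(g j, f i) ≠ s(f p, g q) := by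
  rw [Sym2.eq_swap]; exact c.inE hi hj h1 h2 h3 h4 ha.symm
theorem Cfg.fin [Finite V] (c : Cfg G v a u f g n m i0 j0 E) {v' a' u' : V} {D D' : Set V}
    (h1 : G.Adj v' a') (h2 : G.Adj v' u') (h3 : a' ≠ u') (h4 : ¬ Sep G v' a' u') (h5 : LC G v' a' u' D D')
    (h : ∀ x ∈ D, x ≠ a' → x ≠ u' → ∀ y ∈ D', y ≠ a' → y ≠ u' → G.Adj x y → s(x, y) ∈ E ∧ s(x, y) ≠ s(f i0, g j0)) :
    False := by
  have h6 := c.mn v' a' u' D D' h1 h2 h3 h4 h5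
  have h7 := c.hE i0 j0 c.hi c.hi' c.hj c.hj' c.e
  have h8 : (XE G a' u' D D').ncard ≤ (E \ {s(f i0, g j0)}).ncard := by
    refine Set.ncard_le_ncard ?_ (Set.toFinite _)
    rintro _ ⟨x, hx, y, hy, ⟨e1, e2⟩, ⟨e3, e4⟩, ha, rfl⟩
    grind
  rw [Set.ncard_diff_singleton_of_mem h7] at h8
  have : 0 < E.ncard := (Set.ncard_pos (Set.toFinite _)).2 ⟨_, h7⟩
  omega
end
end Paper

namespace Paper
variable {V : Type} {G : SimpleGraph V} {v a u : V} {f g : ℕ → V} {n m i0 j0 : ℕ} {E : Set (Sym2 V)}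
theorem Cfg.direct [Finite V] (c : Cfg G v a u f g n m i0 j0 E) (hC : CP G) {i j : ℕ} (h1 : i < i0) (h2 : j0 < j)
    (hj : j ≤ m) (ha : G.Adj (f i) (g j)) : False := by
  have b1 := c.hi; have b2 := c.hi'; have b3 := c.hj; have b4 := c.hj'
  have key : ∀ i j, i < i0 → j0 < j → j ≤ m → G.Adj (f i) (g j) → 0 < i ∧ j < m ∧ i + 1 = i0 ∧ j = j0 + 1 := by
    intro i j h1 h2 hj ha
    have hi0 : 0 < i := by
      by_contra hc; obtain rfl : i = 0 := om
      rw [c.f0, ← c.g0] at ha; have := c.pg.adj om hj ha; omega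
    have hjm : j < m := by
      by_contra hc; obtain rfl : j = m := om
      rw [c.gm, ← c.fn] at ha; have := c.pf.adj om le_rfl ha; omega
    refine ⟨hi0, hjm, ?_⟩
    by_contra hc
    let b : Sym2 V := if i + 1 = i0 then s(f i, f i0) else s(g j, g j0)
    have hLC : LC G v a u (f '' Icc 0 i ∪ g '' Icc j m) (g '' Icc 0 j0 ∪ f '' Icc i0 n) := by
      refine ⟨(c.pf.seg om om).union (c.pg.seg hj le_rfl) ⟨_, mseg (Nat.zero_le _) le_rfl, _, mseg le_rfl hj, .inr ha⟩,
        (c.pg.seg om om).union (c.pf.seg b2.le le_rfl) ⟨_, mseg (Nat.zero_le _) le_rfl, _, mseg le_rfl b2.le, .inr c.e.symm⟩,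
        .inl ⟨0, by simp, c.f0⟩, .inr ⟨m, by simp [hj], c.gm⟩, .inl ⟨0, by simp, c.g0⟩, .inr ⟨n, by simp [b2.le], c.fn⟩, ?_, ?_, ?_⟩
      · rintro (⟨s, hs, e⟩ | ⟨s, hs, e⟩)
        · exact c.vf s (by simp at hs; omega) e
        · exact c.vg s (by simp at hs; omega) e
      · rintro (⟨s, hs, e⟩ | ⟨s, hs, e⟩)
        · exact c.vg s (by simp at hs; omega) e
        · exact c.vf s (by simp at hs; omega) e
      · rintro _ (⟨s, ⟨hs, hs'⟩, rfl⟩ | ⟨s, ⟨hs, hs'⟩, rfl⟩) (⟨t, ⟨ht, ht'⟩, e⟩ | ⟨t, ⟨ht, ht'⟩, e⟩)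
        · have := c.dj s om t om e.symm
          left; rw [show s = 0 by omega, c.f0]
        · have := c.pf.inj om om e; omega
        · have := c.pg.inj om om e; omega
        · have := c.dj t om s om e
          right; rw [show s = m by omega, c.gm]
    have h6 := c.mn _ _ _ _ _ c.va c.vu c.au c.ns hLC
    have h7 := c.hE i0 j0 b1 b2 b3 b4 c.e
    have h7' := c.hE i j hi0 om om hjm ha
    have hne : s(f i, g j) ≠ s(f i0, g j0) := fun e => by
      rw [Sym2.eq_iff] at e
      rcases e with ⟨e1, e2⟩ | ⟨e1, e2⟩
      · have := c.pf.inj om om e1; omega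
      · have := c.dj i om j0 om e1; omega
    have h8 : (XE G a u (f '' Icc 0 i ∪ g '' Icc j m) (g '' Icc 0 j0 ∪ f '' Icc i0 n)).ncard ≤
        (insert b ((E \ {s(f i0, g j0)}) \ {s(f i, g j)})).ncard := by
      refine Set.ncard_le_ncard ?_ (Set.toFinite _)
      rintro _ ⟨x, hx, y, hy, ⟨e1, e2⟩, ⟨e3, e4⟩, ha', rfl⟩
      rcases hx with ⟨s, ⟨hs, hs'⟩, rfl⟩ | ⟨s, ⟨hs, hs'⟩, rfl⟩ <;> rcases hy with ⟨t, ⟨ht, ht'⟩, rfl⟩ | ⟨t, ⟨ht, ht'⟩, rfl⟩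
      · obtain ⟨q1, q2⟩ := c.inE om om e1 e2 e3 e4 ha'
        exact .inr ⟨⟨q1, q2 i0 j0 b1 b2 b4.le om⟩, q2 i j hi0 om hj om⟩
      · have := c.pf.adj om om ha'
        grind
      · have := c.pg.adj om om ha'
        grind
      · obtain ⟨q1, q2⟩ := c.inE' om om e3 e4 e1 e2 ha'
        exact .inr ⟨⟨q1, q2 i0 j0 b1 b2 b4.le om⟩, q2 i j hi0 om hj om⟩
    have h9 := Set.ncard_insert_le b ((E \ {s(f i0, g j0)}) \ {s(f i, g j)})
    have h10 := Set.ncard_diff_singleton_of_mem h7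
    have h11 := Set.ncard_diff_singleton_of_mem (show s(f i, g j) ∈ E \ {s(f i0, g j0)} from ⟨h7', hne⟩)
    have h12 : 0 < (E \ {s(f i0, g j0)}).ncard := (Set.ncard_pos (Set.toFinite _)).2 ⟨_, h7', hne⟩
    omega
  obtain ⟨p1, p2, p3, p4⟩ := key i j h1 h2 hj ha
  have hz : G.Adj (f i0) (f i) := by have := c.pf.1 i om; rw [p3] at this; exact this.symm
  have hq : G.Adj (g j0) (g j) := by have := c.pg.1 j0 om; grind
  have hfg : ∀ s ≤ n, ∀ t ≤ m, 0 < s → s < n → f s ≠ g t := fun s hs t ht h h' e => by have := c.dj s hs t ht e; omega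
  have hfg' : ∀ s ≤ n, ∀ t ≤ m, 0 < t → t < m → f s ≠ g t := fun s hs t ht h h' e => by have := c.dj s hs t ht e; omega
  refine hC.use (D := {g j}) (D' := g '' Icc 0 (j0 - 1) ∪ f '' Icc 0 (i - 1)) hz c.e (hfg i om j0 om om om)
    (conn_single _ _) ((c.pg.seg om om).union (c.pf.seg om om)
      ⟨_, mseg le_rfl om, _, mseg le_rfl om, .inl (c.g0.trans c.f0.symm)⟩) ?_ ?_ ?_ ⟨_, rfl, ha⟩ ⟨_, rfl, hq⟩
    ⟨f (i - 1), .inr (mseg om le_rfl), ?_⟩ ⟨g (j0 - 1), .inl (mseg om le_rfl), ?_⟩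
  · rintro _ rfl y (⟨s, ⟨hs, hs'⟩, rfl⟩ | ⟨s, ⟨hs, hs'⟩, rfl⟩)
    · refine ⟨fun e => ?_, fun e => ?_⟩
      · have := c.pg.inj om om e; omega
      · have := c.pg.adj om om e; omega
    · refine ⟨(hfg' s om j om om p2).symm, fun e => ?_⟩
      have := key s j om h2 hj e.symm; omega
  · rintro _ rfl
    exact ⟨(hfg' _ om _ om om om).symm, (hfg' _ om _ om om om).symm, hq.ne'⟩
  · rintro y (⟨s, ⟨hs, hs'⟩, rfl⟩ | ⟨s, ⟨hs, hs'⟩, rfl⟩)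
    · refine ⟨(hfg _ om _ om om om).symm, (hfg _ om _ om om om).symm, fun e => ?_⟩
      have := c.pg.inj om om e; omega
    · refine ⟨fun e => ?_, fun e => ?_, hfg' _ om _ om om om⟩
      · have := c.pf.inj om om e; omega
      grind
  · have := c.pf.1 (i - 1) om; rw [show i - 1 + 1 = i by omega] at this; exact this.symm
  · have := c.pg.1 (j0 - 1) om; rw [show j0 - 1 + 1 = j0 by omega] at this; exact this.symm
theorem Cfg.uniq [Finite V] (c : Cfg G v a u f g n m i0 j0 E) {r x y : V} (hr : r ≠ v) (hrf : ∀ i ≤ n, f i ≠ r)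
    (hrg : ∀ i ≤ m, g i ≠ r) (hx : G.Adj r x) (hy : G.Adj r y) (hxC : x ∈ f '' Icc 0 i0 ∪ g '' Icc 0 j0)
    (hyC : y ∈ f '' Icc 0 i0 ∪ g '' Icc 0 j0) : x = y := by
  have b1 := c.hi; have b2 := c.hi'; have b3 := c.hj; have b4 := c.hj'
  let h : ℕ → V := fun s => if s ≤ i0 then f (i0 - s) else g (s - i0)
  have hf : ∀ s ≤ i0, h s = f (i0 - s) := fun s hs => if_pos hs
  have hg : ∀ s, i0 ≤ s → h s = g (s - i0) := fun s hs => by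
    rcases hs.lt_or_eq with h' | rfl
    · grind
    · rw [hf _ le_rfl]; simp [c.f0, c.g0]
  have hadj : ∀ s < i0 + j0, G.Adj (h s) (h (s + 1)) := fun s hs => by
    rcases lt_or_ge s i0 with h' | h'
    · rw [hf s h'.le, hf (s + 1) h']
      have := c.pf.1 (i0 - (s + 1)) om; rw [show i0 - (s + 1) + 1 = i0 - s by omega] at this; exact this.symm
    · rw [hg s h', hg (s + 1) om, show s + 1 - i0 = s - i0 + 1 by omega]; exact c.pg.1 _ om
  have hch : ∀ p q, p < q → q ≤ i0 + j0 → h p ≠ h q ∧ (G.Adj (h p) (h q) → q = p + 1 ∨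
      (p < i0 ∧ i0 < q ∧ h p = f (i0 - p) ∧ h q = g (q - i0))) := fun p q hpq hq => by
    rcases le_or_gt q i0 with h' | h'
    · rw [hf p om, hf q h']
      refine ⟨fun e => ?_, fun e => ?_⟩
      · have := c.pf.inj om om e; omega
      · have := c.pf.adj om om e; omega
    rcases le_or_gt i0 p with h'' | h''
    · rw [hg p h'', hg q h'.le]
      refine ⟨fun e => ?_, fun e => ?_⟩
      · have := c.pg.inj om om e; omega
      · have := c.pg.adj om om e; omega
    · rw [hf p h''.le, hg q h'.le]
      refine ⟨fun e => ?_, fun _ => .inr ⟨h'', h', rfl, rfl⟩⟩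
      have := c.dj _ om _ om e; omega
  have hmem : ∀ x, x ∈ f '' Icc 0 i0 ∪ g '' Icc 0 j0 → ∃ s ≤ i0 + j0, h s = x := by
    rintro x (⟨s, ⟨hs, hs'⟩, rfl⟩ | ⟨s, ⟨hs, hs'⟩, rfl⟩)
    · exact ⟨i0 - s, om, by rw [hf _ om]; congr 1; omega⟩
    · exact ⟨i0 + s, om, by rw [hg _ om]; congr 1; omega⟩
  have hoff : ∀ s ≤ i0 + j0, h s ≠ r := fun s hs => by
    rcases le_or_gt s i0 with h' | h'
    · grind
    grind
  have main : ∀ s t, s < t → t ≤ i0 + j0 → G.Adj r (h s) → G.Adj r (h t) → False := by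
    intro s t hst ht hxs hyt
    have hseg : ∀ {p q}, p ≤ q → q ≤ i0 + j0 → Conn G (h '' Icc p q) := fun hpq hq => conn_seg hpq fun t _ _ => hadj t om
    have c1 : Conn G (h '' Icc s t) := hseg hst.le ht
    have c2 : Conn G (h '' Icc 0 s ∪ h '' Icc t (i0 + j0)) := (hseg (Nat.zero_le _) om).union (hseg ht le_rfl)
      ⟨h 0, mseg le_rfl (Nat.zero_le _), h (i0 + j0), mseg ht le_rfl, .inr (by
        rw [hf 0 (Nat.zero_le _), hg _ om]; simpa using c.e)⟩
    have hinj : ∀ p q, p ≤ i0 + j0 → q ≤ i0 + j0 → h p = h q → p = q := fun p q hp hq e => by grind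
    have hLC : LC G r (h s) (h t) (h '' Icc s t) (h '' Icc 0 s ∪ h '' Icc t (i0 + j0)) := by
      refine ⟨c1, c2, mseg le_rfl hst.le, mseg hst.le le_rfl, .inl (mseg (Nat.zero_le _) le_rfl), .inr (mseg le_rfl ht), ?_, ?_, ?_⟩
      · rintro ⟨p, ⟨hp, hp'⟩, e⟩; exact hoff p om e
      · rintro (⟨p, ⟨hp, hp'⟩, e⟩ | ⟨p, ⟨hp, hp'⟩, e⟩) <;> exact hoff p om e
      · rintro _ ⟨p, ⟨hp, hp'⟩, rfl⟩ (⟨q, ⟨hq, hq'⟩, e⟩ | ⟨q, ⟨hq, hq'⟩, e⟩)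
        · have := hinj q p om om e; left; congr 1; omega
        · have := hinj q p om om e; right; congr 1; omega
    have hcd : ∀ x ∈ h '' Icc s t, x ≠ h s → x ≠ h t → ∀ y ∈ h '' Icc 0 s ∪ h '' Icc t (i0 + j0), y ≠ h s → y ≠ h t →
        G.Adj x y → ∃ i j, 0 < i ∧ i ≤ i0 ∧ 0 < j ∧ j ≤ j0 ∧ (i ≠ i0 ∨ j ≠ j0) ∧ G.Adj (f i) (g j) ∧ s(x, y) = s(f i, g j) := by
      rintro _ ⟨p, ⟨hp, hp'⟩, rfl⟩ n1 n2 y hy n3 n4 ha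
      have hp1 : p ≠ s := fun e => n1 (e ▸ rfl)
      have hp2 : p ≠ t := fun e => n2 (e ▸ rfl)
      have hq : ∃ q, h q = y ∧ q ≤ i0 + j0 ∧ (q < s ∨ t < q) := by
        rcases hy with ⟨q, ⟨hq, hq'⟩, rfl⟩ | ⟨q, ⟨hq, hq'⟩, rfl⟩
        · exact ⟨q, rfl, om, .inl (lt_of_le_of_ne hq' fun e => n3 (e ▸ rfl))⟩
        · exact ⟨q, rfl, om, .inr (lt_of_le_of_ne hq fun e => n4 (e ▸ rfl))⟩
      obtain ⟨q, rfl, hq, hq' | hq'⟩ := hq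
      · rcases (hch q p om om).2 ha.symm with e | ⟨k1, k2, k3, k4⟩
        · omega
        · refine ⟨i0 - q, p - i0, om, om, om, om, om, ?_, ?_⟩
          · rw [← k3, ← k4]; exact ha.symm
          · rw [← k3, ← k4, Sym2.eq_swap]
      · rcases (hch p q om om).2 ha with e | ⟨k1, k2, k3, k4⟩
        · omega
        · refine ⟨i0 - p, q - i0, om, om, om, om, om, ?_, ?_⟩
          · grind
          · rw [← k3, ← k4]
    by_cases hsep : Sep G r (h s) (h t)
    · obtain ⟨w, w', A, hw, hsA, htA, hw1, hw2, hwA, hwA', hrA, hN⟩ := hsep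
      have q1 : w ∈ h '' Icc s t ∨ w' ∈ h '' Icc s t := by
        by_contra! hc
        exact htA (sep_conn hN c1 hLC.2.2.2.2.2.2.1 hc.1 hc.2 (mseg le_rfl hst.le) hsA (mseg hst.le le_rfl))
      have q2 : w ∈ h '' Icc 0 s ∪ h '' Icc t (i0 + j0) ∨ w' ∈ h '' Icc 0 s ∪ h '' Icc t (i0 + j0) := by
        by_contra! hc
        exact htA (sep_conn hN c2 hLC.2.2.2.2.2.2.2.1 hc.1 hc.2 (.inl (mseg (Nat.zero_le _) le_rfl)) hsA (.inr (mseg le_rfl ht)))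
      have s1 : w ≠ h s := fun e => hwA (e ▸ hsA)
      have s2 : w' ≠ h s := fun e => hwA' (e ▸ hsA)
      have hd := hLC.2.2.2.2.2.2.2.2
      have hij : ∃ i j, 0 < i ∧ i ≤ i0 ∧ 0 < j ∧ j ≤ j0 ∧ s(w, w') = s(f i, g j) := by
        rcases hw with rfl | hw
        · rcases hd w (q1.elim id id) (q2.elim id id) with e | e
          exacts [absurd e s1, absurd e hw1.symm]
        · rcases q1 with q1 | q1
          · rcases q2 with q2 | q2
            · grind
            · obtain ⟨i, j, k1, k2, k3, k4, k5, k6, k7⟩ := hcd w q1 s1 hw1.symm w' q2 s2 hw2.symm hw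
              exact ⟨i, j, k1, k2, k3, k4, k7⟩
          · rcases q2 with q2 | q2
            · obtain ⟨i, j, k1, k2, k3, k4, k5, k6, k7⟩ := hcd w' q1 s2 hw2.symm w q2 s1 hw1.symm hw.symm
              exact ⟨i, j, k1, k2, k3, k4, by rw [Sym2.eq_swap]; exact k7⟩
            grind
      obtain ⟨i, j, k1, k2, k3, k4, k5⟩ := hij
      let T : Set V := (f '' Icc 0 (i - 1) ∪ g '' Icc 0 (j - 1)) ∪ (insert v (f '' Icc (i + 1) n ∪ g '' Icc (j + 1) m))
      have hT : Conn G T := by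
        refine ((c.pf.seg om om).union (c.pg.seg om om) ⟨_, mseg le_rfl om, _, mseg le_rfl om, .inl (c.f0.trans c.g0.symm)⟩).union
          (((c.pf.seg om om).union (c.pg.seg om om) ⟨_, mseg om le_rfl, _, mseg om le_rfl, .inl (c.fn.trans c.gm.symm)⟩).ins
          ⟨f n, .inl (mseg om le_rfl), ?_⟩) ⟨f 0, .inl (mseg le_rfl om), v, .inl rfl, .inr ?_⟩
        · rw [c.fn]; exact c.vu
        · rw [c.f0]; exact c.va.symm
      have hT1 : ∀ x, (∃ p ≤ n, p ≠ i ∧ f p = x) ∨ (∃ p ≤ m, p ≠ j ∧ g p = x) → x ∈ T := by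
        rintro _ (⟨p, hp, hp', rfl⟩ | ⟨p, hp, hp', rfl⟩)
        · rcases lt_or_gt_of_ne hp' with h' | h'
          · exact .inl (.inl (mseg om om))
          · exact .inr (.inr (.inl (mseg om hp)))
        · rcases lt_or_gt_of_ne hp' with h' | h'
          · exact .inl (.inr (mseg om om))
          · exact .inr (.inr (.inr (mseg om hp)))
      have hT2 : ∀ x ∈ T, x = v ∨ (∃ p ≤ n, p ≠ i ∧ f p = x) ∨ (∃ p ≤ m, p ≠ j ∧ g p = x) := by
        rintro x ((⟨p, ⟨hp, hp'⟩, e⟩ | ⟨p, ⟨hp, hp'⟩, e⟩) | rfl | ⟨p, ⟨hp, hp'⟩, e⟩ | ⟨p, ⟨hp, hp'⟩, e⟩)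
        · exact .inr (.inl ⟨p, om, om, e⟩)
        · exact .inr (.inr ⟨p, om, om, e⟩)
        · exact .inl rfl
        · exact .inr (.inl ⟨p, om, om, e⟩)
        · exact .inr (.inr ⟨p, om, om, e⟩)
      have hnT : r ∉ T ∧ f i ∉ T ∧ g j ∉ T := by
        refine ⟨fun hh => ?_, fun hh => ?_, fun hh => ?_⟩ <;> rcases hT2 _ hh with e | ⟨p, hp, hp', e⟩ | ⟨p, hp, hp', e⟩
        · exact hr e
        · exact hrf p hp e
        · exact hrg p hp e
        · exact c.vf i om e
        · exact hp' (c.pf.inj hp om e)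
        · have := c.dj i om p hp e.symm; omega
        · exact c.vg j om e
        · have := c.dj p hp j om e; omega
        · exact hp' (c.pg.inj hp om e)
      have hnT' : w ∉ T ∧ w' ∉ T := by
        rw [Sym2.eq_iff] at k5
        rcases k5 with ⟨rfl, rfl⟩ | ⟨rfl, rfl⟩
        · exact hnT.2
        · exact hnT.2.symm
      have hin : ∀ p ≤ i0 + j0, h p ≠ w → h p ≠ w' → h p ∈ T := by
        intro p hp n1 n2
        have : h p ≠ f i ∧ h p ≠ g j := by
          rw [Sym2.eq_iff] at k5
          rcases k5 with ⟨rfl, rfl⟩ | ⟨rfl, rfl⟩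
          · exact ⟨n1, n2⟩
          · exact ⟨n2, n1⟩
        apply hT1
        rcases le_or_gt p i0 with h' | h'
        · rw [hf p h'] at this ⊢; exact .inl ⟨_, om, fun e => this.1 (by rw [e]), rfl⟩
        · rw [hg p h'.le] at this ⊢; exact .inr ⟨_, om, fun e => this.2 (by rw [e]), rfl⟩
      exact htA (sep_conn hN hT hnT.1 hnT'.1 hnT'.2 (hin s om s1.symm s2.symm) hsA (hin t ht hw1 hw2))
    · refine c.fin hxs hyt (hch s t hst ht).1 hsep hLC fun x hx n1 n2 y hy n3 n4 ha => ?_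
      obtain ⟨i, j, k1, k2, k3, k4, k5, k6, k7⟩ := hcd x hx n1 n2 y hy n3 n4 ha
      rw [k7]
      have z1 : f i ≠ a := fun e => by rw [← c.f0] at e; have := c.pf.inj om om e; omega
      have z2 : f i ≠ u := fun e => by rw [← c.fn] at e; have := c.pf.inj om om e; omega
      have z3 : g j ≠ a := fun e => by rw [← c.g0] at e; have := c.pg.inj om om e; omega
      have z4 : g j ≠ u := fun e => by rw [← c.gm] at e; have := c.pg.inj om om e; omega
      obtain ⟨q1, q2⟩ := c.inE om om z1 z2 z3 z4 k6
      exact ⟨q1, q2 i0 j0 b1 b2 b4.le k5⟩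
  obtain ⟨s, hs, rfl⟩ := hmem x hxC
  obtain ⟨t, ht, rfl⟩ := hmem y hyC
  by_contra hne
  rcases lt_trichotomy s t with h' | rfl | h'
  · exact main s t h' ht hx hy
  · exact hne rfl
  grind
end Paper

namespace Paper
variable {V : Type} {G : SimpleGraph V} {v a u : V} {f g : ℕ → V} {n m i0 j0 : ℕ} {E : Set (Sym2 V)}
theorem Cfg.uniq' [Finite V] (c : Cfg G v a u f g n m i0 j0 E) {r x y : V} (hr : r ≠ v) (hrf : ∀ i ≤ n, f i ≠ r)
    (hrg : ∀ i ≤ m, g i ≠ r) (hx : G.Adj r x) (hy : G.Adj r y) (hxC : x ∈ f '' Icc i0 n ∪ g '' Icc j0 m)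
    (hyC : y ∈ f '' Icc i0 n ∪ g '' Icc j0 m) : x = y := by
  have key : ∀ x, x ∈ f '' Icc i0 n ∪ g '' Icc j0 m →
      x ∈ (fun i => f (n - i)) '' Icc 0 (n - i0) ∪ (fun i => g (m - i)) '' Icc 0 (m - j0) := by
    rintro x (⟨s, ⟨hs, hs'⟩, rfl⟩ | ⟨s, ⟨hs, hs'⟩, rfl⟩)
    · exact .inl ⟨n - s, ⟨by omega, om⟩, by simp only; congr 1; omega⟩
    · exact .inr ⟨m - s, ⟨by omega, om⟩, by simp only; congr 1; omega⟩
  exact c.rev.uniq hr (fun i _ => hrf _ om) (fun i _ => hrg _ om) hx hy (key x hxC) (key y hyC)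
structure Rh (G : SimpleGraph V) (v : V) (f g ρ : ℕ → V) (n m i0 j0 l : ℕ) : Prop where
  pr : IsP G ρ l
  rv : ∀ s ≤ l, ρ s ≠ v
  rf : ∀ s ≤ l, ∀ i ≤ n, f i ≠ ρ s
  rg : ∀ s ≤ l, ∀ i ≤ m, g i ≠ ρ s
  A1 : ∀ s ≤ l, ∀ i < i0, G.Adj (ρ s) (f i) → s = 0
  A2 : ∀ s ≤ l, ∀ i < j0, G.Adj (ρ s) (g i) → s = 0
  B1 : ∀ s ≤ l, ∀ i, i0 < i → i ≤ n → G.Adj (ρ s) (f i) → s = l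
  B2 : ∀ s ≤ l, ∀ i, j0 < i → i ≤ m → G.Adj (ρ s) (g i) → s = l
variable {ρ : ℕ → V} {l : ℕ}
theorem Rh.swap (r : Rh G v f g ρ n m i0 j0 l) : Rh G v g f ρ m n j0 i0 l :=
  ⟨r.pr, r.rv, r.rg, r.rf, r.A2, r.A1, r.B2, r.B1⟩
theorem Rh.rev (r : Rh G v f g ρ n m i0 j0 l) :
    Rh G v (fun i => f (n - i)) (fun i => g (m - i)) (fun i => ρ (l - i)) n m (n - i0) (m - j0) l :=
  ⟨r.pr.rev, fun s _ => r.rv _ om, fun s _ i _ => r.rf _ om _ om, fun s _ i _ => r.rg _ om _ om,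
   fun s _ i _ h => by have := r.B1 (l - s) om _ om om h; omega,
   fun s _ i _ h => by have := r.B2 (l - s) om _ om om h; omega,
   fun s _ i _ _ h => by have := r.A1 (l - s) om _ om h; omega,
   fun s _ i _ _ h => by have := r.A2 (l - s) om _ om h; omega⟩
theorem IsP.prev (h : IsP G f n) {i : ℕ} (h0 : 0 < i) (hi : i ≤ n) : G.Adj (f i) (f (i - 1)) := by
  have := h.1 (i - 1) om; rw [show i - 1 + 1 = i by omega] at this; exact this.symm
theorem Cfg.same [Finite V] (c : Cfg G v a u f g n m i0 j0 E) (hC : CP G) (r : Rh G v f g ρ n m i0 j0 l) {i i' : ℕ}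
    (hi : i < i0) (hp : G.Adj (ρ 0) (f i)) (hi' : i0 < i') (hn : i' ≤ n) (hq : G.Adj (ρ l) (f i')) : False := by
  have b1 := c.hi; have b2 := c.hi'; have b3 := c.hj; have b4 := c.hj'
  have uA : ∀ y, G.Adj (ρ 0) y → y ∈ f '' Icc 0 i0 ∪ g '' Icc 0 j0 → f i = y := fun y hy hyC =>
    c.uniq (r.rv 0 om) (r.rf 0 om) (r.rg 0 om) hp hy (.inl (mseg om hi.le)) hyC
  have uB : ∀ y, G.Adj (ρ l) y → y ∈ f '' Icc i0 n ∪ g '' Icc j0 m → f i' = y := fun y hy hyC =>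
    c.uniq' (r.rv l le_rfl) (r.rf l le_rfl) (r.rg l le_rfl) hq hy (.inl (mseg om hn)) hyC
  have hz : ∀ s ≤ l, ¬ G.Adj (ρ s) (g j0) := by
    intro s hs ha
    have s0 : 0 < s := by
      by_contra hc; obtain rfl : s = 0 := om
      have := c.dj _ om _ om (uA _ ha (.inr (mseg om le_rfl))); omega
    have sl : s < l := by
      by_contra hc; obtain rfl : s = l := om
      have := c.dj _ om _ om (uB _ ha (.inr (mseg le_rfl om))); omega
    refine hC.use (D := f '' Icc i (i0 - 1) ∪ ρ '' Icc 0 (s - 1)) (D' := ρ '' Icc (s + 1) l ∪ f '' Icc (i0 + 1) i') c.e.symm ha.symm (r.rf s hs i0 om)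
      ((c.pf.seg om om).union (r.pr.seg om om) ⟨_, mseg le_rfl om, _, mseg le_rfl om, .inr hp.symm⟩)
      ((r.pr.seg om om).union (c.pf.seg om om) ⟨_, mseg om le_rfl, _, mseg om le_rfl, .inr hq⟩)
      ?_ ?_ ?_ ⟨_, .inl (mseg om le_rfl), c.pf.prev b1 om⟩ ⟨_, .inr (mseg om le_rfl), r.pr.prev s0 om⟩
      ⟨_, .inr (mseg le_rfl om), c.pf.1 _ om⟩ ⟨_, .inl (mseg le_rfl om), r.pr.1 _ om⟩
    · rintro _ (⟨p, ⟨hp, hp'⟩, rfl⟩ | ⟨p, ⟨hp, hp'⟩, rfl⟩) _ (⟨q, ⟨hq, hq'⟩, rfl⟩ | ⟨q, ⟨hq, hq'⟩, rfl⟩)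
      · exact ⟨r.rf _ om _ om, fun e => by have := r.A1 q om p om e.symm; omega⟩
      · exact ⟨fun e => by have := c.pf.inj om om e; omega, fun e => by have := c.pf.adj om om e; omega⟩
      · exact ⟨fun e => by have := r.pr.inj om om e; omega, fun e => by have := r.pr.adj om om e; omega⟩
      · exact ⟨(r.rf _ om _ om).symm, fun e => by have := r.B1 p om q om om e; omega⟩
    · rintro _ (⟨p, ⟨hp, hp'⟩, rfl⟩ | ⟨p, ⟨hp, hp'⟩, rfl⟩)
      · exact ⟨fun e => by have := c.dj _ om _ om e; omega, fun e => by have := c.pf.inj om om e; omega, r.rf _ hs _ om⟩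
      · exact ⟨(r.rg _ om _ om).symm, (r.rf _ om _ om).symm, fun e => by have := r.pr.inj om om e; omega⟩
    · rintro _ (⟨p, ⟨hp, hp'⟩, rfl⟩ | ⟨p, ⟨hp, hp'⟩, rfl⟩)
      · exact ⟨(r.rg _ om _ om).symm, (r.rf _ om _ om).symm, fun e => by have := r.pr.inj om om e; omega⟩
      · exact ⟨fun e => by have := c.dj _ om _ om e; omega, fun e => by have := c.pf.inj om om e; omega, r.rf _ hs _ om⟩
  refine c.fin (D := (f '' Icc 0 i ∪ ρ '' Icc 0 l) ∪ f '' Icc i' n) (D' := g '' Icc 0 m) c.va c.vu c.au c.ns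
    ⟨((c.pf.seg om om).union (r.pr.seg om om) ⟨_, mseg om le_rfl, _, mseg le_rfl om, .inr hp.symm⟩).union
      (c.pf.seg om om) ⟨_, .inr (mseg om le_rfl), _, mseg le_rfl hn, .inr hq⟩, c.pg.seg om le_rfl,
      .inl (.inl ⟨0, by simp, c.f0⟩), .inr ⟨n, by simp [hn], c.fn⟩, ⟨0, by simp, c.g0⟩, ⟨m, by simp, c.gm⟩, ?_, ?_, ?_⟩ ?_
  · rintro ((⟨s, ⟨hs, hs'⟩, e⟩ | ⟨s, ⟨hs, hs'⟩, e⟩) | ⟨s, ⟨hs, hs'⟩, e⟩)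
    · exact c.vf s om e
    · exact r.rv s om e
    · exact c.vf s om e
  · rintro ⟨s, ⟨hs, hs'⟩, e⟩; exact c.vg s om e
  · have : ∀ s ≤ n, ∀ t ≤ m, g t = f s → f s = a ∨ f s = u := fun s hs t ht e => by
      rcases c.dj s hs t ht e.symm with ⟨rfl, -⟩ | ⟨rfl, -⟩
      exacts [.inl c.f0, .inr c.fn]
    rintro _ ((⟨s, ⟨hs, hs'⟩, rfl⟩ | ⟨s, ⟨hs, hs'⟩, rfl⟩) | ⟨s, ⟨hs, hs'⟩, rfl⟩) ⟨t, ⟨ht, ht'⟩, e⟩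
    · grind
    · exact absurd e (r.rg s hs' t ht')
    grind
  · rintro _ ((⟨s, ⟨hs, hs'⟩, rfl⟩ | ⟨s, ⟨hs, hs'⟩, rfl⟩) | ⟨s, ⟨hs, hs'⟩, rfl⟩) h1 h2 _ ⟨t, ⟨ht, ht'⟩, rfl⟩ h3 h4 ha
    · obtain ⟨q1, q2⟩ := c.inE om om h1 h2 h3 h4 ha
      grind
    · exfalso
      rcases lt_trichotomy t j0 with h' | rfl | h'
      · obtain rfl := r.A2 s om t h' ha
        rcases c.dj _ om _ om (uA _ ha (.inr (mseg om om))) with ⟨-, rfl⟩ | ⟨-, rfl⟩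
        exacts [h3 c.g0, h4 c.gm]
      · exact hz s hs' ha
      · obtain rfl := r.B2 s om t h' ht' ha
        rcases c.dj _ om _ om (uB _ ha (.inr (mseg om om))) with ⟨-, rfl⟩ | ⟨-, rfl⟩
        exacts [h3 c.g0, h4 c.gm]
    · obtain ⟨q1, q2⟩ := c.inE om om h1 h2 h3 h4 ha
      grind
theorem Cfg.cross1 [Finite V] (c : Cfg G v a u f g n m i0 j0 E) (hC : CP G) (r : Rh G v f g ρ n m i0 j0 l) {i j : ℕ}
    (h0 : 0 < i) (hi : i < i0) (hp : G.Adj (ρ 0) (f i)) (hj : j0 < j) (hm : j < m) (hq : G.Adj (ρ l) (g j)) :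
    (∀ s ≤ l, ¬ G.Adj (ρ s) (f i0)) ∧ ¬ G.Adj (f i) (f i0) := by
  have b1 := c.hi; have b2 := c.hi'; have b3 := c.hj; have b4 := c.hj'
  have uA : ∀ y, G.Adj (ρ 0) y → y ∈ f '' Icc 0 i0 ∪ g '' Icc 0 j0 → f i = y := fun y hy hyC =>
    c.uniq (r.rv 0 om) (r.rf 0 om) (r.rg 0 om) hp hy (.inl (mseg om hi.le)) hyC
  have uB : ∀ y, G.Adj (ρ l) y → y ∈ f '' Icc i0 n ∪ g '' Icc j0 m → g j = y := fun y hy hyC =>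
    c.uniq' (r.rv l le_rfl) (r.rf l le_rfl) (r.rg l le_rfl) hq hy (.inr (mseg om hm.le)) hyC
  have hfg : ∀ s ≤ n, ∀ t ≤ m, 0 < s → s < n → f s ≠ g t := fun s hs t ht h h' e => by have := c.dj s hs t ht e; omega
  have hfg' : ∀ s ≤ n, ∀ t ≤ m, 0 < t → t < m → f s ≠ g t := fun s hs t ht h h' e => by have := c.dj s hs t ht e; omega
  refine ⟨fun s hs ha => ?_, fun ha => ?_⟩
  · have s0 : 0 < s := by
      by_contra hc; obtain rfl : s = 0 := om
      have := c.pf.inj om om (uA _ ha (.inl (mseg om le_rfl))); omega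
    have sl : s < l := by grind
    refine hC.use (D := g '' Icc (j0 + 1) j ∪ ρ '' Icc (s + 1) l) (D' := (g '' Icc 0 (j0 - 1) ∪ f '' Icc 0 i) ∪ ρ '' Icc 0 (s - 1))
      c.e ha.symm (r.rg s hs j0 om)
      ((c.pg.seg om om).union (r.pr.seg om om) ⟨_, mseg om le_rfl, _, mseg om le_rfl, .inr hq.symm⟩)
      (((c.pg.seg om om).union (c.pf.seg om om) ⟨_, mseg le_rfl om, _, mseg le_rfl om, .inl (c.g0.trans c.f0.symm)⟩).union
        (r.pr.seg om om) ⟨_, .inr (mseg om le_rfl), _, mseg le_rfl om, .inr hp.symm⟩)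
      ?_ ?_ ?_ ⟨_, .inl (mseg le_rfl om), c.pg.1 _ om⟩ ⟨_, .inr (mseg le_rfl om), r.pr.1 _ om⟩
      ⟨_, .inl (.inl (mseg om le_rfl)), c.pg.prev b3 om⟩ ⟨_, .inr (mseg om le_rfl), r.pr.prev s0 om⟩
    · rintro _ (⟨p, ⟨hp, hp'⟩, rfl⟩ | ⟨p, ⟨hp, hp'⟩, rfl⟩) _ ((⟨q, ⟨hq, hq'⟩, rfl⟩ | ⟨q, ⟨hq, hq'⟩, rfl⟩) | ⟨q, ⟨hq, hq'⟩, rfl⟩)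
      · exact ⟨fun e => by have := c.pg.inj om om e; omega, fun e => by have := c.pg.adj om om e; omega⟩
      · exact ⟨(hfg' _ om _ om om om).symm, fun e => c.direct hC (i := q) (j := p) om om om e.symm⟩
      · exact ⟨r.rg _ om _ om, fun e => by have := r.B2 q om p om om e.symm; omega⟩
      · exact ⟨(r.rg _ om _ om).symm, fun e => by have := r.A2 p om q om e; omega⟩
      · exact ⟨(r.rf _ om _ om).symm, fun e => by have := r.A1 p om q om e; omega⟩
      · exact ⟨fun e => by have := r.pr.inj om om e; omega, fun e => by have := r.pr.adj om om e; omega⟩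
    · rintro _ (⟨p, ⟨hp, hp'⟩, rfl⟩ | ⟨p, ⟨hp, hp'⟩, rfl⟩)
      · exact ⟨(hfg _ om _ om om om).symm, fun e => by have := c.pg.inj om om e; omega, r.rg _ hs _ om⟩
      · exact ⟨(r.rf _ om _ om).symm, (r.rg _ om _ om).symm, fun e => by have := r.pr.inj om om e; omega⟩
    · rintro _ ((⟨p, ⟨hp, hp'⟩, rfl⟩ | ⟨p, ⟨hp, hp'⟩, rfl⟩) | ⟨p, ⟨hp, hp'⟩, rfl⟩)
      · exact ⟨(hfg _ om _ om om om).symm, fun e => by have := c.pg.inj om om e; omega, r.rg _ hs _ om⟩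
      · exact ⟨fun e => by have := c.pf.inj om om e; omega, hfg' _ om _ om om om, r.rf _ hs _ om⟩
      · exact ⟨(r.rf _ om _ om).symm, (r.rg _ om _ om).symm, fun e => by have := r.pr.inj om om e; omega⟩
  · refine hC.use (D := ρ '' Icc 0 l ∪ g '' Icc (j0 + 1) j) (D' := g '' Icc 0 (j0 - 1) ∪ f '' Icc 0 (i - 1))
      ha.symm c.e (hfg _ om _ om om om)
      ((r.pr.seg om om).union (c.pg.seg om om) ⟨_, mseg om le_rfl, _, mseg om le_rfl, .inr hq⟩)
      ((c.pg.seg om om).union (c.pf.seg om om) ⟨_, mseg le_rfl om, _, mseg le_rfl om, .inl (c.g0.trans c.f0.symm)⟩)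
      ?_ ?_ ?_ ⟨_, .inl (mseg le_rfl om), hp.symm⟩ ⟨_, .inr (mseg le_rfl om), c.pg.1 _ om⟩
      ⟨_, .inr (mseg om le_rfl), c.pf.prev h0 om⟩ ⟨_, .inl (mseg om le_rfl), c.pg.prev b3 om⟩
    · rintro _ (⟨p, ⟨hp, hp'⟩, rfl⟩ | ⟨p, ⟨hp, hp'⟩, rfl⟩) _ (⟨q, ⟨hq, hq'⟩, rfl⟩ | ⟨q, ⟨hq, hq'⟩, rfl⟩)
      · refine ⟨(r.rg _ om _ om).symm, fun e => ?_⟩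
        obtain rfl := r.A2 p om q om e
        grind
      · refine ⟨(r.rf _ om _ om).symm, fun e => ?_⟩
        obtain rfl := r.A1 p om q om e
        have := c.pf.inj om om (uA _ e (.inl (mseg om om))); omega
      · exact ⟨fun e => by have := c.pg.inj om om e; omega, fun e => by have := c.pg.adj om om e; omega⟩
      · exact ⟨(hfg' _ om _ om om om).symm, fun e => c.direct hC (i := q) (j := p) om om om e.symm⟩
    · rintro _ (⟨p, ⟨hp, hp'⟩, rfl⟩ | ⟨p, ⟨hp, hp'⟩, rfl⟩)
      · exact ⟨(r.rf _ om _ om).symm, (r.rf _ om _ om).symm, (r.rg _ om _ om).symm⟩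
      · exact ⟨(hfg _ om _ om om om).symm, (hfg _ om _ om om om).symm, fun e => by have := c.pg.inj om om e; omega⟩
    · rintro _ (⟨p, ⟨hp, hp'⟩, rfl⟩ | ⟨p, ⟨hp, hp'⟩, rfl⟩)
      · exact ⟨(hfg _ om _ om om om).symm, (hfg _ om _ om om om).symm, fun e => by have := c.pg.inj om om e; omega⟩
      · exact ⟨fun e => by have := c.pf.inj om om e; omega, fun e => by have := c.pf.inj om om e; omega, hfg' _ om _ om om om⟩
theorem Cfg.cross [Finite V] (c : Cfg G v a u f g n m i0 j0 E) (hC : CP G) (r : Rh G v f g ρ n m i0 j0 l) {i j : ℕ}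
    (h0 : 0 < i) (hi : i < i0) (hp : G.Adj (ρ 0) (f i)) (hj : j0 < j) (hm : j < m) (hq : G.Adj (ρ l) (g j)) : False := by
  have b1 := c.hi; have b2 := c.hi'; have b3 := c.hj; have b4 := c.hj'
  have uA : ∀ y, G.Adj (ρ 0) y → y ∈ f '' Icc 0 i0 ∪ g '' Icc 0 j0 → f i = y := fun y hy hyC =>
    c.uniq (r.rv 0 om) (r.rf 0 om) (r.rg 0 om) hp hy (.inl (mseg om hi.le)) hyC
  have uB : ∀ y, G.Adj (ρ l) y → y ∈ f '' Icc i0 n ∪ g '' Icc j0 m → g j = y := fun y hy hyC =>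
    c.uniq' (r.rv l le_rfl) (r.rf l le_rfl) (r.rg l le_rfl) hq hy (.inr (mseg om hm.le)) hyC
  obtain ⟨k1, k2⟩ := c.cross1 hC r h0 hi hp hj hm hq
  obtain ⟨k3, k4⟩ := c.swap.rev.cross1 hC r.swap.rev (i := m - j) (j := n - i) om om
    (by rw [show m - (m - j) = j by omega]; exact hq) om om (by rw [show n - (n - i) = i by omega]; simpa using hp)
  simp only [show m - (m - j) = j by omega, show m - (m - j0) = j0 by omega] at k3 k4
  have k3 : ∀ s ≤ l, ¬ G.Adj (ρ s) (g j0) := fun s hs => by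
    have := k3 (l - s) om; rwa [show l - (l - s) = s by omega] at this
  refine c.fin (D := (f '' Icc 0 i ∪ ρ '' Icc 0 l) ∪ g '' Icc j m) (D' := g '' Icc 0 j0 ∪ f '' Icc i0 n) c.va c.vu c.au c.ns
    ⟨((c.pf.seg om om).union (r.pr.seg om om) ⟨_, mseg om le_rfl, _, mseg le_rfl om, .inr hp.symm⟩).union
      (c.pg.seg om om) ⟨_, .inr (mseg om le_rfl), _, mseg le_rfl hm.le, .inr hq⟩,
      (c.pg.seg om om).union (c.pf.seg b2.le le_rfl) ⟨_, mseg (Nat.zero_le _) le_rfl, _, mseg le_rfl b2.le, .inr c.e.symm⟩,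
      .inl (.inl ⟨0, by simp, c.f0⟩), .inr ⟨m, by simp [hm.le], c.gm⟩, .inl ⟨0, by simp, c.g0⟩, .inr ⟨n, by simp [b2.le], c.fn⟩, ?_, ?_, ?_⟩ ?_
  · rintro ((⟨s, ⟨hs, hs'⟩, e⟩ | ⟨s, ⟨hs, hs'⟩, e⟩) | ⟨s, ⟨hs, hs'⟩, e⟩)
    · exact c.vf s om e
    · exact r.rv s om e
    · exact c.vg s om e
  · rintro (⟨s, ⟨hs, hs'⟩, e⟩ | ⟨s, ⟨hs, hs'⟩, e⟩)
    · exact c.vg s om e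
    · exact c.vf s om e
  · rintro _ ((⟨s, ⟨hs, hs'⟩, rfl⟩ | ⟨s, ⟨hs, hs'⟩, rfl⟩) | ⟨s, ⟨hs, hs'⟩, rfl⟩) (⟨t, ⟨ht, ht'⟩, e⟩ | ⟨t, ⟨ht, ht'⟩, e⟩)
    · have := c.dj s om t om e.symm
      left; rw [show s = 0 by omega, c.f0]
    · have := c.pf.inj om om e; omega
    · exact absurd e (r.rg s hs' t om)
    · exact absurd e (r.rf s hs' t om)
    · have := c.pg.inj om om e; omega
    · have := c.dj t om s om e
      right; rw [show s = m by omega, c.gm]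
  · rintro _ ((⟨s, ⟨hs, hs'⟩, rfl⟩ | ⟨s, ⟨hs, hs'⟩, rfl⟩) | ⟨s, ⟨hs, hs'⟩, rfl⟩) h1 h2 _ (⟨t, ⟨ht, ht'⟩, rfl⟩ | ⟨t, ⟨ht, ht'⟩, rfl⟩) h3 h4 ha
    · obtain ⟨q1, q2⟩ := c.inE om om h1 h2 h3 h4 ha
      grind
    · exfalso
      have := c.pf.adj om om ha
      grind
    · exfalso
      rcases ht'.lt_or_eq with h' | rfl
      · obtain rfl := r.A2 s om t h' ha
        have := c.dj _ om _ om (uA _ ha (.inr (mseg om om))); omega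
      grind
    · exfalso
      rcases ht.lt_or_eq with h' | rfl
      · obtain rfl := r.B1 s om t h' ht' ha
        have := c.dj _ om _ om (uB _ ha (.inl (mseg om om))).symm; omega
      grind
    · exfalso
      have := c.pg.adj om om ha
      grind
    · obtain ⟨q1, q2⟩ := c.inE' om om h3 h4 h1 h2 ha
      grind
end Paper

namespace Paper
variable {V : Type} {G : SimpleGraph V} {v a u : V} {f g : ℕ → V} {n m i0 j0 : ℕ} {E : Set (Sym2 V)}
theorem Cfg.false [Finite V] (c : Cfg G v a u f g n m i0 j0 E) (hC : CP G) : False := by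
  have b1 := c.hi; have b2 := c.hi'; have b3 := c.hj; have b4 := c.hj'
  let A : Set V := f '' Icc 0 (i0 - 1) ∪ g '' Icc 0 (j0 - 1)
  let B : Set V := f '' Icc (i0 + 1) n ∪ g '' Icc (j0 + 1) m
  have na : ∀ i, 0 < i → i ≤ n → f i ≠ a := fun i h h' e => by
    rw [← c.f0] at e; have := c.pf.inj h' om e; omega
  have nu : ∀ i, i < n → f i ≠ u := fun i h e => by
    rw [← c.fn] at e; have := c.pf.inj h.le om e; omega
  have na' : ∀ i, 0 < i → i ≤ m → g i ≠ a := fun i h h' e => by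
    rw [← c.g0] at e; have := c.pg.inj h' om e; omega
  have nu' : ∀ i, i < m → g i ≠ u := fun i h e => by
    rw [← c.gm] at e; have := c.pg.inj h.le om e; omega
  obtain ⟨K, hK, haK, huK, hvK, hzK, hzK'⟩ := nsep c.ns c.va.ne (.inr c.e) (na _ b1 b2.le).symm (na' _ b3 b4.le).symm
    (nu _ b2).symm (nu' _ b4).symm
  have haA : a ∈ A := .inl ⟨0, by simp, c.f0⟩
  have huB : u ∈ B := .inl ⟨n, by simp; omega, c.fn⟩
  have hAB : Anti G A B := by
    rintro _ (⟨s, ⟨hs, hs'⟩, rfl⟩ | ⟨s, ⟨hs, hs'⟩, rfl⟩) _ (⟨t, ⟨ht, ht'⟩, rfl⟩ | ⟨t, ⟨ht, ht'⟩, rfl⟩)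
    · exact ⟨fun e => by have := c.pf.inj om om e; omega, fun e => by have := c.pf.adj om om e; omega⟩
    · exact ⟨fun e => by have := c.dj _ om _ om e; omega, fun e => c.direct hC om om om e⟩
    · exact ⟨fun e => by have := c.dj _ om _ om e.symm; omega, fun e => c.swap.direct hC om om om e⟩
    · exact ⟨fun e => by have := c.pg.inj om om e; omega, fun e => by have := c.pg.adj om om e; omega⟩
  have hfC : ∀ i ≤ n, i = i0 ∨ f i ∈ A ∨ f i ∈ B := fun i hi => by grind
  have hgC : ∀ i ≤ m, i = j0 ∨ g i ∈ A ∨ g i ∈ B := fun i hi => by grind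
  obtain ⟨σ, k, hσ0, hσk, hσK, hσP, hσA, hσB⟩ := exists_path hK (A := A) (B := B) ⟨a, haK, haA⟩ ⟨u, huK, huB⟩
  have hk : 2 ≤ k := by
    by_contra hc
    obtain rfl | rfl : k = 0 ∨ k = 1 := om
    · exact (hAB _ hσ0 _ hσk).1 rfl
    · exact (hAB _ hσ0 _ hσk).2 (hσP.1 0 om)
  have hM : ∀ x ∈ σ '' Icc 1 (k - 1), x ∈ K ∧ x ∉ A ∧ x ∉ B := by grind
  obtain ⟨ρ, l, h0, hl, hρM, hP, hA, hB⟩ := exists_path (hσP.seg (i := 1) (j := k - 1) om om)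
    (A := {x | ∃ p ∈ A, G.Adj x p}) (B := {x | ∃ p ∈ B, G.Adj x p})
    ⟨σ 1, mseg om om, σ 0, hσ0, (hσP.1 0 om).symm⟩
    ⟨σ (k - 1), mseg om om, σ k, hσk, by
      have := hσP.1 (k - 1) om; grind⟩
  have r : Rh G v f g ρ n m i0 j0 l := by
    refine ⟨hP, fun s hs e => hvK (e ▸ (hM _ (hρM s hs)).1), fun s hs i hi e => ?_, fun s hs i hi e => ?_,
      fun s hs i hi h => hA s hs ⟨_, .inl (mseg om om), h⟩,
      fun s hs i hi h => hA s hs ⟨_, .inr (mseg om om), h⟩,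
      fun s hs i hi hi' h => hB s hs ⟨_, .inl (mseg om om), h⟩,
      fun s hs i hi hi' h => hB s hs ⟨_, .inr (mseg om om), h⟩⟩
    · grind
    grind
  have fin : ∀ {f g : ℕ → V} {n m i0 j0 : ℕ} (c : Cfg G v a u f g n m i0 j0 E) (r : Rh G v f g ρ n m i0 j0 l) (s t : ℕ),
      s ≤ i0 - 1 → G.Adj (ρ 0) (f s) → j0 + 1 ≤ t → t ≤ m → G.Adj (ρ l) (g t) → False := by
    intro f g n m i0 j0 c r s t hs ha ht htm hb
    have b1 := c.hi; have b2 := c.hi'; have b3 := c.hj; have b4 := c.hj'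
    by_cases hs0 : s = 0
    · rw [hs0, c.f0, ← c.g0] at ha; exact c.swap.same hC r.swap om ha om htm hb
    by_cases ht0 : t = m
    · rw [ht0, c.gm, ← c.fn] at hb; exact c.same hC r om ha om le_rfl hb
    · exact c.cross hC r om om ha om om hb
  obtain ⟨_, ⟨s, ⟨hs, hs'⟩, rfl⟩ | ⟨s, ⟨hs, hs'⟩, rfl⟩, ha⟩ := h0 <;> obtain ⟨_, ⟨t, ⟨ht, ht'⟩, rfl⟩ | ⟨t, ⟨ht, ht'⟩, rfl⟩, hb⟩ := hl
  · exact c.same hC r om ha om ht' hb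
  · exact fin c r s t hs' ha ht ht' hb
  · exact fin c.swap r.swap s t hs' ha ht ht' hb
  · exact c.swap.same hC r.swap om ha om ht' hb
theorem sep [Finite V] (hC : CP G) (hT : Tf G) (hva : G.Adj v a) (hvu : G.Adj v u) (hau : a ≠ u) : Sep G v a u := by
  by_contra hns
  classical
  let Q : ℕ → Prop := fun N => ∃ v a u D D', G.Adj v a ∧ G.Adj v u ∧ a ≠ u ∧ ¬ Sep G v a u ∧ LC G v a u D D' ∧
    (XE G a u D D').ncard = N
  have hQ : ∃ N, Q N := by
    obtain ⟨D, D', h⟩ := exists_LC hT hva hvu hau hns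
    grind
  obtain ⟨v, a, u, D, D', hva, hvu, hau, hns, ⟨hD, hD', ha, hu, ha', hu', hv, hv', hd⟩, hN⟩ := Nat.find_spec hQ
  obtain ⟨f, n, f0, fn, hfD, hf, f0', fn'⟩ := exists_path hD (A := {a}) (B := {u}) ⟨a, ha, rfl⟩ ⟨u, hu, rfl⟩
  obtain ⟨g, m, g0, gm, hgD, hg, g0', gm'⟩ := exists_path hD' (A := {a}) (B := {u}) ⟨a, ha', rfl⟩ ⟨u, hu', rfl⟩
  have hna : ¬ G.Adj a u := fun h => hT _ _ _ hva.symm hvu h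
  have two : ∀ (f : ℕ → V) (n : ℕ), IsP G f n → f 0 = a → f n = u → 2 ≤ n := fun f n h e1 e2 => by
    by_contra hc
    obtain rfl | rfl : n = 0 ∨ n = 1 := om
    · grind
    · have := h.1 0 om; grind
  have n2 := two f n hf f0 fn
  have m2 := two g m hg g0 gm
  have hdj : ∀ i ≤ n, ∀ j ≤ m, f i = g j → (i = 0 ∧ j = 0) ∨ (i = n ∧ j = m) := fun i hi j hj e => by grind
  have hex : ∃ i j, 0 < i ∧ i < n ∧ 0 < j ∧ j < m ∧ G.Adj (f i) (g j) := by
    by_contra! hno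
    refine hC.use (D := f '' Icc 1 (n - 1)) (D' := g '' Icc 1 (m - 1)) hva hvu hau (hf.seg om om) (hg.seg om om) ?_ ?_ ?_
      ⟨f 1, mseg om om, by have := hf.1 0 om; rwa [f0] at this⟩
      ⟨f (n - 1), mseg om om, by have := hf.prev (i := n) om le_rfl; rwa [fn] at this⟩
      ⟨g 1, mseg om om, by have := hg.1 0 om; rwa [g0] at this⟩
      ⟨g (m - 1), mseg om om, by have := hg.prev (i := m) om le_rfl; rwa [gm] at this⟩
    · rintro _ ⟨s, ⟨hs, hs'⟩, rfl⟩ _ ⟨t, ⟨ht, ht'⟩, rfl⟩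
      grind
    · grind
    grind
  obtain ⟨i0, j0, h1, h2, h3, h4, h5⟩ := hex
  refine Cfg.false (v := v) (a := a) (u := u) (f := f) (g := g) (n := n) (m := m) (i0 := i0) (j0 := j0) (E := XE G a u D D') (G := G) ?_ hC
  exact {
    va := hva, vu := hvu, au := hau, ns := hns, pf := hf, pg := hg, f0 := f0, g0 := g0, fn := fn, gm := gm, dj := hdj
    vf := fun i hi e => hv (e ▸ hfD i hi), vg := fun i hi e => hv' (e ▸ hgD i hi)
    hE := fun i j k1 k2 k3 k4 h => ⟨_, hfD i om, _, hgD j om,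
      ⟨fun e => by have := f0' i om e; omega, fun e => by have := fn' i om e; omega⟩,
      ⟨fun e => by have := g0' j om e; omega, fun e => by have := gm' j om e; omega⟩, h, rfl⟩
    mn := fun v' a' u' K K' k1 k2 k3 k4 k5 => by
      rw [hN]; exact Nat.find_min' hQ ⟨v', a', u', K, K', k1, k2, k3, k4, k5, rfl⟩
    hi := h1, hi' := h2, hj := h3, hj' := h4, e := h5 }
end Paper

namespace Paper
variable {V : Type} {G : SimpleGraph V} {B : Set (Set V)} {c : ℕ}
def Crit (G : SimpleGraph V) (B : Set (Set V)) (c : ℕ) : Prop :=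
  Bram G B c ∧ ∀ B', Bram G B' c → ∀ v, ∃ X ∈ B', v ∈ X
def Small (B : Set (Set V)) (A : Set V) : Prop := ∀ X ∈ B, ¬ X ⊆ A
lemma Small.mono {A A' : Set V} (h : Small B A) (hA : A' ⊆ A) : Small B A' :=
  fun X hX hs => h X hX (hs.trans hA)
lemma small_or {A A' : Set V} (hB : Bram G B c) (h : Anti G A A') : Small B A ∨ Small B A' := by
  by_contra hn
  simp only [Small, not_or, not_forall, not_not] at hn
  obtain ⟨⟨X, hX, hXA⟩, Y, hY, hYA⟩ := hn
  obtain ⟨x, hx, y, hy, h'⟩ := hB.2.1 X hX Y hY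
  have := h x (hXA hx) y (hYA hy)
  tauto
lemma cover {S : Set V} (hB : Bram G B c) (hS : S.ncard ≤ c)
    (h : ∀ x, x ∉ S → ∃ A, x ∈ A ∧ Small B A ∧ ∀ y ∈ A, ∀ w, G.Adj y w → w ∈ A ∨ w ∈ S) : False := by
  obtain ⟨X, hX, hd⟩ := hB.2.2 S hS
  rw [Set.disjoint_left] at hd
  obtain ⟨x, hx⟩ := (hB.1 X hX).1
  obtain ⟨A, hxA, hA, hN⟩ := h x (hd hx)
  refine hA X hX ((hB.1 X hX).2 (· ∈ A) ⟨x, hx, hxA⟩ fun u hu w hw ha huA => ?_)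
  grind
lemma Small.nb {A X : Set V} (hB : Bram G B c) (hA : Small B A) (hX : X ∈ B) (h : Mt X A) :
    ∃ z ∈ X, z ∈ Nb G A := by
  obtain ⟨x, hx, hxA⟩ := h
  obtain ⟨u, hu, w, hw, huA, hwA, ha⟩ := (hB.1 X hX).edge ⟨x, hx, hxA⟩
    (by simpa [Set.subset_def] using hA X hX)
  exact ⟨w, hw, hwA, u, huA, ha⟩
lemma lemR [Finite V] {A Q : Set V} (hc : Crit G B c) (hA : Small B A) (hQ : Q ⊆ A) (v : V)
    (hcl : ∀ c1 ∈ Nb G A, ∀ c2 ∈ Nb G A, c1 = c2 ∨ G.Adj c1 c2 ∨ c1 = v ∨ c2 = v)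
    (hv : v ∈ Nb G A → Conn G Q ∧ ∀ c ∈ Nb G A, ∃ q ∈ Q, G.Adj q c) :
    ∀ a ∈ A, a ∈ Q ∧ v ∈ Nb G A := by
  obtain ⟨hB, hm⟩ := hc
  set g : Set V → Set V := fun X => {x | (x ∈ X ∧ x ∉ A) ∨ (x ∈ Q ∧ v ∈ X ∧ v ∈ Nb G A)} with hg
  have hb : Bram G (g '' B) c := by
    refine ⟨?_, ?_, ?_⟩
    · rintro _ ⟨X, hX, rfl⟩
      obtain ⟨x0, hx0, hx0A⟩ := Set.not_subset.1 (hA X hX)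
      refine ⟨⟨x0, Or.inl ⟨hx0, hx0A⟩⟩, fun P hP hst => ?_⟩
      have hQP : v ∈ X → v ∈ Nb G A → ∀ w ∈ g X, P w → (w ∈ Q ∨ w ∈ Nb G A) → (∀ q ∈ Q, P q) := by
        intro h1 h2 w hw hPw h3
        have hQP : (∃ x ∈ Q, P x) → ∀ y ∈ Q, P y := fun h => (hv h2).1.2 P h
          fun u hu w hw ha => hst u (Or.inr ⟨hu, h1, h2⟩) w (Or.inr ⟨hw, h1, h2⟩) ha
        rcases h3 with h3 | h3
        · grind
        · obtain ⟨q, hq, ha⟩ := (hv h2).2 w h3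
          exact hQP ⟨q, hq, hst w hw q (Or.inr ⟨hq, h1, h2⟩) ha.symm hPw⟩
      have hPQ : v ∈ X → v ∈ Nb G A → (∀ q ∈ Q, P q) → ∀ c ∈ Nb G A, c ∈ X → P c := by
        intro h1 h2 h3 c hc hcX
        obtain ⟨q, hq, ha⟩ := (hv h2).2 c hc
        exact hst q (Or.inr ⟨hq, h1, h2⟩) c (Or.inl ⟨hcX, hc.1⟩) ha (h3 q hq)
      have key : ∀ x ∈ X, (x ∉ A → P x) ∧ (x ∈ A → ∀ c ∈ Nb G A, c ∈ X → P c) := by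
        apply (hB.1 X hX).2
        · grind
        · rintro u hu w hw ha ⟨h1, h2⟩
          by_cases huA : u ∈ A
          · exact ⟨fun hwA => h2 huA w ⟨hwA, u, huA, ha⟩ hw, fun _ => h2 huA⟩
          · have hPu := h1 huA
            refine ⟨fun hwA => hst u (Or.inl ⟨hu, huA⟩) w (Or.inl ⟨hw, hwA⟩) ha hPu,
              fun hwA d hd hdX => ?_⟩
            have huN : u ∈ Nb G A := ⟨huA, w, hwA, ha.symm⟩
            have h4 : v ∈ X → v ∈ Nb G A → P d := fun h5 h6 =>
              hPQ h5 h6 (hQP h5 h6 u (Or.inl ⟨hu, huA⟩) hPu (Or.inr huN)) d hd hdX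
            rcases hcl u huN d hd with h | h | h | h
            · exact h ▸ hPu
            · exact hst u (Or.inl ⟨hu, huA⟩) d (Or.inl ⟨hdX, hd.1⟩) h hPu
            · grind
            grind
      rintro y (hy | hy)
      · grind
      · exact hQP hy.2.1 hy.2.2 v (Or.inl ⟨hy.2.1, hy.2.2.1⟩) ((key v hy.2.1).1 hy.2.2.1)
          (Or.inr hy.2.2) y hy.1
    · rintro _ ⟨X, hX, rfl⟩ _ ⟨Y, hY, rfl⟩
      obtain ⟨x, hx, y, hy, h⟩ := hB.2.1 X hX Y hY
      by_cases hxy : x ∉ A ∧ y ∉ A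
      · exact ⟨x, Or.inl ⟨hx, hxy.1⟩, y, Or.inl ⟨hy, hxy.2⟩, h⟩
      obtain ⟨⟨c1, h1, h1'⟩, c2, h2, h2'⟩ : (∃ z ∈ X, z ∈ Nb G A) ∧ ∃ z ∈ Y, z ∈ Nb G A := by
        by_cases hxA : x ∈ A
        · refine ⟨hA.nb hB hX ⟨x, hx, hxA⟩, ?_⟩
          by_cases hyA : y ∈ A
          · exact hA.nb hB hY ⟨y, hy, hyA⟩
          · rcases h with rfl | h
            · grind
            · exact ⟨y, hy, hyA, x, hxA, h⟩
        · have hyA : y ∈ A := by tauto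
          refine ⟨?_, hA.nb hB hY ⟨y, hy, hyA⟩⟩
          rcases h with rfl | h
          · grind
          · exact ⟨x, hx, hxA, y, hyA, h.symm⟩
      rcases hcl c1 h1' c2 h2' with h | h | h | h
      · exact ⟨c1, Or.inl ⟨h1, h1'.1⟩, c2, Or.inl ⟨h2, h2'.1⟩, Or.inl h⟩
      · exact ⟨c1, Or.inl ⟨h1, h1'.1⟩, c2, Or.inl ⟨h2, h2'.1⟩, Or.inr h⟩
      · subst h
        obtain ⟨q, hq, ha⟩ := (hv h1').2 c2 h2'
        exact ⟨q, Or.inr ⟨hq, h1, h1'⟩, c2, Or.inl ⟨h2, h2'.1⟩, Or.inr ha⟩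
      · subst h
        obtain ⟨q, hq, ha⟩ := (hv h2').2 c1 h1'
        exact ⟨c1, Or.inl ⟨h1, h1'.1⟩, q, Or.inr ⟨hq, h2, h2'⟩, Or.inr ha.symm⟩
    · intro S hS
      obtain ⟨S', hS', h1, h2⟩ : ∃ S' : Set V, S'.ncard ≤ c ∧ S \ Q ⊆ S' ∧ ((∃ q ∈ Q, q ∈ S) → v ∈ S') := by
        by_cases h : ∃ q ∈ Q, q ∈ S
        · obtain ⟨q, hq, hqS⟩ := h
          refine ⟨insert v (S \ Q), ?_, Set.subset_insert _ _, fun _ => Set.mem_insert _ _⟩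
          have := Set.ncard_insert_le v (S \ Q)
          have h3 : (S \ Q).ncard < S.ncard := Set.ncard_lt_ncard
            ⟨Set.diff_subset, fun h => (h hqS).2 hq⟩ (Set.toFinite _)
          omega
        grind
      obtain ⟨X, hX, hd⟩ := hB.2.2 S' hS'
      rw [Set.disjoint_left] at hd
      refine ⟨_, ⟨X, hX, rfl⟩, Set.disjoint_left.2 ?_⟩
      grind
  intro a ha
  obtain ⟨_, ⟨X, hX, rfl⟩, h | h⟩ := hm _ hb a
  · grind
  grind
lemma lemR0 [Finite V] {A : Set V} (hc : Crit G B c) (hA : Small B A) {a : V} (ha : a ∈ A)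
    (hcl : ∀ c1 ∈ Nb G A, ∀ c2 ∈ Nb G A, c1 = c2 ∨ G.Adj c1 c2) : False :=
  (lemR hc hA (Set.empty_subset A) a (fun c1 h1 c2 h2 => (hcl c1 h1 c2 h2).imp_right Or.inl)
    (fun h => absurd ha h.1) a ha).1
end Paper

namespace Paper
variable {V : Type} {G : SimpleGraph V} {B : Set (Set V)} {c : ℕ} {v a z z' : V} {A : Set V} {p q : ℕ → V} {n m : ℕ}
def Hv (G : SimpleGraph V) (x : V) : Prop :=
  ∃ y1 y2 y3, y1 ≠ y2 ∧ y1 ≠ y3 ∧ y2 ≠ y3 ∧ G.Adj x y1 ∧ G.Adj x y2 ∧ G.Adj x y3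
lemma not_hv {x s t : V} (h : ∀ y, G.Adj x y → y = s ∨ y = t) : ¬ Hv G x := by
  rintro ⟨y1, y2, y3, h1, h2, h3, a1, a2, a3⟩
  grind
structure Cy (G : SimpleGraph V) (B : Set (Set V)) (v a : V) (A : Set V) (p : ℕ → V) (n : ℕ) (q : ℕ → V) (m : ℕ) : Prop where
  hp : IsP G p n
  hq : IsP G q m
  p0 : p 0 = a
  q0 : q 0 = a
  n1 : 1 ≤ n
  m1 : 1 ≤ m
  ne : ∀ i j, i ≤ n → j ≤ m → p i = q j → i = 0 ∧ j = 0
  ch : ∀ i j, 1 ≤ i → i ≤ n → 1 ≤ j → j ≤ m → G.Adj (p i) (q j) → i = n ∧ j = m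
  cl : G.Adj (p n) (q m)
  mA : ∀ x, x ∈ A ↔ (∃ i < n, x = p i) ∨ ∃ j < m, x = q j
  va : G.Adj v a
  vA : v ∉ A
  vp : v ≠ p n
  vq : v ≠ q m
  sm : Small B A
  nb : ∀ x ∈ A, ∀ y, G.Adj x y → y ∉ A → y = v ∨ y = p n ∨ y = q m
namespace Cy
lemma symm (h : Cy G B v a A p n q m) : Cy G B v a A q m p n :=
  { hp := h.hq, hq := h.hp, p0 := h.q0, q0 := h.p0, n1 := h.m1, m1 := h.n1
    ne := fun i j h1 h2 e => (h.ne j i h2 h1 e.symm).symm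
    ch := fun i j h1 h2 h3 h4 e => (h.ch j i h3 h4 h1 h2 e.symm).symm
    cl := h.cl.symm, mA := fun x => by rw [h.mA, or_comm], va := h.va, vA := h.vA, vp := h.vq, vq := h.vp
    sm := h.sm, nb := fun x hx y h1 h2 => by have := h.nb x hx y h1 h2; tauto }
lemma aA (h : Cy G B v a A p n q m) : a ∈ A := (h.mA a).2 (Or.inl ⟨0, h.n1, h.p0.symm⟩)
lemma pnA (h : Cy G B v a A p n q m) : p n ∉ A := by
  have := h.n1
  rw [h.mA]; rintro (⟨i, hi, e⟩ | ⟨i, hi, e⟩)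
  · have := h.hp.inj le_rfl hi.le e; omega
  · have := h.ne n i le_rfl hi.le e; omega
lemma vne (h : Cy G B v a A p n q m) {i : ℕ} (hi : i ≤ n) : v ≠ p i := by
  rcases Nat.lt_or_ge i n with h1 | h1
  · rintro rfl; exact h.vA ((h.mA _).2 (Or.inl ⟨i, h1, rfl⟩))
  · rw [le_antisymm hi h1]; exact h.vp
lemma v1 (h : Cy G B v a A p n q m) (hC : CP G) (hT : Tf G) {i : ℕ} (hi : i ≤ n) (hv : G.Adj v (p i)) : i = 0 := by
  by_contra h0
  have h1 : i ≠ 1 := by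
    rintro rfl
    have := h.hp.1 0 h.n1
    rw [h.p0] at this
    exact hT v a (p 1) h.va this hv
  have hm := h.m1
  have hD' : ∃ D', Conn G D' ∧ (∀ x ∈ D', (∃ j, 1 ≤ j ∧ j ≤ m ∧ x = q j) ∨ ∃ j, i < j ∧ j ≤ n ∧ x = p j) ∧
      q 1 ∈ D' ∧ ∃ d ∈ D', G.Adj (p i) d := by
    rcases Nat.lt_or_ge i n with h2 | h2
    · refine ⟨q '' Icc 1 m ∪ p '' Icc (i+1) n, (h.hq.seg hm le_rfl).union (h.hp.seg h2 le_rfl)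
        ⟨q m, mseg hm le_rfl, p n, mseg h2 le_rfl, Or.inr h.cl.symm⟩, ?_, Or.inl (mseg le_rfl hm),
        p (i+1), Or.inr (mseg le_rfl h2), h.hp.1 i h2⟩
      grind
    · refine ⟨q '' Icc 1 m, h.hq.seg hm le_rfl, ?_, mseg le_rfl hm,
        q m, mseg hm le_rfl, by rw [le_antisymm hi h2]; exact h.cl⟩
      grind
  obtain ⟨D', hD', hm', hq1, he⟩ := hD'
  have ha0 : ∀ j, j ≤ n → p j = a → j = 0 := fun j hj e => h.hp.inj hj (Nat.zero_le _) (e.trans h.p0.symm)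
  have hb0 : ∀ j, j ≤ m → q j = a → j = 0 := fun j hj e => h.hq.inj hj (Nat.zero_le _) (e.trans h.q0.symm)
  refine hC.use h.va hv (fun e => h0 (ha0 i hi e.symm)) (h.hp.seg (i := 1) (j := i-1) om om) hD' ?_ ?_ ?_
    ⟨p 1, mseg le_rfl om, by have := h.hp.1 0 h.n1; rwa [h.p0] at this⟩
    ⟨p (i-1), mseg om le_rfl, h.hp.prev om hi⟩
    ⟨q 1, hq1, by have := h.hq.1 0 h.m1; rwa [h.q0] at this⟩ he
  · rintro _ ⟨s, ⟨hs, hs'⟩, rfl⟩ y hy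
    rcases hm' y hy with ⟨j, h3, h4, rfl⟩ | ⟨j, h3, h4, rfl⟩
    · refine ⟨fun e => ?_, fun e => ?_⟩
      · have := h.ne s j om h4 e; omega
      · have := h.ch s j hs om h3 h4 e; omega
    · refine ⟨fun e => ?_, fun e => ?_⟩
      · have := h.hp.inj om h4 e; omega
      · have := h.hp.adj om h4 e; omega
  · rintro _ ⟨s, ⟨hs, hs'⟩, rfl⟩
    refine ⟨(h.vne om).symm, fun e => ?_, fun e => ?_⟩
    · grind
    · have := h.hp.inj om hi e; omega
  · intro d hd
    rcases hm' d hd with ⟨j, h3, h4, rfl⟩ | ⟨j, h3, h4, rfl⟩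
    · refine ⟨(h.symm.vne h4).symm, fun e => ?_, fun e => ?_⟩
      · grind
      · have := h.ne i j hi h4 e.symm; omega
    · refine ⟨(h.vne h4).symm, fun e => ?_, fun e => ?_⟩
      · grind
      · have := h.hp.inj h4 hi e; omega
lemma cov (h : Cy G B v a A p n q m) {x y : V} (hx : x ∈ A) (ha : G.Adj x y) :
    y = v ∨ (∃ i ≤ n, y = p i) ∨ ∃ j ≤ m, y = q j := by
  by_cases hy : y ∈ A
  · rcases (h.mA y).1 hy with ⟨i, hi, e⟩ | ⟨i, hi, e⟩
    · grind
    grind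
  · rcases h.nb x hx y ha hy with e | e | e
    · exact Or.inl e
    · grind
    grind
lemma nbp (h : Cy G B v a A p n q m) (hC : CP G) (hT : Tf G) {i : ℕ} (h0 : 0 < i) (hi : i < n) {y : V}
    (ha : G.Adj (p i) y) : y = p (i-1) ∨ y = p (i+1) := by
  rcases h.cov ((h.mA _).2 (Or.inl ⟨i, hi, rfl⟩)) ha with rfl | ⟨j, hj, rfl⟩ | ⟨j, hj, rfl⟩
  · have := h.v1 hC hT hi.le ha.symm; omega
  · rcases h.hp.adj hi.le hj ha with h1 | h1
    · grind
    grind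
  · rcases Nat.eq_zero_or_pos j with rfl | h1
    · rw [h.q0, ← h.p0] at ha ⊢
      have := h.hp.adj hi.le (Nat.zero_le _) ha
      grind
    · have := h.ch i j h0 hi.le h1 hj ha; omega
lemma nh (h : Cy G B v a A p n q m) (hC : CP G) (hT : Tf G) {x : V} (hx : x ∈ A) (hxa : x ≠ a) : ¬ Hv G x := by
  rcases (h.mA x).1 hx with ⟨i, hi, rfl⟩ | ⟨i, hi, rfl⟩
  · exact not_hv fun y hy => h.nbp hC hT (Nat.pos_of_ne_zero (by rintro rfl; exact hxa h.p0)) hi hy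
  · exact not_hv fun y hy => h.symm.nbp hC hT (Nat.pos_of_ne_zero (by rintro rfl; exact hxa h.q0)) hi hy
lemma va' (h : Cy G B v a A p n q m) (hC : CP G) (hT : Tf G) {x : V} (hx : x ∈ A) (ha : G.Adj v x) : x = a := by
  rcases (h.mA x).1 hx with ⟨i, hi, rfl⟩ | ⟨i, hi, rfl⟩
  · rw [h.v1 hC hT hi.le ha, h.p0]
  · rw [h.symm.v1 hC hT hi.le ha, h.q0]
lemma n2 [Finite V] (h : Cy G B v a A p n q m) (hC : CP G) (hT : Tf G) (hc : Crit G B c) : 2 ≤ n := by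
  by_contra hn
  have h1 := h.n1
  obtain rfl : n = 1 := om
  have haz : G.Adj a (p 1) := by have := h.hp.1 0 h1; rwa [h.p0] at this
  have hm1 : m ≠ 1 := by
    rintro rfl
    have := h.hq.1 0 h.m1
    rw [h.q0] at this
    exact hT a (p 1) (q 1) haz h.cl this
  have hm := h.m1
  set C : Set V := {x | x ∉ A ∧ x ≠ p 1 ∧ x ≠ q m} with hCd
  have hvC : v ∈ C := ⟨h.vA, h.vp, h.vq⟩
  set D := comp G C v with hD
  have hDC : D ⊆ C := comp_sub hvC
  have hDA : ∀ x ∈ D, ∀ y ∈ A, G.Adj x y → y = a := by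
    intro x hx y hy ha
    have h3 := hDC hx
    rcases h.nb y hy x ha.symm h3.1 with rfl | rfl | rfl
    · exact h.va' hC hT hy ha
    · grind
    grind
  by_cases ht : ∃ d ∈ D, G.Adj (q m) d
  · have hqA : ∀ s, s < m → q s ∈ A := fun s hs => (h.mA _).2 (Or.inr ⟨s, hs, rfl⟩)
    refine hC.use haz.symm h.cl (fun e => ?_) (h.hq.seg (i := 1) (j := m-1) om om) (comp_conn hvC) ?_ ?_ ?_
      ⟨q 1, mseg le_rfl om, by have := h.hq.1 0 h.m1; rwa [h.q0] at this⟩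
      ⟨q (m-1), mseg om le_rfl, h.hq.prev om le_rfl⟩ ⟨v, mem_comp_self, h.va.symm⟩ ht
    · exact h.symm.pnA (e ▸ h.aA)
    · rintro _ ⟨s, ⟨hs, hs'⟩, rfl⟩ y hy
      refine ⟨fun e => (hDC hy).1 (e ▸ hqA s om), fun e => ?_⟩
      have := h.hq.inj om (Nat.zero_le _) ((hDA y hy _ (hqA s om) e.symm).trans h.q0.symm)
      omega
    · rintro _ ⟨s, ⟨hs, hs'⟩, rfl⟩
      refine ⟨fun e => ?_, fun e => ?_, fun e => ?_⟩
      · have := h.ne 1 s le_rfl om e.symm; omega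
      · have := h.hq.inj om (Nat.zero_le _) (e.trans h.q0.symm); omega
      · have := h.hq.inj om le_rfl e; omega
    · intro d hd
      have := hDC hd
      exact ⟨this.2.1, fun e => this.1 (e ▸ h.aA), this.2.2⟩
  · have hN : ∀ x ∈ D, ∀ y, G.Adj x y → y ∉ D → y = a ∨ y = p 1 := by
      intro x hx y ha hy
      by_cases hyA : y ∈ A
      · grind
      · by_contra hn
        refine hy (comp_closed hx ha ⟨hyA, fun e => hn (Or.inr e), ?_⟩)
        rintro rfl; exact ht ⟨x, hx, ha.symm⟩
    have hcl : ∀ c1 c2, (c1 = a ∨ c1 = p 1) → (c2 = a ∨ c2 = p 1) → c1 = c2 ∨ G.Adj c1 c2 := by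
      rintro c1 c2 (rfl | rfl) (rfl | rfl)
      · exact Or.inl rfl
      · exact Or.inr haz
      · exact Or.inr haz.symm
      grind
    rcases small_or hc.1 (A := D) (A' := {x | x ∉ D ∧ x ≠ a ∧ x ≠ p 1}) (fun x hx y hy => ⟨fun e => hy.1 (e ▸ hx),
      fun e => (hN x hx y e hy.1).elim hy.2.1 hy.2.2⟩) with hs | hs
    · exact lemR0 hc hs mem_comp_self fun c1 ⟨h1, x, hx, h2⟩ c2 ⟨h3, y, hy, h4⟩ =>
        hcl _ _ (hN x hx c1 h2 h1) (hN y hy c2 h4 h3)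
    · have hN2 : ∀ w ∈ Nb G {x | x ∉ D ∧ x ≠ a ∧ x ≠ p 1}, w = a ∨ w = p 1 := by
        rintro w ⟨hw, x, hx, hxw⟩
        by_contra hn
        push Not at hn
        have hwD : w ∈ D := by grind
        exact (hN w hwD x hxw.symm hx.1).elim hx.2.1 hx.2.2
      exact lemR0 hc hs (a := q m) ⟨fun h' => (hDC h').2.2 rfl, fun e => h.symm.pnA (e ▸ h.aA), h.cl.ne'⟩
        fun c1 h1 c2 h2 => hcl _ _ (hN2 c1 h1) (hN2 c2 h2)
lemma hz [Finite V] (h : Cy G B v a A p n q m) (hc : Crit G B c) (h3 : 3 ≤ c) : Hv G (p n) := by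
  by_contra hn
  have hn1 := h.n1
  have hm := h.m1
  have hpA : p (n-1) ∈ A := (h.mA _).2 (Or.inl ⟨n-1, om, rfl⟩)
  have hz : ∀ y, G.Adj (p n) y → y = p (n-1) ∨ y = q m := by
    intro y hy
    by_contra h'
    push Not at h'
    exact hn ⟨y, _, _, h'.1, h'.2, fun e => h.symm.pnA (e ▸ hpA), hy, h.hp.prev hn1 le_rfl, h.cl⟩
  have hN : ∀ x ∈ insert (p n) A, ∀ y, G.Adj x y → y ∉ insert (p n) A → y = v ∨ y = q m := by
    rintro x (rfl | hx) y ha hy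
    · grind
    · rcases h.nb x hx y ha (fun h' => hy (Set.mem_insert_of_mem _ h')) with e | e | e
      · exact Or.inl e
      · grind
      · exact Or.inr e
  have hs : Small B (insert (p n) A) := by
    rcases small_or hc.1 (A := insert (p n) A) (A' := {x | x ∉ insert (p n) A ∧ x ≠ v ∧ x ≠ q m}) (fun x hx y hy =>
      ⟨fun e => hy.1 (e ▸ hx), fun e => (hN x hx y e hy.1).elim hy.2.1 hy.2.2⟩) with hs | hs
    · exact hs
    · refine (cover hc.1 (S := {v, p n, q m}) ((Set.ncard_insert_le _ _).trans ?_) ?_).elim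
      · have := Set.ncard_insert_le (p n) {q m}
        rw [Set.ncard_singleton] at this; omega
      · intro x hx
        simp only [Set.mem_insert_iff, Set.mem_singleton_iff, not_or] at hx ⊢
        by_cases hxA : x ∈ A
        · refine ⟨A, hxA, h.sm, fun y hy w ha => ?_⟩
          grind
        · refine ⟨_, ?_, hs, fun y hy w ha => ?_⟩
          · grind
          · by_contra hw
            simp only [Set.mem_setOf_eq, Set.mem_insert_iff] at hw
            have hwA : w ∈ A := by tauto
            have := hN w (Set.mem_insert_of_mem _ hwA) y ha.symm hy.1
            grind
  have := (lemR hc hs (Q := q '' Icc 0 (m-1)) (by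
    rintro _ ⟨s, ⟨_, hs⟩, rfl⟩
    exact Set.mem_insert_of_mem _ ((h.mA _).2 (Or.inr ⟨s, om, rfl⟩))) v (by
      rintro c1 ⟨h1, x, hx, h2⟩ c2 ⟨h3, y, hy, h4⟩
      grind) (fun _ => by
      refine ⟨h.hq.seg om om, ?_⟩
      rintro w ⟨h1, x, hx, h2⟩
      rcases hN x hx w h2 h1 with rfl | rfl
      · exact ⟨q 0, mseg le_rfl om, by rw [h.q0]; exact h.va.symm⟩
      · exact ⟨q (m-1), mseg om le_rfl, (h.hq.prev hm le_rfl).symm⟩) (p n) (Set.mem_insert _ _)).1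
  obtain ⟨s, ⟨_, hs⟩, e⟩ := this
  have := h.ne n s le_rfl om e.symm
  omega
end Cy
structure Ear (G : SimpleGraph V) (B : Set (Set V)) (v a z z' : V) (A T T' : Set V) : Prop where
  va : G.Adj v a
  zz : G.Adj z z'
  vA : v ∉ A
  zA : z ∉ A
  zA' : z' ∉ A
  sm : Small B A
  nb : ∀ x ∈ A, ∀ y, G.Adj x y → y ∉ A → y = v ∨ y = z ∨ y = z'
  ha : Hv G a
  hz : Hv G z
  hz' : Hv G z'
  nh : ∀ x ∈ A, x ≠ a → ¬ Hv G x
  va' : ∀ x ∈ A, G.Adj v x → x = a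
  na : ∀ y, G.Adj a y → y = v ∨ y ∈ A
  eq : A = insert a (T ∪ T')
  aT : a ∉ T
  aT' : a ∉ T'
  cT : Conn G T
  cT' : Conn G T'
  Tz : ∃ x ∈ T, G.Adj x z
  Tz' : ∃ x ∈ T', G.Adj x z'
  Ta : ∃ x ∈ T, G.Adj x a
  Ta' : ∃ x ∈ T', G.Adj x a
  un : ∀ x ∈ T, ∀ y ∈ T, G.Adj a x → G.Adj a y → x = y
lemma Cy.ear [Finite V] (h : Cy G B v a A p n q m) (hC : CP G) (hT : Tf G) (hc : Crit G B c) (h3 : 3 ≤ c)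
    (ha : Hv G a) : Ear G B v a (p n) (q m) A (p '' Icc 1 (n-1)) (q '' Icc 1 (m-1)) := by
  have hn := h.n2 hC hT hc
  have hm := h.symm.n2 hC hT hc
  have aT : ∀ s, 1 ≤ s → s ≤ n → p s ≠ a := fun s h1 h2 e => by
    have := h.hp.inj h2 (Nat.zero_le _) (e.trans h.p0.symm); omega
  have aT' : ∀ s, 1 ≤ s → s ≤ m → q s ≠ a := fun s h1 h2 e => by
    have := h.hq.inj h2 (Nat.zero_le _) (e.trans h.q0.symm); omega
  refine
    { va := h.va, zz := h.cl, vA := h.vA, zA := h.pnA, zA' := h.symm.pnA, sm := h.sm, nb := h.nb, ha := ha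
      hz := h.hz hc h3, hz' := h.symm.hz hc h3, nh := fun x => h.nh hC hT, va' := fun x => h.va' hC hT, na := ?_, eq := ?_
      aT := ?_, aT' := ?_, cT := h.hp.seg om om, cT' := h.hq.seg om om
      Tz := ⟨p (n-1), mseg om le_rfl, (h.hp.prev om le_rfl).symm⟩
      Tz' := ⟨q (m-1), mseg om le_rfl, (h.hq.prev om le_rfl).symm⟩
      Ta := ⟨p 1, mseg le_rfl om, by have := h.hp.1 0 h.n1; rw [h.p0] at this; exact this.symm⟩
      Ta' := ⟨q 1, mseg le_rfl om, by have := h.hq.1 0 h.m1; rw [h.q0] at this; exact this.symm⟩, un := ?_ }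
  · intro y hy
    by_contra hn'
    push Not at hn'
    rcases h.nb a h.aA y hy hn'.2 with rfl | rfl | rfl
    · exact hn'.1 rfl
    · rw [← h.p0] at hy; have := h.hp.adj (Nat.zero_le _) le_rfl hy; omega
    · rw [← h.q0] at hy; have := h.hq.adj (Nat.zero_le _) le_rfl hy; omega
  · ext x
    rw [h.mA]
    constructor
    · rintro (⟨i, hi, rfl⟩ | ⟨i, hi, rfl⟩) <;> rcases Nat.eq_zero_or_pos i with rfl | h0
      · exact Or.inl h.p0
      · grind
      · exact Or.inl h.q0
      grind
    · rintro (rfl | ⟨s, ⟨h1, h2⟩, rfl⟩ | ⟨s, ⟨h1, h2⟩, rfl⟩)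
      · exact Or.inl ⟨0, om, h.p0.symm⟩
      · grind
      grind
  · grind
  · grind
  · rintro _ ⟨s, ⟨h1, h2⟩, rfl⟩ _ ⟨t, ⟨h3, h4⟩, rfl⟩ e1 e2
    rw [← h.p0] at e1 e2
    have := h.hp.adj (Nat.zero_le _) om e1
    have := h.hp.adj (Nat.zero_le _) om e2
    grind
end Paper

namespace Paper
variable {V : Type} {G : SimpleGraph V} {B : Set (Set V)} {c : ℕ} {v a z z' : V} {A : Set V} {p q : ℕ → V} {n m : ℕ}
structure EP (G : SimpleGraph V) (B : Set (Set V)) (v a : V) (A : Set V) (z z' : V) : Prop where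
  va : G.Adj v a
  ha : Hv G a
  zz : z = z' ∨ G.Adj z z'
  aA : a ∈ A
  zA : z ∉ A
  zA' : z' ∉ A
  vA : v ∉ A
  sm : Small B A
  nb : ∀ x ∈ A, ∀ y, G.Adj x y → y ∉ A → y = v ∨ y = z ∨ y = z'
def EMin (G : SimpleGraph V) (v a : V) (A : Set V) : Prop :=
  ∀ A1 ⊆ A, ∀ z1 z1', (z1 = z1' ∨ G.Adj z1 z1') → a ∈ A1 → z1 ∉ A1 → z1' ∉ A1 →
    (∀ x ∈ A1, ∀ y, G.Adj x y → y ∉ A1 → y = v ∨ y = z1 ∨ y = z1') → A ⊆ A1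
lemma EP.min [Finite V] (h : EP G B v a A z z') : ∃ A z z', EP G B v a A z z' ∧ EMin G v a A := by
  induction hn : A.ncard using Nat.strong_induction_on generalizing A z z' with
  | _ n ih =>
    by_cases hm : EMin G v a A
    · grind
    · simp only [EMin, not_forall] at hm
      obtain ⟨A1, hA1, z1, z1', h1, h2, h3, h4, h5, h6⟩ := hm
      exact ih _ (hn ▸ Set.ncard_lt_ncard ⟨hA1, h6⟩ (Set.toFinite _)) ⟨h.va, h.ha, h1, h2, h3, h4, fun h' => h.vA (hA1 h'),
        h.sm.mono hA1, h5⟩ rfl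
lemma fan1 [Finite V] (h : EP G B v a A z z') (hm : EMin G v a A) (hc : Crit G B c) (hA : Conn G A) (s : V) (hs : s ≠ a) :
    ∃ C, Conn G C ∧ s ∉ C ∧ C ⊆ (A \ {a}) ∪ {z, z'} ∧ (∃ x ∈ C, G.Adj a x) ∧ (z ∈ C ∨ z' ∈ C) := by
  have haS : a ∈ A \ {s} := ⟨h.aA, hs.symm⟩
  set A1 := comp G (A \ {s}) a with hA1
  have hsub : A1 ⊆ A \ {s} := comp_sub haS
  by_cases hw : ∃ x ∈ A1, ∃ w, (w = z ∨ w = z') ∧ w ≠ s ∧ G.Adj x w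
  · obtain ⟨x, hx, w, hwz, hws, hxw⟩ := hw
    by_cases hxa : x = a
    · subst hxa
      refine ⟨{w}, conn_single _ _, fun e => hws e.symm, ?_, ⟨w, rfl, hxw⟩, ?_⟩
      · grind
      grind
    · have hxS : x ∈ A1 \ {a} := ⟨hx, hxa⟩
      have hsub2 := comp_sub (G := G) hxS
      obtain ⟨u, hu, t, ht, hu1, ht1, hut⟩ := (comp_conn (G := G) haS).edge (T := comp G (A1 \ {a}) x) ⟨x, hx, mem_comp_self⟩
        ⟨a, mem_comp_self, fun h' => (hsub2 h').2 rfl⟩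
      have hta : t = a := by
        by_contra hne
        exact ht1 (comp_closed hu1 hut ⟨ht, hne⟩)
      subst hta
      refine ⟨insert w (comp G (A1 \ {t}) x), (comp_conn hxS).ins ⟨x, mem_comp_self, hxw.symm⟩, ?_, ?_,
        ⟨u, Or.inr hu1, hut.symm⟩, ?_⟩
      · grind
      · grind
      grind
  · exfalso
    push Not at hw
    have hN : ∀ x ∈ A1, ∀ y, G.Adj x y → y ∉ A1 → y = v ∨ y = s := by
      intro x hx y hxy hy
      by_cases hys : y = s
      · exact Or.inr hys
      by_cases hyA : y ∈ A
      · exact absurd (comp_closed hx hxy ⟨hyA, hys⟩) hy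
      · rcases h.nb x (hsub hx).1 y hxy hyA with e | e | e
        · exact Or.inl e
        · grind
        grind
    have hAA : A ⊆ A1 := hm A1 (hsub.trans Set.diff_subset) s s (Or.inl rfl) mem_comp_self (fun h' => (hsub h').2 rfl)
      (fun h' => (hsub h').2 rfl) fun x hx y h1 h2 => (hN x hx y h1 h2).imp_right Or.inl
    have hN' : ∀ w ∈ Nb G A, w = v ∨ w = s := by
      rintro w ⟨h1, x, hx, h2⟩
      grind
    by_cases hsN : s ∈ Nb G A
    · obtain ⟨hsA, y, hy, hys⟩ := hsN
      obtain ⟨f, n, f0, fn, fC, hf, f1, f2⟩ := exists_path (A := {x | G.Adj v x}) (B := {x | G.Adj s x}) hA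
        ⟨a, h.aA, h.va⟩ ⟨y, hy, hys.symm⟩
      have hQ := lemR hc h.sm (Q := f '' Icc 0 n) (by grind) v (by
        grind) (fun _ => ⟨hf.seg (Nat.zero_le _) le_rfl, by
          intro w hw
          rcases hN' w hw with rfl | rfl
          · exact ⟨f 0, mseg le_rfl (Nat.zero_le _), G.adj_symm f0⟩
          · exact ⟨f n, mseg (Nat.zero_le _) le_rfl, G.adj_symm fn⟩⟩)
      obtain ⟨⟨i, ⟨_, hi⟩, e⟩, _⟩ := hQ a h.aA
      obtain rfl := f1 i hi (by rw [e]; exact h.va)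
      refine not_hv (s := v) (t := if n = 0 then s else f 1) (fun w hwa => ?_) h.ha
      by_cases hwA : w ∈ A
      · obtain ⟨⟨j, ⟨_, hj⟩, rfl⟩, _⟩ := hQ w hwA
        rw [← e] at hwa
        have := hf.adj (Nat.zero_le _) hj hwa
        grind
      · rcases hN' w ⟨hwA, a, h.aA, hwa⟩ with rfl | rfl
        · exact Or.inl rfl
        · have := f2 0 (Nat.zero_le _) (by rw [e]; exact hwa.symm)
          grind
    · refine lemR0 hc h.sm h.aA fun c1 h1 c2 h2 => Or.inl ?_
      grind
lemma fan [Finite V] (h : EP G B v a A z z') (hm : EMin G v a A) (hc : Crit G B c) (hA : Conn G A) :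
    ∃ P P', Conn G P ∧ Conn G P' ∧ Disjoint P P' ∧ z ∈ P ∧ z' ∈ P' ∧ P ⊆ (A \ {a}) ∪ {z, z'} ∧
      P' ⊆ (A \ {a}) ∪ {z, z'} ∧ (∃ x ∈ P, G.Adj a x) ∧ (∃ x ∈ P', G.Adj a x) := by
  set U := (A \ {a}) ∪ {z, z'} with hU
  obtain ⟨C, hC, hd⟩ : Lnk (rst G U) {x | x ∈ U ∧ G.Adj a x} {z, z'} 2 := by
    apply menger
    intro S hS
    obtain ⟨s, hs, hsS⟩ : ∃ s, s ≠ a ∧ ∀ x ∈ S, x = s ∨ x = a := by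
      rcases Set.ncard_le_one_iff_eq (Set.toFinite S) |>.1 om with rfl | ⟨s, rfl⟩
      · exact ⟨v, h.va.ne, by simp⟩
      · by_cases hs : s = a
        · exact ⟨v, h.va.ne, by simp [hs]⟩
        · exact ⟨s, hs, by simp⟩
    obtain ⟨C, h1, h2, h3, ⟨x, hx, hax⟩, h5⟩ := fan1 h hm hc hA s hs
    refine ⟨C, h1.rst h3, Set.disjoint_left.2 fun y hy hyS => ?_, ⟨x, hx, h3 hx, hax⟩, ?_⟩
    · rcases hsS y hyS with rfl | rfl
      · exact h2 hy
      · rcases h3 hy with h' | h'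
        · exact h'.2 rfl
        · rcases h' with rfl | rfl
          · exact h.zA h.aA
          · exact h.zA' h.aA
    · rcases h5 with h5 | h5
      · exact ⟨z, h5, by simp⟩
      · exact ⟨z', h5, by simp⟩
  have hs : ∀ i, C i ⊆ U := fun i => by
    obtain ⟨x, h1, h2⟩ := (hC i).2.1
    exact conn_rst (hC i).1 ⟨x, h1, h2.1⟩
  have hn : ∀ i, ∃ x ∈ C i, G.Adj a x := fun i => by
    obtain ⟨x, h1, h2⟩ := (hC i).2.1
    grind
  have hd := Set.disjoint_left.1 (hd 0 1 (by decide))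
  obtain ⟨x, hx, hx'⟩ := (hC 0).2.2
  obtain ⟨y, hy, hy'⟩ := (hC 1).2.2
  have hc := fun i => (hC i).1.mono rst_le
  rcases hx' with rfl | rfl <;> rcases hy' with rfl | rfl
  · exact absurd hy (hd hx)
  · exact ⟨C 0, C 1, hc 0, hc 1, Set.disjoint_left.2 hd, hx, hy, hs 0, hs 1, hn 0, hn 1⟩
  · exact ⟨C 1, C 0, hc 1, hc 0, (Set.disjoint_left.2 hd).symm, hy, hx, hs 1, hs 0, hn 1, hn 0⟩
  · exact absurd hy (hd hx)
end Paper

namespace Paper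
variable {V : Type} {G : SimpleGraph V} {B : Set (Set V)} {c : ℕ} {v a z z' : V} {A : Set V} {p q : ℕ → V} {n m : ℕ}
lemma chord (hC : CP G) (hp : IsP G p n) (hq : IsP G q m) (p0 : p 0 = a) (q0 : q 0 = a)
    (ne : ∀ i j, i ≤ n → j ≤ m → p i = q j → i = 0 ∧ j = 0)
    (mA : ∀ x, x ∈ A ↔ (∃ i < n, x = p i) ∨ ∃ j < m, x = q j)
    (nb : ∀ x ∈ A, ∀ y, G.Adj x y → y ∉ A → y = v ∨ y = p n ∨ y = q m) (hm : EMin G v a A)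
    (hR : ∀ Q ⊆ A, Conn G Q → a ∈ Q → (∃ x ∈ Q, G.Adj x (p n)) → (∃ x ∈ Q, G.Adj x (q m)) → A ⊆ Q) :
    ∀ i j, 1 ≤ i → i ≤ n → 1 ≤ j → j ≤ m → G.Adj (p i) (q j) → i = n ∧ j = m := by
  classical
  by_contra hno
  have hex : ∃ i, ∃ j, 1 ≤ i ∧ i ≤ n ∧ 1 ≤ j ∧ j ≤ m ∧ G.Adj (p i) (q j) ∧ ¬ (i = n ∧ j = m) := by grind
  obtain ⟨i, hi, hi0⟩ : ∃ i, (∃ j, 1 ≤ i ∧ i ≤ n ∧ 1 ≤ j ∧ j ≤ m ∧ G.Adj (p i) (q j) ∧ ¬ (i = n ∧ j = m)) ∧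
      ∀ i' < i, ¬ ∃ j, 1 ≤ i' ∧ i' ≤ n ∧ 1 ≤ j ∧ j ≤ m ∧ G.Adj (p i') (q j) ∧ ¬ (i' = n ∧ j = m) :=
    ⟨Nat.find hex, Nat.find_spec hex, fun i' h => Nat.find_min hex h⟩
  obtain ⟨j, ⟨hi1, hin, hj1, hjm, hij, hnm⟩, hj0⟩ : ∃ j, (1 ≤ i ∧ i ≤ n ∧ 1 ≤ j ∧ j ≤ m ∧ G.Adj (p i) (q j) ∧ ¬ (i = n ∧ j = m)) ∧
      ∀ j' < j, ¬ (1 ≤ i ∧ i ≤ n ∧ 1 ≤ j' ∧ j' ≤ m ∧ G.Adj (p i) (q j') ∧ ¬ (i = n ∧ j' = m)) :=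
    ⟨Nat.find hi, Nat.find_spec hi, fun i' h => Nat.find_min hi h⟩
  have hi0 : ∀ i' j', i' < i → 1 ≤ i' → 1 ≤ j' → j' ≤ m → ¬ G.Adj (p i') (q j') := fun i' j' h1 h2 h3 h4 h5 =>
    hi0 i' h1 ⟨j', h2, om, h3, h4, h5, om⟩
  have hj0 : ∀ j', j' < j → 1 ≤ j' → ¬ G.Adj (p i) (q j') := fun j' h1 h2 h3 =>
    hj0 j' h1 ⟨hi1, hin, h2, om, h3, om⟩
  have hcr : ∃ i2 j2, i < i2 ∧ i2 ≤ n ∧ 1 ≤ j2 ∧ j2 < j ∧ G.Adj (p i2) (q j2) := by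
    by_contra hcr
    push Not at hcr
    have hs : A ⊆ {x | (∃ s < i, x = p s) ∨ ∃ s < j, x = q s} := by
      have hpi : p i ∉ {x | (∃ s < i, x = p s) ∨ ∃ s < j, x = q s} := by
        rintro (⟨s, hs, e⟩ | ⟨s, hs, e⟩)
        · have := hp.inj hin om e; omega
        grind
      have hqj : q j ∉ {x | (∃ s < i, x = p s) ∨ ∃ s < j, x = q s} := by
        rintro (⟨s, hs, e⟩ | ⟨s, hs, e⟩)
        · grind
        · have := hq.inj hjm om e; omega
      refine hm _ ?_ (p i) (q j) (Or.inr hij) (Or.inl ⟨0, hi1, p0.symm⟩) hpi hqj ?_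
      · rintro x (⟨s, hs, rfl⟩ | ⟨s, hs, rfl⟩)
        · grind
        grind
      · intro x hx y hxy hy
        have hyc : y = v ∨ (∃ t ≤ n, y = p t) ∨ ∃ t ≤ m, y = q t := by
          have hxA : x ∈ A := by
            rcases hx with ⟨s, hs, rfl⟩ | ⟨s, hs, rfl⟩
            · grind
            grind
          by_cases hyA : y ∈ A
          · rcases (mA y).1 hyA with ⟨t, ht, e⟩ | ⟨t, ht, e⟩
            · grind
            grind
          grind
        rcases hyc with e | ⟨t, ht, rfl⟩ | ⟨t, ht, rfl⟩
        · exact Or.inl e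
        · have hti : i ≤ t := by grind
          right; left
          by_contra hne
          have hti' : t ≠ i := by grind
          have hps : ∀ s, s < i → ¬ G.Adj (p s) (p t) := fun s hs e => by
            have := hp.adj om ht e; omega
          rcases hx with ⟨s, hs, rfl⟩ | ⟨s, hs, rfl⟩
          · exact hps s hs hxy
          · rcases Nat.eq_zero_or_pos s with rfl | h0
            · grind
            · exact hcr t s om ht h0 hs hxy.symm
        · have htj : j ≤ t := by grind
          right; right
          have hqs : ∀ s, s < j → G.Adj (q s) (q t) → q t = q j := fun s hs e => by
            have := hq.adj om ht e
            rw [show t = j by omega]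
          rcases hx with ⟨s, hs, rfl⟩ | ⟨s, hs, rfl⟩
          · rcases Nat.eq_zero_or_pos s with rfl | h0
            · grind
            grind
          · exact hqs s hs hxy
    rcases Nat.lt_or_ge i n with h1 | h1
    · rcases hs ((mA (p i)).2 (Or.inl ⟨i, h1, rfl⟩)) with ⟨s, hs, e⟩ | ⟨s, hs, e⟩
      · have := hp.inj hin om e; omega
      · grind
    · rcases hs ((mA (q j)).2 (Or.inr ⟨j, om, rfl⟩)) with ⟨s, hs, e⟩ | ⟨s, hs, e⟩
      · have := ne s j om hjm e.symm; omega
      · have := hq.inj hjm om e; omega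
  have hst : ∀ i2 j2, i < i2 → i2 ≤ n → 1 ≤ j2 → j2 < j → G.Adj (p i2) (q j2) → i2 = i + 1 ∧ j2 + 1 = j := by
    intro i2 j2 h1 h2 h3 h4 h5
    have c0 : Conn G (p '' Icc 0 i ∪ q '' Icc 0 j2) := (hp.seg (Nat.zero_le _) hin).union (hq.seg (Nat.zero_le _) om)
      ⟨p 0, mseg le_rfl (Nat.zero_le _), q 0, mseg le_rfl (Nat.zero_le _), Or.inl (p0.trans q0.symm)⟩
    have c1 : ∃ Q, Conn G Q ∧ p '' Icc 0 i ∪ q '' Icc 0 j2 ⊆ Q ∧ (∃ x ∈ Q, G.Adj x (p n)) ∧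
        ∀ x ∈ Q, (∃ s, s < n ∧ (s ≤ i ∨ i2 ≤ s) ∧ x = p s) ∨ ∃ s, s ≤ j2 ∧ x = q s := by
      have hx0 : ∀ x ∈ p '' Icc 0 i ∪ q '' Icc 0 j2, (∃ s, s < n ∧ (s ≤ i ∨ i2 ≤ s) ∧ x = p s) ∨ ∃ s, s ≤ j2 ∧ x = q s := by
        rintro _ (⟨s, ⟨_, hs⟩, rfl⟩ | ⟨s, ⟨_, hs⟩, rfl⟩)
        · exact Or.inl ⟨s, om, Or.inl hs, rfl⟩
        grind
      rcases Nat.lt_or_ge i2 n with h6 | h6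
      · refine ⟨_, c0.union (hp.seg (i := i2) (j := n-1) om om) ⟨q j2, Or.inr (mseg (Nat.zero_le _) le_rfl), p i2,
          mseg le_rfl om, Or.inr h5.symm⟩, Set.subset_union_left,
          ⟨p (n-1), Or.inr (mseg om le_rfl), (hp.prev om le_rfl).symm⟩, ?_⟩
        rintro x (hx | ⟨s, ⟨hs, hs'⟩, rfl⟩)
        · exact hx0 x hx
        · exact Or.inl ⟨s, om, Or.inr hs, rfl⟩
      · exact ⟨_, c0, le_rfl, ⟨q j2, Or.inr (mseg (Nat.zero_le _) le_rfl), by rw [show n = i2 by omega]; exact h5.symm⟩, hx0⟩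
    obtain ⟨Q1, hQ1, hs1, ht1, hm1⟩ := c1
    have c2 : ∃ Q, Conn G Q ∧ Q1 ⊆ Q ∧ (∃ x ∈ Q, G.Adj x (q m)) ∧
        ∀ x ∈ Q, (∃ s, s < n ∧ (s ≤ i ∨ i2 ≤ s) ∧ x = p s) ∨ ∃ s, s < m ∧ (s ≤ j2 ∨ j ≤ s) ∧ x = q s := by
      have hx0 : ∀ x ∈ Q1, (∃ s, s < n ∧ (s ≤ i ∨ i2 ≤ s) ∧ x = p s) ∨ ∃ s, s < m ∧ (s ≤ j2 ∨ j ≤ s) ∧ x = q s := by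
        intro x hx
        exact (hm1 x hx).imp_right fun ⟨s, h, e⟩ => ⟨s, om, Or.inl h, e⟩
      have hpi : p i ∈ Q1 := hs1 (Or.inl (mseg (Nat.zero_le _) le_rfl))
      rcases Nat.lt_or_ge j m with h6 | h6
      · refine ⟨_, hQ1.union (hq.seg (i := j) (j := m-1) om om) ⟨p i, hpi, q j,
          mseg le_rfl om, Or.inr hij⟩, Set.subset_union_left,
          ⟨q (m-1), Or.inr (mseg om le_rfl), (hq.prev om le_rfl).symm⟩, ?_⟩
        rintro x (hx | ⟨s, ⟨hs, hs'⟩, rfl⟩)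
        · exact hx0 x hx
        · exact Or.inr ⟨s, om, Or.inr hs, rfl⟩
      grind
    obtain ⟨Q2, hQ2, hs2, ht2, hm2⟩ := c2
    have hAQ : A ⊆ Q2 := hR Q2 (fun x hx => by
      rcases hm2 x hx with ⟨s, h6, _, rfl⟩ | ⟨s, h6, _, rfl⟩
      · exact (mA _).2 (Or.inl ⟨s, h6, rfl⟩)
      grind) hQ2 (hs2 (hs1 (Or.inl ⟨0, ⟨le_rfl, Nat.zero_le _⟩, p0⟩)))
      (by obtain ⟨x, hx, h⟩ := ht1; exact ⟨x, hs2 hx, h⟩) ht2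
    constructor
    · by_contra h6
      rcases hm2 _ (hAQ ((mA (p (i+1))).2 (Or.inl ⟨i+1, om, rfl⟩))) with ⟨s, h7, h8, e⟩ | ⟨s, h7, h8, e⟩
      · have := hp.inj om om e; omega
      grind
    · by_contra h6
      rcases hm2 _ (hAQ ((mA (q (j2+1))).2 (Or.inr ⟨j2+1, om, rfl⟩))) with ⟨s, h7, h8, e⟩ | ⟨s, h7, h8, e⟩
      · grind
      · have := hq.inj om om e; omega
  obtain ⟨i2, j2, h1, h2, h3, h4, h5⟩ := hcr
  obtain ⟨rfl, rfl⟩ := hst i2 j2 h1 h2 h3 h4 h5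
  have nez : ∀ s t, s ≤ n → t ≤ m → 1 ≤ s ∨ 1 ≤ t → p s ≠ q t := fun s t h1 h2 h3 e => by
    have := ne s t h1 h2 e; omega
  refine hC.use (c := q (j2+1)) (x := p i) (y := q j2) (D := {p (i+1)}) (D' := p '' Icc 0 (i-1) ∪ q '' Icc 0 (j2-1))
    hij.symm (hq.1 j2 om).symm (nez _ _ hin om om) (conn_single _ _)
    ((hp.seg (Nat.zero_le _) om).union (hq.seg (Nat.zero_le _) om)
      ⟨p 0, mseg le_rfl (Nat.zero_le _), q 0, mseg le_rfl (Nat.zero_le _), Or.inl (p0.trans q0.symm)⟩) ?_ ?_ ?_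
    ⟨_, rfl, hp.1 i om⟩ ⟨_, rfl, h5.symm⟩ ⟨p (i-1), Or.inl (mseg (Nat.zero_le _) le_rfl), hp.prev hi1 hin⟩
    ⟨q (j2-1), Or.inr (mseg (Nat.zero_le _) le_rfl), hq.prev h3 om⟩
  · have hps : ∀ s, s < i → ¬ G.Adj (p (i+1)) (p s) := fun s hs e => by
      have := hp.adj h2 om e; omega
    rintro _ rfl _ (⟨s, ⟨_, hs⟩, rfl⟩ | ⟨s, ⟨_, hs⟩, rfl⟩)
    · exact ⟨fun e => by have := hp.inj h2 om e; omega, hps s om⟩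
    · refine ⟨nez _ _ h2 om om, fun e => ?_⟩
      rcases Nat.eq_zero_or_pos s with rfl | h0
      · grind
      · grind
  · grind
  · rintro _ (⟨s, ⟨_, hs⟩, rfl⟩ | ⟨s, ⟨_, hs⟩, rfl⟩)
    · exact ⟨nez _ _ om hjm om, fun e => by have := hp.inj om hin e; omega,
        nez _ _ om om om⟩
    · exact ⟨fun e => by have := hq.inj om hjm e; omega, (nez _ _ hin om om).symm,
        fun e => by have := hq.inj om om e; omega⟩
theorem ear_ex [Finite V] (hC : CP G) (hT : Tf G) (hc : Crit G B c) (h3 : 3 ≤ c) (h : EP G B v a A z z') :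
    ∃ z z' A T T', Ear G B v a z z' A T T' := by
  obtain ⟨A, z, z', h, hm⟩ := h.min
  have hA : Conn G A := by
    have : A = comp G A a := (hm (comp G A a) (comp_sub h.aA) z z' h.zz mem_comp_self (fun h' => h.zA (comp_sub h.aA h'))
      (fun h' => h.zA' (comp_sub h.aA h')) (fun x hx y hxy hy => h.nb x (comp_sub h.aA hx) y hxy
        fun hyA => hy (comp_closed hx hxy hyA))).antisymm (comp_sub h.aA)
    rw [this]; exact comp_conn h.aA
  obtain ⟨P, P', cP, cP', hd, hz, hz', hP, hP', ⟨x, hx, hax⟩, y, hy, hay⟩ := fan h hm hc hA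
  have hd := Set.disjoint_left.1 hd
  have hzz : G.Adj z z' := h.zz.resolve_left (by grind)
  have haz : a ≠ z := by rintro rfl; exact h.zA h.aA
  have haz' : a ≠ z' := by rintro rfl; exact h.zA' h.aA
  have key : ∀ (P : Set V) (z x : V), a ≠ z → Conn G P → z ∈ P → x ∈ P → G.Adj a x → ∃ p n, p 0 = a ∧ p n = z ∧ 1 ≤ n ∧
      IsP G p n ∧ (∀ i ≤ n, p i = a ∨ p i ∈ P) ∧ ∀ i ≤ n, p i = z → i = n := by
    intro P z x haz cP hz hx hax
    obtain ⟨p, n, p0, pn, h1, h2, h3, h4⟩ := exists_path (A := {a}) (B := {z}) (cP.ins ⟨x, hx, hax⟩) ⟨a, Or.inl rfl, rfl⟩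
      ⟨z, Or.inr hz, rfl⟩
    grind
  obtain ⟨p, n, p0, rfl, n1, hp, hpP, hpz⟩ := key P z x haz cP hz hx hax
  obtain ⟨q, m, q0, rfl, m1, hq, hqP, hqz⟩ := key P' z' y haz' cP' hz' hy hay
  have hpA : ∀ i < n, p i ∈ A := by
    intro i hi
    rcases hpP i hi.le with e | h'
    · rw [e]; exact h.aA
    · rcases hP h' with h1 | h1 | h1
      · exact h1.1
      · grind
      grind
  have hqA : ∀ i < m, q i ∈ A := by
    intro i hi
    rcases hqP i hi.le with e | h'
    · rw [e]; exact h.aA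
    · rcases hP' h' with h1 | h1 | h1
      · exact h1.1
      · grind
      grind
  have ne : ∀ i j, i ≤ n → j ≤ m → p i = q j → i = 0 ∧ j = 0 := by
    intro i j hi hj e
    have : p i = a := by grind
    exact ⟨hp.inj hi (Nat.zero_le _) (this.trans p0.symm), hq.inj hj (Nat.zero_le _) ((e.symm.trans this).trans q0.symm)⟩
  have hN : ∀ w ∈ Nb G A, w = v ∨ w = p n ∨ w = q m := by
    rintro w ⟨h1, x, hx, h2⟩; exact h.nb x hx w h2 h1
  have hR : ∀ Q ⊆ A, Conn G Q → a ∈ Q → (∃ x ∈ Q, G.Adj x (p n)) → (∃ x ∈ Q, G.Adj x (q m)) → A ⊆ Q := by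
    intro Q hQ cQ haQ h1 h2 x hx
    refine (lemR hc h.sm hQ v ?_ (fun _ => ⟨cQ, ?_⟩) x hx).1
    · intro c1 h1 c2 h2
      rcases hN c1 h1 with rfl | rfl | rfl <;> rcases hN c2 h2 with rfl | rfl | rfl <;> simp [hzz, hzz.symm]
    · intro w hw
      rcases hN w hw with rfl | rfl | rfl
      · exact ⟨a, haQ, h.va.symm⟩
      · exact h1
      · exact h2
  have mA : ∀ x, x ∈ A ↔ (∃ i < n, x = p i) ∨ ∃ j < m, x = q j := by
    intro x
    constructor
    · intro hx
      rcases hR (p '' Icc 0 (n-1) ∪ q '' Icc 0 (m-1)) (by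
        rintro _ (⟨s, ⟨_, hs⟩, rfl⟩ | ⟨s, ⟨_, hs⟩, rfl⟩)
        · exact hpA s om
        · exact hqA s om) ((hp.seg (Nat.zero_le _) om).union (hq.seg (Nat.zero_le _) om)
          ⟨p 0, mseg le_rfl (Nat.zero_le _), q 0, mseg le_rfl (Nat.zero_le _), Or.inl (p0.trans q0.symm)⟩)
          (Or.inl ⟨0, ⟨le_rfl, Nat.zero_le _⟩, p0⟩) ⟨p (n-1), Or.inl (mseg (Nat.zero_le _) le_rfl), (hp.prev n1 le_rfl).symm⟩
          ⟨q (m-1), Or.inr (mseg (Nat.zero_le _) le_rfl), (hq.prev m1 le_rfl).symm⟩ hx with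
        ⟨s, ⟨_, hs⟩, rfl⟩ | ⟨s, ⟨_, hs⟩, rfl⟩
      · grind
      grind
    · rintro (⟨s, hs, rfl⟩ | ⟨s, hs, rfl⟩)
      · exact hpA s hs
      · exact hqA s hs
  have hcl : ∀ w, (w = p n ∨ w = q m) → v ≠ w := by
    rintro w hw rfl
    refine lemR0 hc h.sm h.aA fun c1 h1 c2 h2 => ?_
    rcases hw with e | e <;> rw [e] at hN <;> rcases hN c1 h1 with rfl | rfl | rfl <;>
      rcases hN c2 h2 with rfl | rfl | rfl <;> simp [hzz, hzz.symm]
  exact ⟨_, _, _, _, _, Cy.ear { hp := hp, hq := hq, p0 := p0, q0 := q0, n1 := n1, m1 := m1, ne := ne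
                                 ch := chord hC hp hq p0 q0 ne mA h.nb hm hR, cl := hzz, mA := mA, va := h.va, vA := h.vA
                                 vp := hcl _ (Or.inl rfl), vq := hcl _ (Or.inr rfl), sm := h.sm, nb := h.nb } hC hT hc h3 h.ha⟩
end Paper

namespace Paper
variable {V : Type} {G : SimpleGraph V} {B : Set (Set V)} {c : ℕ} {v a z z' v2 a2 z2 z2' : V} {A T T' A2 T2 T2' : Set V}
def Ye (G : SimpleGraph V) (B : Set (Set V)) (a : V) : Prop := ∃ v z z' A T T', Ear G B v a z z' A T T'
def HS (G : SimpleGraph V) (B : Set (Set V)) (a : V) : Prop := Hv G a ∧ ¬ Ye G B a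
lemma hs_uniq [Finite V] (hC : CP G) (hT : Tf G) (hc : Crit G B c) (h3 : 3 ≤ c) {v a u : V} (hva : G.Adj v a)
    (hvu : G.Adj v u) (ha : HS G B a) (hu : HS G B u) : a = u := by
  by_contra hau
  obtain ⟨z, z', A, hz, haA, huA, huz, huz', hzA, hzA', hvA, hn⟩ := sep hC hT hva hvu hau
  rcases small_or hc.1 (A' := {x | x ∉ A ∧ x ≠ v ∧ x ≠ z ∧ x ≠ z'}) (fun x hx y hy => ⟨fun e => hy.1 (e ▸ hx), fun h => by
    grind⟩) with h | h
  · obtain ⟨z, z', A, T, T', h⟩ := ear_ex hC hT hc h3 ⟨hva, ha.1, hz, haA, hzA, hzA', hvA, h, hn⟩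
    exact ha.2 ⟨v, z, z', A, T, T', h⟩
  · obtain ⟨z, z', A, T, T', h⟩ := ear_ex hC hT hc h3 (z := z) (z' := z') (A := {x | x ∉ A ∧ x ≠ v ∧ x ≠ z ∧ x ≠ z'}) ⟨hvu, hu.1, hz, ⟨huA, hvu.ne', huz, huz'⟩,
      fun h => h.2.2.1 rfl, fun h => h.2.2.2 rfl, fun h => h.2.1 rfl, h, fun x hx y hxy hy => by
        by_contra hne
        push Not at hne
        have hyA : y ∈ A := by grind
        have := hn y hyA x hxy.symm hx.1
        grind⟩
    exact hu.2 ⟨v, z, z', A, T, T', h⟩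
namespace Ear
lemma aA (h : Ear G B v a z z' A T T') : a ∈ A := by rw [h.eq]; exact Or.inl rfl
lemma hnA (h : Ear G B v a z z' A T T') {x : V} (hx : Hv G x) (hA : x ∈ A) : x = a := by
  by_contra hne; exact h.nh x hA hne hx
lemma hN (h : Ear G B v a z z' A T T') {x : V} (hx : Hv G x) (hA : G.Adj a x) : x = v :=
  (h.na x hA).resolve_right fun h' => hA.ne' (h.hnA hx h')
lemma zY1 [Finite V] (hc : Crit G B c) (h4 : 4 ≤ c) (h : Ear G B v a z z' A T T') {R R' : Set V} {y y' : V}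
    (hs : (y = z ∧ y' = z' ∧ R = T ∧ R' = T') ∨ (y = z' ∧ y' = z ∧ R = T' ∧ R' = T)) : ¬ Ye G B y := by
  rintro ⟨v2, z2, z2', A2, T2, T2', h2⟩
  have hT : T ⊆ A := by rw [h.eq]; grind
  have hT' : T' ⊆ A := by rw [h.eq]; grind
  have fin : ∀ P : Prop, (R ⊆ A → R' ⊆ A → a ∉ R → Conn G R → Conn G R' → (∃ x ∈ R, G.Adj x y) → (∃ x ∈ R, G.Adj x a) →
      (∃ x ∈ R', G.Adj x y') → (∃ x ∈ R', G.Adj x a) → G.Adj y y' → Hv G y' → y ∉ A → y' ∉ A →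
      (∀ x ∈ A, ∀ w, G.Adj x w → w ∉ A → w = v ∨ w = y ∨ w = y') → P) → P := by
    intro P hP
    rcases hs with ⟨rfl, rfl, rfl, rfl⟩ | ⟨rfl, rfl, rfl, rfl⟩
    · exact hP hT hT' h.aT h.cT h.cT' h.Tz h.Ta h.Tz' h.Ta' h.zz h.hz' h.zA h.zA' h.nb
    · exact hP hT' hT h.aT' h.cT' h.cT h.Tz' h.Ta' h.Tz h.Ta h.zz.symm h.hz h.zA' h.zA fun x hx w h1 h2 => by
        have := h.nb x hx w h1 h2; tauto
  apply fin
  intro hR hR' haR cR cR' ⟨x, hx, hxy⟩ ⟨t, ht, hta⟩ hR1 ⟨s, hs1, hs2⟩ hyy hv' hyA hyA' hn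
  obtain rfl := h2.hN hv' hyy
  have hxA := (h2.na x hxy.symm).resolve_left fun e => hyA' (e ▸ hR hx)
  have hnR : ∀ w, Hv G w → w ∉ R := fun w hw hwR => haR (h.hnA hw (hR hwR) ▸ hwR)
  have htA : t ∈ A2 := sep_conn h2.nb cR (fun h' => hyA' (hR h')) (hnR _ h2.hz) (hnR _ h2.hz') hx hxA ht
  have haA : a ∉ A2 := fun h' => hyA (h2.hnA h.ha h' ▸ h.aA)
  have hvA : v ∉ A2 ∧ ∀ x ∈ A2, ∀ w, G.Adj x w → w ∉ A2 → w = y' ∨ w = a ∨ w = v := by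
    rcases h2.nb t htA a hta haA with e | rfl | rfl
    · exact absurd h.aA (e ▸ hyA')
    · obtain rfl := h.hN h2.hz' h2.zz
      exact ⟨h2.zA', h2.nb⟩
    · obtain rfl := h.hN h2.hz h2.zz.symm
      exact ⟨h2.zA, fun x hx w h3 h4 => by have := h2.nb x hx w h3 h4; tauto⟩
  obtain ⟨hvA, hn2⟩ := hvA
  have hnB : ∀ x ∈ A ∪ A2, ∀ w, G.Adj x w → w ∉ A ∪ A2 → w = v ∨ w = y' := by
    rintro x hx w hw hwA
    rw [Set.mem_union, not_or] at hwA
    rcases hx with hx | hx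
    · rcases hn x hx w hw hwA.1 with e | rfl | e
      · exact Or.inl e
      · exact absurd h2.aA hwA.2
      · exact Or.inr e
    · rcases hn2 x hx w hw hwA.2 with e | rfl | e
      · exact Or.inr e
      · exact absurd h.aA hwA.1
      · exact Or.inl e
  have hnb : ∀ w ∈ Nb G (A ∪ A2), w = v ∨ w = y' := fun w ⟨h1, x, hx, h2⟩ => hnB x hx w h2 h1
  rcases small_or hc.1 (A := A ∪ A2) (A' := {x | x ∉ A ∪ A2 ∧ x ≠ v ∧ x ≠ y'}) (fun x hx w hw =>
    ⟨fun e => hw.1 (e ▸ hx), fun h => by grind⟩) with h5 | h5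
  · have : y ∈ insert a R' := (lemR hc h5 (Q := insert a R') (Set.insert_subset (Or.inl h.aA) fun x hx => Or.inl (hR' hx)) v
      (fun c1 h1 c2 h2 => by
        grind)
      (fun _ => ⟨cR'.ins ⟨s, hs1, hs2.symm⟩, fun w hw => by
        rcases hnb w hw with rfl | rfl
        · exact ⟨a, Or.inl rfl, h.va.symm⟩
        grind⟩) y (Or.inr h2.aA)).1
    rcases this with e | h'
    · exact hyA (e ▸ h.aA)
    grind
  · refine cover hc.1 (S := {v, y, y', a}) ?_ fun x hx => ?_
    · exact (Set.ncard_insert_le _ _).trans (by have := Set.ncard_insert_le y {y', a}; have := Set.ncard_insert_le y' {a}; have := Set.ncard_singleton a; omega)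
    · simp only [Set.mem_insert_iff, Set.mem_singleton_iff, not_or] at hx ⊢
      by_cases h6 : x ∈ A
      · exact ⟨A, h6, h.sm, fun w hw t ht => by grind⟩
      by_cases h7 : x ∈ A2
      · exact ⟨A2, h7, h2.sm, fun w hw t ht => by grind⟩
      refine ⟨{x | x ∉ A ∪ A2 ∧ x ≠ v ∧ x ≠ y'}, ⟨fun h' => h'.elim h6 h7, hx.1, hx.2.2.1⟩, h5, fun w hw t ht => ?_⟩
      by_contra h8
      push Not at h8
      have : t ∈ A ∪ A2 := by grind
      have := hnB t this w ht.symm hw.1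
      grind
lemma zY [Finite V] (hc : Crit G B c) (h4 : 4 ≤ c) (h : Ear G B v a z z' A T T') : HS G B z ∧ HS G B z' :=
  ⟨⟨h.hz, h.zY1 hc h4 (Or.inl ⟨rfl, rfl, rfl, rfl⟩)⟩, h.hz', h.zY1 hc h4 (Or.inr ⟨rfl, rfl, rfl, rfl⟩)⟩
lemma F [Finite V] (hc : Crit G B c) (h4 : 4 ≤ c) (h : Ear G B v a z z' A T T') (h2 : Ear G B v2 a2 z2 z2' A2 T2 T2')
    (hne : a ≠ a2) (hv : v2 ∈ A) : v2 = a ∧ v = a2 := by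
  have hY : Ye G B a2 := ⟨_, _, _, _, _, _, h2⟩
  have haA : a2 ∉ A := fun h' => hne (h.hnA h2.ha h').symm
  have : v2 = a := by
    rcases h.nb v2 hv a2 h2.va haA with rfl | rfl | rfl
    · exact h.va' _ hv h2.va.symm
    · exact absurd hY (h.zY hc h4).1.2
    · exact absurd hY (h.zY hc h4).2.2
  subst this
  exact ⟨rfl, (h.hN h2.ha h2.va).symm⟩
lemma zn [Finite V] (hc : Crit G B c) (h4 : 4 ≤ c) (h : Ear G B v a z z' A T T') (h2 : Ear G B v2 a2 z2 z2' A2 T2 T2') :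
    z2 ∉ A ∧ z2' ∉ A := by
  have hY : Ye G B a := ⟨_, _, _, _, _, _, h⟩
  exact ⟨fun h' => (h2.zY hc h4).1.2 (h.hnA h2.hz h' ▸ hY), fun h' => (h2.zY hc h4).2.2 (h.hnA h2.hz' h' ▸ hY)⟩
lemma dj [Finite V] (hc : Crit G B c) (h4 : 4 ≤ c) (h : Ear G B v a z z' A T T') (h2 : Ear G B v2 a2 z2 z2' A2 T2 T2')
    {x : V} (hx : x ∈ A) (hx2 : x ∈ A2) : a = a2 := by
  by_contra hne
  obtain ⟨hz, hz'⟩ := h.zn hc h4 h2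
  have hsub : ∀ R ⊆ A, Conn G R → v2 ∉ R → x ∈ R → R ⊆ A2 := fun R hR cR hv hx y hy =>
    sep_conn h2.nb cR hv (fun h => hz (hR h)) (fun h => hz' (hR h)) hx hx2 hy
  have hn : ∀ y, y ∈ A → y ∉ A2 ∨ y ≠ a := fun y hy => by
    by_contra! h'
    exact hne (h2.hnA h.ha (h'.2 ▸ h'.1))
  by_cases hv : v2 ∈ A
  · obtain ⟨rfl, rfl⟩ := h.F hc h4 h2 hne hv
    have : ∀ R, R ⊆ A → v2 ∉ R → Conn G R → (∃ y ∈ R, G.Adj y v2) → x ∉ R := by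
      rintro R hR hvR cR ⟨y, hy, hy2⟩ hxR
      have e := h2.va' y (hsub R hR cR hvR hxR hy) hy2.symm
      exact hvR (h.hnA (e ▸ h2.ha) (hR hy) ▸ hy)
    have hx' := hx
    rw [h.eq] at hx'
    rcases hx' with rfl | h' | h'
    · exact h2.vA hx2
    · exact this T (by rw [h.eq]; grind) h.aT h.cT h.Ta h'
    · exact this T' (by rw [h.eq]; grind) h.aT' h.cT' h.Ta' h'
  · have cA : Conn G A := by
      obtain ⟨y, h1, h1'⟩ := h.Ta
      obtain ⟨y', h2, h2'⟩ := h.Ta'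
      have := (h.cT.ins ⟨y, h1, h1'.symm⟩).union (h.cT'.ins ⟨y', h2, h2'.symm⟩) ⟨a, Or.inl rfl, a, Or.inl rfl, Or.inl rfl⟩
      convert this using 1
      rw [h.eq]; grind
    exact (hn a h.aA).elim (fun h' => h' (hsub A subset_rfl cA hv hx h.aA)) (fun h' => h' rfl)
end Ear
end Paper

namespace Paper
variable {V : Type} {G : SimpleGraph V} {B : Set (Set V)} {c : ℕ} {I : Set V} {v z z' : V → V} {A K : V → Set V} {rep : V → Set V}
def Uu (I : Set V) (A K : V → Set V) : Set V := {x | (∀ a ∈ I, x ∉ A a) ∨ ∃ a ∈ I, x ∈ K a}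
structure St (G : SimpleGraph V) (B : Set (Set V)) (I : Set V) (v z z' : V → V) (A K : V → Set V) (rep : V → Set V) : Prop where
  dj : ∀ a ∈ I, ∀ b ∈ I, ∀ x ∈ A a, x ∈ A b → a = b
  vA : ∀ a ∈ I, ∀ b ∈ I, v a ∉ A b
  zA : ∀ a ∈ I, ∀ b ∈ I, z a ∉ A b
  zA' : ∀ a ∈ I, ∀ b ∈ I, z' a ∉ A b
  nb : ∀ a ∈ I, ∀ x ∈ A a, ∀ y, G.Adj x y → y ∉ A a → y = v a ∨ y = z a ∨ y = z' a
  sm : ∀ a ∈ I, Small B (A a)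
  KA : ∀ a ∈ I, K a ⊆ A a
  cK : ∀ a ∈ I, Conn G (K a)
  Kv : ∀ a ∈ I, ∃ q ∈ K a, G.Adj (v a) q
  Kz : ∀ a ∈ I, ∃ q ∈ K a, G.Adj q (z a)
  rz : ∀ a ∈ I, rep (z a) = rep (z' a)
  cl : ∀ x y, rep x = rep y → x = y ∨ G.Adj x y
  hv : ∀ x y, G.Adj x y → Hv (rst G (Uu I A K)) x → Hv (rst G (Uu I A K)) y →
    (∀ a ∈ I, x ∉ A a) ∧ (∀ a ∈ I, y ∉ A a) ∧ rep x = rep y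
lemma st_ex [Finite V] (hC : CP G) (hT : Tf G) (hc : Crit G B c) (h4 : 4 ≤ c) : ∃ I v z z' A K rep, St G B I v z z' A K rep := by
  classical
  obtain ⟨n, ⟨e⟩⟩ := Finite.exists_equiv_fin V
  have : ∀ a, ∃ d : V × V × V × Set V × Set V × Set V, Ye G B a → Ear G B d.1 a d.2.1 d.2.2.1 d.2.2.2.1 d.2.2.2.2.1 d.2.2.2.2.2 := by
    intro a
    by_cases h : Ye G B a
    · obtain ⟨v, z, z', A, T, T', h⟩ := h
      exact ⟨(v, z, z', A, T, T'), fun _ => h⟩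
    · exact ⟨(a, a, a, ∅, ∅, ∅), fun h' => absurd h' h⟩
  choose d hd using this
  set v := fun a => (d a).1
  set z := fun a => (d a).2.1
  set z' := fun a => (d a).2.2.1
  set A := fun a => (d a).2.2.2.1
  set T := fun a => (d a).2.2.2.2.1
  set T' := fun a => (d a).2.2.2.2.2
  replace hd : ∀ a, Ye G B a → Ear G B (v a) a (z a) (z' a) (A a) (T a) (T' a) := hd
  set I : Set V := {a | Ye G B a ∧ (Ye G B (v a) → e a < e (v a))} with hI
  set rep : V → Set V := fun x => {y | y = x ∨ (HS G B x ∧ HS G B y ∧ G.Adj x y)} with hrep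
  have hu : ∀ {x y w}, G.Adj x y → G.Adj x w → HS G B y → HS G B w → y = w := hs_uniq hC hT hc om
  have hr : ∀ x y, G.Adj x y → HS G B x → HS G B y → rep x = rep y := by
    have key : ∀ x y, G.Adj x y → HS G B x → HS G B y → rep x ⊆ rep y := by
      rintro x y h hx hy w (rfl | ⟨h1, h2, h3⟩)
      · exact Or.inr ⟨hy, hx, h.symm⟩
      grind
    exact fun x y h hx hy => (key x y h hx hy).antisymm (key y x h.symm hy hx)
  have hKA : ∀ a ∈ I, insert a (T a) ⊆ A a := fun a ha => by
    have := (hd a ha.1).eq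
    grind
  have hdj : ∀ a ∈ I, ∀ b ∈ I, ∀ x ∈ A a, x ∈ A b → a = b := fun a ha b hb x h1 h2 => (hd a ha.1).dj hc h4 (hd b hb.1) h1 h2
  refine ⟨I, v, z, z', A, fun a => insert a (T a), rep, ?_⟩
  have hV0 : ∀ x, Hv (rst G (Uu I A fun a => insert a (T a))) x → (∀ a ∈ I, x ∉ A a) ∧ Hv G x := by
    rintro x hx
    have hxG : Hv G x := by
      obtain ⟨y1, y2, y3, h1, h2, h3, a1, a2, a3⟩ := hx
      exact ⟨y1, y2, y3, h1, h2, h3, a1.1, a2.1, a3.1⟩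
    refine ⟨fun a ha hxA => ?_, hxG⟩
    have E := hd a ha.1
    obtain rfl := E.hnA hxG hxA
    obtain ⟨t, ht, hta⟩ := E.Ta
    refine not_hv (s := v x) (t := t) (fun y hy => ?_) hx
    rcases E.na y hy.1 with h | h
    · exact Or.inl h
    · rcases hy.2.2 with h' | ⟨b, hb, hyb⟩
      · grind
      · obtain rfl := hdj x ha b hb y h (hKA b hb hyb)
        rcases hyb with rfl | hyb
        · exact absurd hy.1 (G.irrefl)
        · exact Or.inr (E.un _ hyb _ ht hy.1 hta.symm)
  have hnI : ∀ x y, G.Adj x y → Ye G B x → (∀ a ∈ I, x ∉ A a) → Hv G y → y = v x ∧ Ye G B y ∧ ¬ e x < e y := by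
    intro x y hxy hx hxI hy
    obtain rfl := (hd x hx).hN hy hxy
    grind
  exact {
    dj := hdj
    vA := fun a ha b hb h => by
      by_cases hab : b = a
      · subst hab; exact (hd b hb.1).vA h
      · obtain ⟨h1, h2⟩ := (hd b hb.1).F hc h4 (hd a ha.1) hab h
        grind
    zA := fun a ha b hb => ((hd b hb.1).zn hc h4 (hd a ha.1)).1
    zA' := fun a ha b hb => ((hd b hb.1).zn hc h4 (hd a ha.1)).2
    nb := fun a ha => (hd a ha.1).nb
    sm := fun a ha => (hd a ha.1).sm
    KA := hKA
    cK := fun a ha => (hd a ha.1).cT.ins (by obtain ⟨t, h1, h2⟩ := (hd a ha.1).Ta; exact ⟨t, h1, h2.symm⟩)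
    Kv := fun a ha => ⟨a, Or.inl rfl, (hd a ha.1).va⟩
    Kz := fun a ha => by obtain ⟨t, h1, h2⟩ := (hd a ha.1).Tz; exact ⟨t, Or.inr h1, h2⟩
    rz := fun a ha => hr _ _ (hd a ha.1).zz ((hd a ha.1).zY hc h4).1 ((hd a ha.1).zY hc h4).2
    cl := fun x y h => by
      have : y ∈ rep x := h ▸ Or.inl rfl
      grind
    hv := fun x y hxy hx hy => by
      obtain ⟨hx0, hx⟩ := hV0 x hx
      obtain ⟨hy0, hy⟩ := hV0 y hy
      refine ⟨hx0, hy0, ?_⟩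
      have h1 := fun h => hnI x y hxy h hx0 hy
      have h2 := fun h => hnI y x hxy.symm h hy0 hx
      by_cases hxY : Ye G B x
      · obtain ⟨_, h3, h4⟩ := h1 hxY
        obtain ⟨_, _, h5⟩ := h2 h3
        exact absurd (e.injective (le_antisymm (not_lt.1 h5) (not_lt.1 h4))) hxy.ne
      · by_cases hyY : Ye G B y
        · grind
        · exact hr x y hxy ⟨hx, hxY⟩ ⟨hy, hyY⟩ }
open Classical in
noncomputable def sg (I : Set V) (v z : V → V) (A : V → Set V) (rep : V → Set V) (P : Set V) (x : V) : Set V :=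
  if h : ∃ a ∈ I, x ∈ A a then (if v h.choose ∈ P then rep (v h.choose) else rep (z h.choose)) else rep x
def Gh (G : SimpleGraph V) (U : Set V) (τ : V → Set V) : SimpleGraph (Set V) where
  Adj κ κ' := κ ≠ κ' ∧ ∃ x ∈ U, ∃ y ∈ U, G.Adj x y ∧ τ x = κ ∧ τ y = κ'
  symm := ⟨fun κ κ' ⟨h, x, hx, y, hy, h1, h2, h3⟩ => ⟨h.symm, y, hy, x, hx, h1.symm, h3, h2⟩⟩
  loopless := ⟨fun _ h => h.1 rfl⟩
namespace St
lemma out (x : V) (hx : ∀ a ∈ I, x ∉ A a) (P : Set V) : sg I v z A rep P x = rep x := by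
  rw [sg, dif_neg]; grind
lemma inn (h : St G B I v z z' A K rep) {x a : V} (ha : a ∈ I) (hx : x ∈ A a) (P : Set V) :
    (v a ∈ P → sg I v z A rep P x = rep (v a)) ∧ (v a ∉ P → sg I v z A rep P x = rep (z a)) := by
  have hex : ∃ a ∈ I, x ∈ A a := ⟨a, ha, hx⟩
  have e : hex.choose = a := h.dj _ hex.choose_spec.1 a ha x hex.choose_spec.2 hx
  rw [sg, dif_pos hex, e]
  grind
lemma weak (h : St G B I v z z' A K rep) {x y : V} (hxy : x = y ∨ G.Adj x y) (P P' : Set V) :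
    sg I v z A rep P x = sg I v z A rep P' y ∨
      (Gh G (Uu I A K) (sg I v z A rep Set.univ)).Adj (sg I v z A rep P x) (sg I v z A rep P' y) := by
  set H := Gh G (Uu I A K) (sg I v z A rep Set.univ)
  have key : ∀ a ∈ I, ∀ κ κ', (κ = rep (v a) ∨ κ = rep (z a)) → (κ' = rep (v a) ∨ κ' = rep (z a)) → κ = κ' ∨ H.Adj κ κ' := by
    intro a ha κ κ' h1 h2
    by_cases e : κ = κ'
    · exact Or.inl e
    refine Or.inr ?_
    have : κ ≠ κ' → κ = rep (v a) → κ' = rep (z a) → H.Adj κ κ' := by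
      rintro h3 rfl rfl
      obtain ⟨q, hq, hqz⟩ := h.Kz a ha
      exact ⟨h3, q, Or.inr ⟨a, ha, hq⟩, z a, Or.inl fun b hb => h.zA a ha b hb, hqz, (h.inn ha (h.KA a ha hq) _).1 trivial,
        out _ (h.zA a ha) _⟩
    rcases h1 with rfl | rfl <;> rcases h2 with rfl | rfl
    · grind
    · grind
    · have := h.Kz a ha
      obtain ⟨q, hq, hqz⟩ := this
      exact ⟨e, z a, Or.inl fun b hb => h.zA a ha b hb, q, Or.inr ⟨a, ha, hq⟩, hqz.symm, out _ (h.zA a ha) _,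
        (h.inn ha (h.KA a ha hq) _).1 trivial⟩
    grind
  have hin : ∀ a ∈ I, ∀ x ∈ A a, ∀ P, sg I v z A rep P x = rep (v a) ∨ sg I v z A rep P x = rep (z a) := by
    intro a ha x hx P
    by_cases hP : v a ∈ P
    · exact Or.inl ((h.inn ha hx P).1 hP)
    · exact Or.inr ((h.inn ha hx P).2 hP)
  have hnb : ∀ a ∈ I, ∀ x ∈ A a, ∀ y, (x = y ∨ G.Adj x y) → ∀ P, sg I v z A rep P y = rep (v a) ∨ sg I v z A rep P y = rep (z a) := by
    intro a ha x hx y hxy P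
    by_cases hy : y ∈ A a
    · grind
    rcases hxy with rfl | hxy
    · grind
    rcases h.nb a ha x hx y hxy hy with rfl | rfl | rfl
    · exact Or.inl (out _ (h.vA a ha) _)
    · exact Or.inr (out _ (h.zA a ha) _)
    · exact Or.inr ((out _ (h.zA' a ha) _).trans (h.rz a ha).symm)
  by_cases hx : ∃ a ∈ I, x ∈ A a
  · grind
  by_cases hy : ∃ a ∈ I, y ∈ A a
  · obtain ⟨a, ha, hy⟩ := hy
    exact key a ha _ _ (hnb a ha y hy x (hxy.imp Eq.symm fun h => h.symm) P) (hin a ha y hy P')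
  push Not at hx hy
  rw [out x hx, out y hy]
  rcases hxy with rfl | hxy
  · exact Or.inl rfl
  by_cases e : rep x = rep y
  · exact Or.inl e
  · exact Or.inr ⟨e, x, Or.inl hx, y, Or.inl hy, hxy, out x hx _, out y hy _⟩
lemma bram [Finite V] (h : St G B I v z z' A K rep) (hT : Tf G) {m : ℕ} (hB : Bram G B c) (hm : 2 * m ≤ c) :
    ∃ B', Bram (Gh G (Uu I A K) (sg I v z A rep Set.univ)) B' m := by
  refine ⟨(fun X => sg I v z A rep X '' X) '' B, ?_, ?_, ?_⟩
  · rintro _ ⟨X, hX, rfl⟩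
    have cX := hB.1 X hX
    refine ⟨cX.1.image _, ?_⟩
    rintro P ⟨_, ⟨x, hx, rfl⟩, hP⟩ hcl _ ⟨y, hy, rfl⟩
    refine cX.2 (fun y => P (sg I v z A rep X y)) ⟨x, hx, hP⟩ (fun s hs t ht hst hP => ?_) y hy
    rcases h.weak (Or.inr hst) X X with e | h'
    · exact e ▸ hP
    grind
  · rintro _ ⟨X, hX, rfl⟩ _ ⟨Y, hY, rfl⟩
    obtain ⟨x, hx, y, hy, hxy⟩ := hB.2.1 X hX Y hY
    exact ⟨_, ⟨x, hx, rfl⟩, _, ⟨y, hy, rfl⟩, h.weak hxy X Y⟩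
  · intro S hS
    have hcard : {x | rep x ∈ S}.ncard ≤ c := by
      have h2 : ∀ κ : Set V, {x | rep x = κ}.ncard ≤ 2 := by
        intro κ
        by_contra! h3
        obtain ⟨x, hx, y, hy, w, hw, h1, h2, h3⟩ := (Set.two_lt_ncard (Set.toFinite _)).1 h3
        have a1 := (h.cl x y (hx.trans hy.symm)).resolve_left h1
        have a2 := (h.cl x w (hx.trans hw.symm)).resolve_left h2
        have a3 := (h.cl y w (hy.trans hw.symm)).resolve_left h3
        exact hT x y w a1 a3 a2
      have : ∀ S : Set (Set V), S.Finite → {x | rep x ∈ S}.ncard ≤ 2 * S.ncard := by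
        intro S hS
        induction S, hS using Set.Finite.induction_on with
        | empty => simp
        | @insert κ S hκ hS ih =>
          rw [Set.ncard_insert_of_notMem hκ hS]
          have e : {x | rep x ∈ insert κ S} = {x | rep x = κ} ∪ {x | rep x ∈ S} := by ext; simp
          rw [e]
          have := Set.ncard_union_le {x | rep x = κ} {x | rep x ∈ S}
          have := h2 κ
          omega
      have := this S (Set.toFinite _)
      omega
    obtain ⟨X, hX, hd⟩ := hB.2.2 _ hcard
    rw [Set.disjoint_left] at hd
    refine ⟨_, ⟨X, hX, rfl⟩, Set.disjoint_left.2 ?_⟩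
    rintro _ ⟨x, hx, rfl⟩ hS
    by_cases hxA : ∃ a ∈ I, x ∈ A a
    · obtain ⟨a, ha, hxA⟩ := hxA
      by_cases hv : v a ∈ X
      · rw [(h.inn ha hxA X).1 hv] at hS
        exact hd hv hS
      · rw [(h.inn ha hxA X).2 hv] at hS
        obtain ⟨w, hw, hwA, y, hy, hyw⟩ := (h.sm a ha).nb hB hX ⟨x, hx, hxA⟩
        rcases h.nb a ha y hy w hyw hwA with rfl | rfl | rfl
        · exact hv hw
        · exact hd hw hS
        · exact hd hw (show rep (z' a) ∈ S from h.rz a ha ▸ hS)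
    · push Not at hxA
      rw [out x hxA] at hS
      exact hd hx hS
lemma pull (h : St G B I v z z' A K rep) {W : Type} {H : SimpleGraph W} (hW : ∀ w, ∃ w', H.Adj w w')
    (hM : Minor (Gh G (Uu I A K) (sg I v z A rep Set.univ)) H) : ∃ M : W → Set V, (∀ w, Conn G (M w) ∧ M w ⊆ Uu I A K) ∧
      (∀ w w', w ≠ w' → Disjoint (M w) (M w')) ∧ (∀ w w', H.Adj w w' → Ed G (M w) (M w')) ∧
      ∀ w w', w ≠ w' → ∀ x ∈ M w, ∀ y ∈ M w', G.Adj x y → Hv (rst G (Uu I A K)) x → ¬ Hv (rst G (Uu I A K)) y := by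
  obtain ⟨μ, m1, m2, m3⟩ := hM
  set τ := sg I v z A rep Set.univ with hτ
  have ed : ∀ w w', H.Adj w w' → ∃ x ∈ Uu I A K, ∃ y ∈ Uu I A K, τ x ∈ μ w ∧ τ y ∈ μ w' ∧ G.Adj x y := by
    intro w w' hw
    obtain ⟨κ, hκ, κ', hκ', -, x, hx, y, hy, h1, rfl, rfl⟩ := m3 w w' hw
    grind
  refine ⟨fun w => {x | x ∈ Uu I A K ∧ τ x ∈ μ w}, fun w => ⟨⟨?_, ?_⟩, fun x hx => hx.1⟩, ?_, ?_, ?_⟩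
  · obtain ⟨w', hw⟩ := hW w
    obtain ⟨x, hx, _, _, h1, _⟩ := ed w w' hw
    exact ⟨x, hx, h1⟩
  · rintro P ⟨x, ⟨hx, hxμ⟩, hP⟩ hcl y ⟨hy, hyμ⟩
    have hb : ∀ x ∈ Uu I A K, τ x ∈ μ w → ∃ b, (∀ a ∈ I, b ∉ A a) ∧ rep b = τ x ∧ (P x ↔ P b) := by
      rintro x (hx | ⟨a, ha, hx⟩) hxμ
      · exact ⟨x, hx, (out x hx _).symm, Iff.rfl⟩
      · have hK : ∀ q ∈ insert (v a) (K a), τ q = rep (v a) ∧ q ∈ Uu I A K := by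
          rintro q (rfl | hq)
          · exact ⟨out _ (h.vA a ha) _, Or.inl (h.vA a ha)⟩
          · exact ⟨(h.inn ha (h.KA a ha hq) _).1 trivial, Or.inr ⟨a, ha, hq⟩⟩
        have e := (hK x (Or.inr hx)).1
        have cK := (h.cK a ha).ins (h.Kv a ha)
        have mem : ∀ q ∈ insert (v a) (K a), q ∈ Uu I A K ∧ τ q ∈ μ w := fun q hq => ⟨(hK q hq).2, by grind⟩
        have : ∀ s ∈ insert (v a) (K a), ∀ t ∈ insert (v a) (K a), P s → P t := fun s hs t ht hP =>
          cK.2 P ⟨s, hs, hP⟩ (fun i hi j hj => hcl i (mem i hi) j (mem j hj)) t ht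
        exact ⟨v a, h.vA a ha, e.symm, this _ (Or.inr hx) _ (Or.inl rfl), this _ (Or.inl rfl) _ (Or.inr hx)⟩
    have fib : ∀ x ∈ Uu I A K, ∀ y ∈ Uu I A K, τ x ∈ μ w → τ x = τ y → P x → P y := by
      intro x hx y hy hxμ e hP
      obtain ⟨b, hb1, hb2, hb3⟩ := hb x hx hxμ
      obtain ⟨d, hd1, hd2, hd3⟩ := hb y hy (e ▸ hxμ)
      rw [hd3]
      have hPb := hb3.1 hP
      rcases h.cl b d (by rw [hb2, hd2, e]) with rfl | h'
      · exact hPb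
      · exact hcl b ⟨Or.inl hb1, by rw [hτ, out b hb1, hb2]; exact hxμ⟩ d ⟨Or.inl hd1, by rw [hτ, out d hd1, hd2, ← e]; exact hxμ⟩ h' hPb
    obtain ⟨x1, hx1, e1, hP1⟩ := (m1 w).2 (fun κ => ∃ x ∈ Uu I A K, τ x = κ ∧ P x) ⟨_, hxμ, x, hx, rfl, hP⟩ (by
      rintro _ hκ _ hκ' ⟨-, s, hs, t, ht, hst, rfl, rfl⟩ ⟨x, hx, e, hP⟩
      grind) _ hyμ
    grind
  · exact fun w w' hw => Set.disjoint_left.2 fun x hx hx' => Set.disjoint_left.1 (m2 w w' hw) hx.2 hx'.2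
  · intro w w' hw
    obtain ⟨x, hx, y, hy, h1, h2, h3⟩ := ed w w' hw
    exact ⟨x, ⟨hx, h1⟩, y, ⟨hy, h2⟩, h3⟩
  · intro w w' hw x hx y hy hxy h1 h2
    obtain ⟨hx0, hy0, e⟩ := h.hv x y hxy h1 h2
    refine Set.disjoint_left.1 (m2 w w' hw) hx.2 ?_
    have := hy.2
    rw [hτ, out y hy0, ← e] at this
    rw [hτ, out x hx0]
    exact this
end St
end Paper

namespace Paper
variable {V W β : Type} {G : SimpleGraph V}
structure In (G : SimpleGraph V) (H : SimpleGraph β) (T : β → Set V) : Prop where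
  cn : ∀ i, Conn G (T i)
  dj : ∀ i j x, x ∈ T i → x ∈ T j → i = j
  b1 : ∀ i j, i ≠ j → ∀ x ∈ T i, ∀ y ∈ T j, G.Adj x y → H.Adj i j
  b2 : ∀ i j, i ≠ j → ∀ x ∈ T i, ∀ y ∈ T j, G.Adj x y → ∀ x' ∈ T i, ∀ y' ∈ T j, G.Adj x' y' → x = x'
  ed : ∀ i j, H.Adj i j → Ed G (T i) (T j)
  c : ∀ i, ∀ x ∈ T i, Conn G (T i \ {x}) → ∃ j ≠ i, ∃ y ∈ T j, G.Adj x y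
  d : ∀ i, ∀ f : Fin 4 → β, Function.Injective f → ∃ n, ¬ H.Adj i (f n)
lemma sd_none {H : SimpleGraph β} {i l j : β} : (subdivideEdge H i l).Adj none (some j) ↔ j = i ∨ j = l := by
  simp [subdivideEdge, SimpleGraph.fromRel_adj]
lemma sd_some {H : SimpleGraph β} {i l j m : β} :
    (subdivideEdge H i l).Adj (some j) (some m) ↔ H.Adj j m ∧ ¬ (j = i ∧ m = l) ∧ ¬ (j = l ∧ m = i) := by
  have := H.adj_comm j m
  have : H.Adj j m → j ≠ m := fun h => h.ne
  simp [subdivideEdge, SimpleGraph.fromRel_adj]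
  grind
lemma leaf_conn {T : Set V} {x t : V} (h : Conn G T) (ht : t ∈ T) (hne : t ≠ x) (hu : ∀ w ∈ T, G.Adj x w → w = t) : Conn G (T \ {x}) := by
  refine ⟨⟨t, ht, hne⟩, ?_⟩
  rintro P ⟨s, hs, hP⟩ hcl y hy
  have key : ∀ Q : V → Prop, (∃ s ∈ T \ {x}, Q s) → (∀ u ∈ T \ {x}, ∀ v ∈ T \ {x}, G.Adj u v → Q u → Q v) → Q t := by
    rintro Q ⟨s, hs, hQ⟩ hcl
    by_contra hQt
    have := h.2 (fun w => w ≠ x ∧ Q w) ⟨s, hs.1, hs.2, hQ⟩ (by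
      rintro u hu1 w hw huw ⟨h1, h2⟩
      by_cases hwx : w = x
      · subst hwx; exact absurd (hu u hu1 huw.symm ▸ h2) hQt
      grind) t ht
    exact hQt this.2
  have hPt := key P ⟨s, hs, hP⟩ hcl
  by_contra hPy
  exact key (fun w => ¬ P w) ⟨y, hy, hPy⟩ (fun u hu v hv huv h1 h2 => h1 (hcl v hv u hu huv.symm h2)) hPt
lemma Conn.nbr {T : Set V} {x w : V} (h : Conn G T) (hx : x ∈ T) (hw : w ∈ T) (hne : w ≠ x) : ∃ t ∈ T, G.Adj x t := by
  obtain ⟨u, hu, t, ht, rfl, _, h'⟩ := h.edge (T := {x}) ⟨x, hx, rfl⟩ ⟨w, hw, hne⟩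
  grind
lemma In.leaf {H : SimpleGraph β} {T : β → Set V} (h : In G H T)
    (h2 : ∀ x y y', G.Adj x y → G.Adj x y' → Hv G x → Hv G y → Hv G y' → y = y') {i : β} {x : V} (hx : x ∈ T i)
    (hc : Conn G (T i \ {x})) {y y' : V} (hy : y ∈ T i) (hy' : y' ∈ T i) (a : G.Adj x y) (a' : G.Adj x y') : y = y' := by
  by_contra hne
  have key : ∀ y y', y ∈ T i → y' ∈ T i → y ≠ y' → G.Adj x y → G.Adj x y' → Hv G y := by
    intro y y' hy hy' hne a a'
    by_contra hn
    obtain ⟨s, hs, hys⟩ := hc.nbr (x := y) ⟨hy, a.ne'⟩ (w := y') ⟨hy', a'.ne'⟩ hne.symm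
    have hN : ∀ w, G.Adj y w → w = x ∨ w = s := by
      intro w hw
      by_contra! h'
      exact hn ⟨x, s, w, Ne.symm hs.2, h'.1.symm, h'.2.symm, a.symm, hys, hw⟩
    have h3 : Conn G ((T i \ {x}) \ {y}) := leaf_conn hc hs hys.ne' fun w hw hyw => (hN w hyw).resolve_left hw.2
    have h4 : Conn G (T i \ {y}) := by
      have := h3.ins (x := x) ⟨y', ⟨⟨hy', a'.ne'⟩, hne.symm⟩, a'⟩
      convert this using 1
      ext w
      simp only [Set.mem_diff, Set.mem_singleton_iff, Set.mem_insert_iff]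
      have := a.ne
      grind
    obtain ⟨j, hj, w, hw, hyw⟩ := h.c i y hy h4
    rcases hN w hyw with rfl | rfl
    · exact hj (h.dj _ _ _ hw hx)
    · exact hj (h.dj _ _ _ hw hs.1)
  obtain ⟨j, hj, w, hw, hxw⟩ := h.c i x hx hc
  have hwn : ∀ y ∈ T i, y ≠ w := fun y hy e => hj (h.dj _ _ _ hw (e ▸ hy))
  exact hne (h2 x y y' a a' ⟨y, y', w, hne, hwn y hy, hwn y' hy', a, a', hxw⟩ (key y y' hy hy' hne a a')
    (key y' y hy' hy (Ne.symm hne) a' a))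
lemma In.split {H : SimpleGraph β} {T : β → Set V} (h : In G H T) {i l : β} {x t y : V} (hx : x ∈ T i)
    (hc : Conn G (T i \ {x})) (ht : t ∈ T i) (hxt : G.Adj x t) (htu : ∀ w ∈ T i, G.Adj x w → w = t) (hl : l ≠ i) (hy : y ∈ T l)
    (hxy : G.Adj x y) (hyu : ∀ j ≠ i, ∀ w ∈ T j, G.Adj x w → w = y) :
    In G (subdivideEdge H i l) (fun o => o.elim {x} fun j => T j \ {x}) := by
  have hj : ∀ j, j ≠ i → T j \ {x} = T j := fun j hj => Set.diff_singleton_eq_self fun h' => hj (h.dj _ _ _ h' hx)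
  have hjl : ∀ j ≠ i, ∀ w ∈ T j, G.Adj x w → w = y ∧ j = l := fun j hj w hw hxw => by
    have e := hyu j hj w hw hxw
    exact ⟨e, h.dj _ _ _ hw (e ▸ hy)⟩
  have hb1 : ∀ j, ∀ w ∈ T j, G.Adj x w → (subdivideEdge H i l).Adj none (some j) := fun j w hw hxw => by
    rw [sd_none]
    grind
  have hil : ∀ u ∈ T i \ {x}, ∀ w ∈ T l, ¬ G.Adj u w := fun u hu w hw huw =>
    hu.2 (h.b2 i l hl.symm u hu.1 w hw huw x hx y hy hxy)
  refine ⟨?_, ?_, ?_, ?_, ?_, ?_, ?_⟩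
  · rintro (_ | j)
    · exact conn_single G x
    · by_cases hji : j = i
      · grind
      · show Conn G (T j \ {x}); rw [hj j hji]; exact h.cn j
  · rintro (_ | j) (_ | m) w hw hw'
    · rfl
    · grind
    · grind
    · rw [h.dj j m w hw.1 hw'.1]
  · rintro (_ | j) (_ | m) hne u hu w hw huw
    · grind
    · grind
    · obtain rfl : w = x := hw
      exact (hb1 j u hu.1 huw.symm).symm
    · rw [sd_some]
      refine ⟨h.b1 j m (fun e => hne (e ▸ rfl)) u hu.1 w hw.1 huw, ?_, ?_⟩
      · grind
      · rintro ⟨rfl, rfl⟩; exact hil w hw u hu.1 huw.symm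
  · rintro (_ | j) (_ | m) hne u hu w hw huw u' hu' w' hw' huw'
    · grind
    · grind
    · obtain rfl : w = x := hw
      obtain rfl : w' = w := hw'
      by_cases hji : j = i
      · subst hji; rw [htu u hu.1 huw.symm, htu u' hu'.1 huw'.symm]
      · rw [hyu j hji u hu.1 huw.symm, hyu j hji u' hu'.1 huw'.symm]
    · exact h.b2 j m (fun e => hne (e ▸ rfl)) u hu.1 w hw.1 huw u' hu'.1 w' hw'.1 huw'
  · have h0 : ∀ j, (j = i ∨ j = l) → ∃ w ∈ T j \ {x}, G.Adj x w := by
      rintro j (rfl | rfl)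
      · exact ⟨t, ⟨ht, hxt.ne'⟩, hxt⟩
      grind
    rintro (_ | j) (_ | m) ha
    · exact absurd ha (SimpleGraph.irrefl _)
    · obtain ⟨w, hw, hxw⟩ := h0 m (sd_none.1 ha)
      exact ⟨x, rfl, w, hw, hxw⟩
    · obtain ⟨w, hw, hxw⟩ := h0 j (sd_none.1 ha.symm)
      exact ⟨w, hw, x, rfl, hxw.symm⟩
    · obtain ⟨h1, h2, h3⟩ := sd_some.1 ha
      obtain ⟨u, hu, w, hw, huw⟩ := h.ed j m h1
      refine ⟨u, ⟨hu, ?_⟩, w, ⟨hw, ?_⟩, huw⟩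
      · rintro rfl
        obtain rfl := h.dj _ _ _ hu hx
        exact h2 ⟨rfl, (hjl m h1.ne' w hw huw).2⟩
      · rintro rfl
        obtain rfl := h.dj _ _ _ hw hx
        exact h3 ⟨(hjl j h1.ne u hu huw.symm).2, rfl⟩
  · have mem : ∀ j w, w ∈ T j → (w = x ∧ j = i) ∨ w ∈ T j \ {x} := fun j w hw => by grind
    have out : ∀ j u, u ≠ x → (∃ m ≠ j, ∃ w ∈ T m, G.Adj u w) → ∃ o, o ≠ some j ∧ ∃ w ∈ (o.elim {x} fun j => T j \ {x} : Set V), G.Adj u w := by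
      rintro j u hux ⟨m, hm, w, hw, huw⟩
      rcases mem m w hw with ⟨rfl, _⟩ | h'
      · exact ⟨none, by simp, w, rfl, huw⟩
      · exact ⟨some m, by simpa using hm, w, h', huw⟩
    rintro (_ | j) u hu hcu
    · obtain ⟨s, hs1, hs2⟩ := hcu.1
      grind
    · by_cases hji : j = i
      · subst hji
        by_cases hux : G.Adj u x
        · exact ⟨none, by simp, x, rfl, hux⟩
        · refine out j u hu.2 (h.c j u hu.1 ?_)
          have := Conn.ins (x := x) hcu ⟨t, ⟨⟨ht, hxt.ne'⟩, fun e => hux (e ▸ hxt.symm)⟩, hxt⟩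
          convert this using 1
          grind
      · refine out j u hu.2 (h.c j u hu.1 ?_)
        grind
  · classical
    intro o f hf
    by_contra! hn
    rcases o with _ | j
    · have h4 : ∀ n, f n = some i ∨ f n = some l := fun n => by
        have := hn n
        rcases hfn : f n with _ | m
        · rw [hfn] at this; exact absurd this (SimpleGraph.irrefl _)
        · rw [hfn, sd_none] at this; simpa using this
      have e01 := hf.ne (show (0 : Fin 4) ≠ 1 by decide)
      have e02 := hf.ne (show (0 : Fin 4) ≠ 2 by decide)
      grind
    · obtain ⟨n, hn'⟩ := h.d j (fun n => (f n).elim (if j = i then l else i) id) (by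
        intro n n' e
        apply hf
        have h1 := hn n
        have h2 := hn n'
        dsimp only at e
        revert e h1 h2
        rcases f n with _ | m <;> rcases f n' with _ | m' <;> intro e h1 h2 <;> simp only [Option.elim, id] at e
        · rfl
        · have := sd_none.1 h1.symm; have := sd_some.1 h2; grind
        · have := sd_none.1 h2.symm; have := sd_some.1 h1; grind
        · rw [e])
      apply hn'
      have h1 := hn n
      rcases hfn : f n with _ | m
      · have hil : H.Adj i l := h.b1 i l hl.symm x hx y hy hxy
        rw [hfn] at h1
        rcases sd_none.1 h1.symm with rfl | rfl
        · simpa using hil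
        · simpa [hl] using hil.symm
      · rw [hfn] at h1; exact (sd_some.1 h1).1
theorem In.sub [Finite V] {β : Type} {H : SimpleGraph β} {T : β → Set V} (h : In G H T)
    (h2 : ∀ x y y', G.Adj x y → G.Adj x y' → Hv G x → Hv G y → Hv G y' → y = y') (S : Set V)
    (hS : ∀ v, v ∈ S ↔ ∃ i, v ∈ T i) : IsSubdivision (G.induce S) H := by
  induction hn : {v | ∃ i, v ∈ T i ∧ ∃ w ∈ T i, w ≠ v}.ncard using Nat.strong_induction_on generalizing β with
  | _ n ih =>
    by_cases hs : ∃ i, ∃ v ∈ T i, ∃ w ∈ T i, w ≠ v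
    · obtain ⟨i, v, hv, hw⟩ := hs
      obtain ⟨x1, hx1, hx1v, c1⟩ := (h.cn i).noncut hv hw
      obtain ⟨x2, hx2, hne, c2⟩ := (h.cn i).noncut hx1 ⟨v, hv, hx1v.symm⟩
      have key : ∃ x ∈ T i, ∃ w ∈ T i, w ≠ x ∧ Conn G (T i \ {x}) ∧ ∃ l ≠ i, ∃ y ∈ T l, G.Adj x y ∧
          ∀ j ≠ i, ∀ w ∈ T j, G.Adj x w → w = y := by
        by_contra! hno
        have two : ∀ x ∈ T i, (∃ w ∈ T i, w ≠ x) → Conn G (T i \ {x}) → ∃ l ≠ i, ∃ y ∈ T l, ∃ m ≠ i, ∃ w ∈ T m, G.Adj x y ∧ G.Adj x w ∧ l ≠ m := by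
          rintro x hx ⟨w, hw, hwx⟩ hc
          obtain ⟨l, hl, y, hy, hxy⟩ := h.c i x hx hc
          obtain ⟨m, hm, s, hs, hxs, hsy⟩ := hno x hx w hw hwx hc l hl y hy hxy
          refine ⟨l, hl, y, hy, m, hm, s, hs, hxy, hxs, ?_⟩
          rintro rfl
          exact hsy (h.b2 l i hl s hs x hx hxs.symm y hy x hx hxy.symm)
        obtain ⟨l1, hl1, y1, hy1, m1, hm1, w1, hw1, a1, b1, e1⟩ := two x1 hx1 ⟨x2, hx2, hne⟩ c1
        obtain ⟨l2, hl2, y2, hy2, m2, hm2, w2, hw2, a2, b2, e2⟩ := two x2 hx2 ⟨x1, hx1, hne.symm⟩ c2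
        have dif : ∀ l m, l ≠ i → ∀ y ∈ T l, ∀ w ∈ T m, G.Adj x1 y → G.Adj x2 w → l ≠ m := by
          rintro l m hl y hy w hw h1 h2 rfl
          exact hne (h.b2 i l hl.symm x1 hx1 y hy h1 x2 hx2 w hw h2).symm
        obtain ⟨n, hn⟩ := h.d i ![l1, m1, l2, m2] (by
          have := dif l1 l2 hl1 y1 hy1 y2 hy2 a1 a2
          have := dif l1 m2 hl1 y1 hy1 w2 hw2 a1 b2
          have := dif m1 l2 hm1 w1 hw1 y2 hy2 b1 a2
          have := dif m1 m2 hm1 w1 hw1 w2 hw2 b1 b2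
          intro p q
          fin_cases p <;> fin_cases q <;> simp <;> grind)
        apply hn
        fin_cases n
        exacts [h.b1 i l1 hl1.symm x1 hx1 y1 hy1 a1, h.b1 i m1 hm1.symm x1 hx1 w1 hw1 b1, h.b1 i l2 hl2.symm x2 hx2 y2 hy2 a2,
          h.b1 i m2 hm2.symm x2 hx2 w2 hw2 b2]
      obtain ⟨x, hx, w, hw, hwx, hc, l, hl, y, hy, hxy, hyu⟩ := key
      obtain ⟨t, ht, hxt⟩ := (h.cn i).nbr hx hw hwx
      refine IsSubdivision.step i l (h.b1 i l hl.symm x hx y hy hxy) (ih _ ?_ (h.split hx hc ht hxt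
        (fun w hw hxw => h.leaf h2 hx hc hw ht hxw hxt) hl hy hxy hyu) ?_ rfl)
      · rw [← hn]
        apply Set.ncard_lt_ncard _ (Set.toFinite _)
        refine ⟨?_, fun hsub => ?_⟩
        · rintro v ⟨_ | j, hv, w, hw, hwv⟩
          · grind
          grind
        · obtain ⟨_ | j, hv, s, hs, hsv⟩ := hsub (show x ∈ _ from ⟨i, hx, w, hw, hwx⟩)
          · exact hsv hs
          · exact hv.2 rfl
      · intro v
        rw [hS]
        constructor
        · rintro ⟨j, hj⟩
          by_cases e : v = x
          · exact ⟨none, e⟩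
          · exact ⟨some j, hj, e⟩
        · rintro ⟨_ | j, hj⟩
          · grind
          · exact ⟨j, hj.1⟩
    · push Not at hs
      choose f hf using fun i => (h.cn i).1
      have hfi : ∀ i x, x ∈ T i → x = f i := fun i x hx => hs i (f i) (hf i) x hx
      refine IsSubdivision.base ⟨RelIso.symm ⟨Equiv.ofBijective (fun i => (⟨f i, (hS _).2 ⟨i, hf i⟩⟩ : S)) ⟨?_, ?_⟩, ?_⟩⟩
      · intro i j e
        have e : f i = f j := congrArg Subtype.val e
        exact h.dj _ _ _ (hf i) (e ▸ hf j)
      · rintro ⟨v, hv⟩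
        grind
      · intro i j
        show G.Adj (f i) (f j) ↔ H.Adj i j
        constructor
        · intro ha
          exact h.b1 i j (fun e => ha.ne (e ▸ rfl)) _ (hf i) _ (hf j) ha
        · intro ha
          obtain ⟨x, hx, y, hy, hxy⟩ := h.ed i j ha
          grind
end Paper

namespace Paper
variable {V W : Type} {G : SimpleGraph V} {H : SimpleGraph W}
def Mn (G : SimpleGraph V) (H : SimpleGraph W) (T : W → Set V) : Prop :=
  (∀ w, Conn G (T w)) ∧ (∀ i j x, x ∈ T i → x ∈ T j → i = j) ∧ (∀ w w', H.Adj w w' → Ed G (T w) (T w')) ∧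
    ∀ w, ∀ x ∈ T w, Conn G (T w \ {x}) → ∃ w', H.Adj w w' ∧ ∀ u ∈ T w, ∀ y ∈ T w', G.Adj u y → u = x
lemma exists_mn [Finite V] [Finite W] {M : W → Set V} (hc : ∀ w, Conn G (M w)) (hd : ∀ i j x, x ∈ M i → x ∈ M j → i = j)
    (he : ∀ w w', H.Adj w w' → Ed G (M w) (M w')) : ∃ T, (∀ w, T w ⊆ M w) ∧ Mn G H T := by
  classical
  obtain ⟨T, ⟨h1, h2, h3⟩, hm⟩ := Set.Finite.exists_minimal (s := {T : W → Set V | (∀ w, T w ⊆ M w) ∧ (∀ w, Conn G (T w)) ∧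
    ∀ w w', H.Adj w w' → Ed G (T w) (T w')}) (Set.toFinite _) ⟨M, fun _ => subset_rfl, hc, he⟩
  refine ⟨T, h1, h2, fun i j x hi hj => hd i j x (h1 i hi) (h1 j hj), h3, fun w x hx hcx => ?_⟩
  by_contra! hn
  have hle : Function.update T w (T w \ {x}) ≤ T := by
    intro i
    grind
  have key : ∀ w', H.Adj w w' → Ed G (T w \ {x}) (T w') := fun w' hw => by
    obtain ⟨u, hu, y, hy, huy, hne⟩ := hn w' hw
    exact ⟨u, ⟨hu, hne⟩, y, hy, huy⟩
  have := hm (y := Function.update T w (T w \ {x})) ⟨fun i => (hle i).trans (h1 i), fun i => ?_, fun i j hij => ?_⟩ hle w hx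
  · simp at this
  · grind
  · by_cases e : i = w
    · subst e; simpa [hij.ne'] using key j hij
    · by_cases e' : j = w
      · subst e'; simpa [e] using (key i hij.symm).symm
      grind
lemma Mn.uniq {T : W → Set V} (h : Mn G H T) {i j l l' : W} (hl : H.Adj i l) (hl' : H.Adj i l') (hne : l ≠ l') {x y : V}
    (hx : x ∈ T i) (hxn : ¬ Hv G x) (hy : y ∈ T j) (hji : i ≠ j) (hxy : G.Adj x y) :
    H.Adj i j ∧ ∀ x' ∈ T i, ∀ y' ∈ T j, G.Adj x' y' → x = x' ∧ y = y' := by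
  obtain ⟨hc, hd, he, hm⟩ := h
  have hnx : ∀ a b d, G.Adj x a → G.Adj x b → G.Adj x d → a ≠ b → a ≠ d → b = d := by
    intro a b d h1 h2 h3 h4 h5
    by_contra h6
    exact hxn ⟨a, b, d, h4, h5, h6, h1, h2, h3⟩
  by_cases hs : ∃ w ∈ T i, w ≠ x
  · obtain ⟨w, hw, hwx⟩ := hs
    obtain ⟨t, ht, hxt⟩ := (hc i).nbr hx hw hwx
    have hne : ∀ m, i ≠ m → ∀ s ∈ T m, t ≠ s := fun m hm s hs e => hm (hd i m t ht (e ▸ hs))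
    have hty := hne j hji y hy
    obtain ⟨m, him, hum⟩ := hm i x hx (leaf_conn (hc i) ht hxt.ne' fun w hw hxw => by
      grind)
    obtain ⟨u, hu, s, hs, hus⟩ := he i m him
    obtain rfl := hum u hu s hs hus
    obtain rfl := hnx t y s hxt hxy hus hty (hne m him.ne s hs)
    grind
  · push Not at hs
    have hadj : ∀ m, H.Adj i m → ∃ s ∈ T m, G.Adj x s := fun m him => by
      obtain ⟨u, hu, s, hs', hus⟩ := he i m him
      grind
    obtain ⟨s, hs1, hs2⟩ := hadj l hl
    obtain ⟨s', hs1', hs2'⟩ := hadj l' hl'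
    have hss : s ≠ s' := fun e => hne (hd l l' s hs1 (e ▸ hs1'))
    have hor : ∀ y ∈ T j, G.Adj x y → (y = s ∧ j = l) ∨ (y = s' ∧ j = l') := by
      intro y hy hxy
      by_cases e : s = y
      · grind
      grind
    grind
def emb {k : ℕ} (w : Fin k × Fin (2 * k)) : Fin (k + 2) × Fin (2 * (k + 2)) := (⟨w.1 + 1, om⟩, ⟨w.2 + 1, om⟩)
lemma emb_adj {k : ℕ} (w w' : Fin k × Fin (2 * k)) : (Wall (k + 2)).Adj (emb w) (emb w') ↔ (Wall k).Adj w w' := by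
  obtain ⟨a, b⟩ := w
  obtain ⟨a', b'⟩ := w'
  simp only [Wall, emb, SimpleGraph.fromRel_adj, ne_eq, Prod.mk.injEq, Fin.ext_iff]
  omega
lemma row_nbr {r i : ℕ} {j j' : ℕ} (hi : i < r) (hj : j < 2 * r) (hj' : j' < 2 * r) (h : j + 1 = j') :
    (Wall r).Adj (⟨i, hi⟩, ⟨j, hj⟩) (⟨i, hi⟩, ⟨j', hj'⟩) := by
  subst h
  simp [Wall, SimpleGraph.fromRel_adj]
lemma wall_deg {k : ℕ} (w : Fin k × Fin (2 * k)) (f : Fin 4 → Fin k × Fin (2 * k)) (hf : Function.Injective f) :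
    ∃ n, ¬ (Wall k).Adj w (f n) := by
  by_contra! h
  have key : ∀ n, ((f n).1.val = w.1 ∧ (f n).2.val + 1 = w.2) ∨ ((f n).1.val = w.1 ∧ (f n).2.val = w.2 + 1) ∨
      ((f n).2.val = w.2 ∧ (f n).1.val + 2 * ((w.1 + w.2) % 2) = w.1 + 1) := by
    intro n
    have := h n
    simp only [Wall, SimpleGraph.fromRel_adj, ne_eq, Fin.ext_iff] at this
    omega
  have : ∀ n, ∃ t : Fin 3, (f n).1.val + (t.val / 2) * 2 * ((w.1 + w.2) % 2) = w.1 + t.val / 2 ∧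
      (f n).2.val + (if t.val = 0 then 1 else 0) = w.2 + (if t.val = 1 then 1 else 0) := fun n => by
    rcases key n with h | h | h
    · exact ⟨0, by simp [h]⟩
    · exact ⟨1, by simp [h]⟩
    · exact ⟨2, by simp [h]⟩
  choose t ht using this
  obtain ⟨n, m, hnm, e⟩ := Fintype.exists_ne_map_eq_of_card_lt t (by simp)
  grind
lemma wall_ext [Finite V] {k : ℕ} {M : Fin (k + 2) × Fin (2 * (k + 2)) → Set V} (hc : ∀ w, Conn G (M w))
    (hd : ∀ i j x, x ∈ M i → x ∈ M j → i = j) (he : ∀ w w', (Wall (k + 2)).Adj w w' → Ed G (M w) (M w'))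
    (h1 : ∀ w w', w ≠ w' → ∀ x ∈ M w, ∀ y ∈ M w', G.Adj x y → Hv G x → ¬ Hv G y)
    (h2 : ∀ x y y', G.Adj x y → G.Adj x y' → Hv G x → Hv G y → Hv G y' → y = y') :
    ∃ S, (∀ x ∈ S, ∃ w, x ∈ M w) ∧ IsSubdivision (G.induce S) (Wall k) := by
  obtain ⟨T, hTM, hT⟩ := exists_mn hc hd he
  have hi : ∀ w w' : Fin k × Fin (2 * k), emb w = emb w' → w = w' := fun w w' e => by
    simp only [emb, Prod.mk.injEq, Fin.mk.injEq] at e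
    grind
  obtain ⟨R, hRT, hR⟩ := exists_mn (H := Wall k) (M := fun w => T (emb w)) (fun w => hT.1 _) (fun i j x h h' => hi _ _ (hT.2.1 _ _ x h h'))
    fun w w' h => hT.2.2.1 _ _ ((emb_adj w w').2 h)
  have key : ∀ i j, i ≠ j → ∀ x ∈ R i, ∀ y ∈ R j, G.Adj x y → (Wall k).Adj i j ∧ ∀ x' ∈ R i, ∀ y' ∈ R j, G.Adj x' y' → x = x' ∧ y = y' := by
    have key : ∀ i j, i ≠ j → ∀ x ∈ R i, ∀ y ∈ R j, G.Adj x y → ¬ Hv G x → (Wall k).Adj i j ∧ ∀ x' ∈ R i, ∀ y' ∈ R j, G.Adj x' y' → x = x' ∧ y = y' := by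
      intro i j hij x hx y hy hxy hxn
      have := hT.uniq (i := emb i) (j := emb j) (row_nbr om (j := i.2) om om rfl).symm
        (row_nbr om om (j' := i.2 + 2) om rfl) (by simp) (hRT i hx) hxn (hRT j hy)
        (fun e => hij (hi _ _ e)) hxy
      exact ⟨(emb_adj i j).1 this.1, fun x' hx' y' hy' => this.2 x' (hRT i hx') y' (hRT j hy')⟩
    intro i j hij x hx y hy hxy
    by_cases hxn : Hv G x
    · have hyn := h1 _ _ (fun e => hij (hi _ _ e)) x (hTM _ (hRT i hx)) y (hTM _ (hRT j hy)) hxy hxn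
      obtain ⟨h3, h4⟩ := key j i hij.symm y hy x hx hxy.symm hyn
      exact ⟨h3.symm, fun x' hx' y' hy' h' => (h4 y' hy' x' hx' h'.symm).symm⟩
    · exact key i j hij x hx y hy hxy hxn
  refine ⟨{v | ∃ i, v ∈ R i}, fun x ⟨i, hx⟩ => ⟨_, hTM _ (hRT i hx)⟩, In.sub (T := R) ⟨hR.1, hR.2.1,
    fun i j hij x hx y hy h => (key i j hij x hx y hy h).1,
    fun i j hij x hx y hy h x' hx' y' hy' h' => ((key i j hij x hx y hy h).2 x' hx' y' hy' h').1, hR.2.2.1, fun i x hx hcx => ?_,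
    wall_deg⟩ h2 _ fun v => Iff.rfl⟩
  obtain ⟨j, hij, hu⟩ := hR.2.2.2 i x hx hcx
  obtain ⟨u, hu1, y, hy, huy⟩ := hR.2.2.1 i j hij
  exact ⟨j, hij.ne', y, hy, hu u hu1 y hy huy ▸ huy⟩
lemma crit_wall [Finite V] {B : Set (Set V)} {c k m : ℕ} (hC : CP G) (hT : Tf G) (hc : Crit G B c) (h4 : 4 ≤ c) (hm : 2 * m ≤ c)
    (hg : ∀ (V : Type) [Finite V] (G : SimpleGraph V) (B : Set (Set V)), Bram G B m → Minor G (Wall (k + 2))) :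
    ContainsWallSubdiv G k := by
  obtain ⟨I, v, z, z', A, K, rep, h⟩ := st_ex hC hT hc h4
  obtain ⟨B', hB'⟩ := h.bram hT hc.1 hm
  obtain ⟨M, h1, h2, h3, h5⟩ := h.pull (fun w => by
    obtain ⟨⟨i, hi⟩, j, hj⟩ := w
    by_cases hj0 : j = 0
    · exact ⟨(⟨i, hi⟩, ⟨1, om⟩), row_nbr hi hj _ om⟩
    · exact ⟨(⟨i, hi⟩, ⟨j - 1, om⟩), (row_nbr hi _ hj om).symm⟩) (hg _ _ _ hB')
  obtain ⟨S, hS, hsub⟩ := wall_ext (G := rst G (Uu I A K)) (M := M) (fun w => (h1 w).1.rst (h1 w).2)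
    (fun i j x hi hj => by by_contra e; exact Set.disjoint_left.1 (h2 i j e) hi hj)
    (fun w w' hw => by
      obtain ⟨x, hx, y, hy, hxy⟩ := h3 w w' hw
      exact ⟨x, hx, y, hy, hxy, (h1 w).2 hx, (h1 w').2 hy⟩)
    (fun w w' hw x hx y hy hxy => h5 w w' hw x hx y hy hxy.1)
    (fun x y y' a1 a2 hx hy hy' => by
      have e1 := (h.hv x y a1.1 hx hy).2.2
      have e2 := (h.hv x y' a2.1 hx hy').2.2
      exact (h.cl y y' (e1.symm.trans e2)).resolve_right fun h' => hT x y y' a1.1 h' a2.1)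
  have e : (rst G (Uu I A K)).induce S = G.induce S := by
    ext ⟨x, hx⟩ ⟨y, hy⟩
    obtain ⟨w, hw⟩ := hS x hx
    obtain ⟨w', hw'⟩ := hS y hy
    exact ⟨fun h => h.1, fun h => ⟨h, (h1 w).2 hw, (h1 w').2 hw'⟩⟩
  rw [e] at hsub
  exact ⟨S, _, hsub, S, ⟨RelIso.refl _⟩⟩
lemma bram_wall (k : ℕ) : ∃ c, ∀ (V : Type) [Finite V] (G : SimpleGraph V) (B : Set (Set V)), CP G → Tf G → Bram G B c → ContainsWallSubdiv G k := by
  obtain ⟨m, hg⟩ := grid (k + 2)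
  refine ⟨2 * m + 4, fun V _ G B => ?_⟩
  induction hn : Nat.card V using Nat.strong_induction_on generalizing V with
  | _ n ih =>
    intro hC hT hB
    by_cases hc : ∀ B', Bram G B' (2 * m + 4) → ∀ v, ∃ X ∈ B', v ∈ X
    · exact crit_wall hC hT ⟨hB, hc⟩ om om hg
    push Not at hc
    obtain ⟨B', hB', v, hv⟩ := hc
    set s : Set V := {x | x ≠ v}
    have im : ∀ D : Set s, Conn (G.induce s) D → Conn G (Subtype.val '' D) := fun D hD =>
      hD.map Subtype.val fun u _ w _ h => Or.inr h
    have nm : ∀ (D : Set s) (x : s), x ∉ D → x.1 ∉ Subtype.val '' D := by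
      rintro D x hx ⟨y, hy, e⟩; grind
    have ex : ∀ (D : Set s) (x : s), (∃ d ∈ D, (G.induce s).Adj x d) → ∃ d ∈ Subtype.val '' D, G.Adj x.1 d := by
      rintro D x ⟨d, hd, h⟩; exact ⟨d, ⟨d, hd, rfl⟩, h⟩
    obtain ⟨α, S, h1, t, ⟨e⟩⟩ := ih (Nat.card s) (by
        rw [← hn]
        exact Finite.card_subtype_lt (p := fun x => x ≠ v) (x := v) (by simp)) s inferInstance (G.induce s)
      ((fun X => Subtype.val ⁻¹' X) '' B') rfl
      (fun v x y D D' a1 a2 hne c1 c2 hA n1 n2 n3 n4 n5 n6 e1 e2 e3 e4 =>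
        hC v x y (Subtype.val '' D) (Subtype.val '' D') a1 a2 (fun e => hne (Subtype.ext e)) (im D c1) (im D' c2)
          (by rintro _ ⟨p, hp, rfl⟩ _ ⟨q, hq, rfl⟩; exact ⟨fun e => (hA p hp q hq).1 (Subtype.ext e), (hA p hp q hq).2⟩)
          (nm _ _ n1) (nm _ _ n2) (nm _ _ n3) (nm _ _ n4) (nm _ _ n5) (nm _ _ n6) (ex _ _ e1) (ex _ _ e2) (ex _ _ e3) (ex _ _ e4))
      (fun x y z h1 h2 h3 => hT x y z h1 h2 h3) (by
        have hs : ∀ X ∈ B', ∀ x ∈ X, x ∈ s := fun X hX x hx e => hv X hX (e ▸ hx)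
        refine ⟨?_, ?_, fun S hS => ?_⟩
        · rintro _ ⟨X, hX, rfl⟩
          obtain ⟨⟨x, hx⟩, hc⟩ := hB'.1 X hX
          refine ⟨⟨⟨x, hs X hX x hx⟩, hx⟩, ?_⟩
          rintro P ⟨x, hx, hP⟩ hcl y hy
          obtain ⟨_, h⟩ := hc (fun y => ∃ h, P ⟨y, h⟩) ⟨x, hx, x.2, hP⟩ (by
            rintro u hu w hw huw ⟨h, hP⟩
            exact ⟨hs X hX w hw, hcl ⟨u, h⟩ hu ⟨w, _⟩ hw huw hP⟩) y hy
          exact h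
        · rintro _ ⟨X, hX, rfl⟩ _ ⟨Y, hY, rfl⟩
          obtain ⟨x, hx, y, hy, h⟩ := hB'.2.1 X hX Y hY
          exact ⟨⟨x, hs X hX x hx⟩, hx, ⟨y, hs Y hY y hy⟩, hy, h.imp (fun e => Subtype.ext e) id⟩
        · obtain ⟨X, hX, hd⟩ := hB'.2.2 (Subtype.val '' S) ((Set.ncard_image_le (Set.toFinite _)).trans hS)
          exact ⟨_, ⟨X, hX, rfl⟩, Set.disjoint_left.2 fun x hx hxS => Set.disjoint_left.1 hd hx ⟨x, hxS, rfl⟩⟩)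
    refine ⟨α, S, h1, Subtype.val '' t, ⟨e.trans ⟨(Equiv.Set.image Subtype.val t Subtype.val_injective), ?_⟩⟩⟩
    intro a b
    exact Iff.rfl
theorem main9 (k : ℕ) :
    ∃ c : ℕ, ∀ (V : Type) [Fintype V] (G : SimpleGraph V),
      MemF 2 G → ¬HasStarCutset G → ¬HasTreewidthAtMost G c →
        ContainsWallSubdiv G k := by
  obtain ⟨c, hc⟩ := bram_wall k
  refine ⟨3 * c + 2, fun V _ G hG _ ht => ?_⟩
  obtain ⟨B, hB⟩ := tw_bramble ht
  exact hc V G B (cp_of_sparse hG.1.1 (tf_of_memF hG)) (tf_of_memF hG) hB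
end Paper

namespace Paper

/-- Theorem `t=2`. -/
theorem statement9 (k : ℕ) :
    ∃ c : ℕ, ∀ (V : Type) [Fintype V] (G : SimpleGraph V),
      MemF 2 G → ¬HasStarCutset G → ¬HasTreewidthAtMost G c →
        ContainsWallSubdiv G k := by
  exact main9 k

end Paper
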